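/- Let n ≥ 2 and let R(Y,X₁,…,Xₙ) ∈ ℤ[Y,X₁,…,Xₙ] be monic in Y and be an n-genuine polynomial that is not a strongly n-genuine polynomial. Then there exists an integer e = e(n) ≥ 1 depending only on n, and a constant C depending only on n and deg R, such that for every integer d ≥ 1 and every real B ≥ 1: #{x ∈ [−B,B]ⁿ ∩ (d^{−1}ℤ)ⁿ : there exists y ∈ ℤ with R(y,x) = 0} ≤ C · (log(‖R‖+2))^{e} · (dB)^{n−1} · (log(d(B+2)))^{2e}. -/

import Mathlib

open Polynomial

noncomputable section

/-- The rational function field `ℚ(X₁,…,Xₙ)`. -/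
abbrev RF (n : ℕ) := FractionRing (MvPolynomial (Fin n) ℚ)

/-- Base change a polynomial `F ∈ ℤ[Y,X₁,…,Xₙ]` (written as a polynomial in `Y`
with coefficients in `ℤ[X₁,…,Xₙ]`) to `ℚ[Y,X₁,…,Xₙ]`. -/
def toQ {n : ℕ} (F : Polynomial (MvPolynomial (Fin n) ℤ)) :
    Polynomial (MvPolynomial (Fin n) ℚ) :=
  F.map (MvPolynomial.map (Int.castRingHom ℚ))

/-- View a polynomial in `ℚ[X][Y]` as a polynomial in `ℚ(X)[Y]`. -/
def toFracQ {n : ℕ} (F : Polynomial (MvPolynomial (Fin n) ℚ)) : Polynomial (RF n) :=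
  F.map (algebraMap (MvPolynomial (Fin n) ℚ) (RF n))

/-- View a polynomial in `ℤ[X][Y]` as a polynomial in `ℚ(X)[Y]`. -/
def toFrac {n : ℕ} (F : Polynomial (MvPolynomial (Fin n) ℤ)) : Polynomial (RF n) :=
  toFracQ (toQ F)

/-- The degree of `F(Y,X)` in the variable `Xᵢ`. -/
def degX {n : ℕ} {R : Type*} [CommSemiring R]
    (F : Polynomial (MvPolynomial (Fin n) R)) (i : Fin n) : ℕ :=
  F.support.sup fun k => (F.coeff k).degreeOf i

/-- The total degree of `F(Y,X₁,…,Xₙ)` as a polynomial in `n+1` variables. -/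
def totalDeg {n : ℕ} {R : Type*} [CommSemiring R]
    (F : Polynomial (MvPolynomial (Fin n) R)) : ℕ :=
  F.support.sup fun k => k + (F.coeff k).totalDegree

/-- `‖g‖`: the maximum absolute value of a coefficient of `g ∈ ℤ[X₁,…,Xₙ]`. -/
def mvNorm {n : ℕ} (g : MvPolynomial (Fin n) ℤ) : ℕ :=
  g.support.sup fun m => (g.coeff m).natAbs

/-- `‖F‖`: the maximum absolute value of a coefficient of `F ∈ ℤ[Y,X₁,…,Xₙ]`. -/
def polyNorm {n : ℕ} (F : Polynomial (MvPolynomial (Fin n) ℤ)) : ℕ :=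
  F.support.sup fun k => mvNorm (F.coeff k)

/-- The counting function
`N(F,B) = #{x ∈ ℤⁿ ∩ [−B,B]ⁿ : ∃ y ∈ ℤ, F(y,x) = 0}`. -/
def NFB {n : ℕ} (F : Polynomial (MvPolynomial (Fin n) ℤ)) (B : ℝ) : ℕ :=
  Set.ncard {x : Fin n → ℤ | (∀ i, |(x i : ℝ)| ≤ B) ∧
    ∃ y : ℤ, Polynomial.eval y (F.map (MvPolynomial.eval x)) = 0}

/-- `F ∈ ℤ[Y,X₁,…,Xₙ]` is absolutely irreducible: irreducible over `ℚ̄`. -/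
def AbsIrred {n : ℕ} (F : Polynomial (MvPolynomial (Fin n) ℤ)) : Prop :=
  Irreducible (F.map (MvPolynomial.map (Int.castRingHom (AlgebraicClosure ℚ))))

/-- `G` has positive degree in `Y` and in each variable `Xᵢ`. -/
def AllPosDeg {n : ℕ} (G : Polynomial (MvPolynomial (Fin n) ℤ)) : Prop :=
  0 < G.natDegree ∧ ∀ i : Fin n, 0 < degX G i

/-- A field extension `M` of `ℚ(X₁,…,Xₙ)` is an `n`-genuine extension: every
`G ∈ ℤ[Y,X₁,…,Xₙ]` irreducible over `ℚ(X)` with `M ≅ ℚ(X)[Y]/(G)` has positive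
degree in each of `Y, X₁, …, Xₙ`. -/
def IsGenuineExt (n : ℕ) (M : Type*) [Field M] [Algebra (RF n) M] : Prop :=
  ∀ G : Polynomial (MvPolynomial (Fin n) ℤ), Irreducible (toFrac G) →
    Nonempty (AdjoinRoot (toFrac G) ≃ₐ[RF n] M) → AllPosDeg G

/-- A field extension `M` of `ℚ(X₁,…,Xₙ)` is strongly `n`-genuine: every
intermediate field strictly containing `ℚ(X)` is `n`-genuine. -/
def IsStronglyGenuineExt (n : ℕ) (M : Type*) [Field M] [Algebra (RF n) M] : Prop :=
  ∀ M' : IntermediateField (RF n) M, M' ≠ ⊥ → IsGenuineExt n M'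

/-- The extension `ℚ(X)[Y]/(Fq)` presented by `Fq ∈ ℚ[X][Y]` is `n`-genuine. -/
def GenuineExtOfQ {n : ℕ} (Fq : Polynomial (MvPolynomial (Fin n) ℚ)) : Prop :=
  ∀ G : Polynomial (MvPolynomial (Fin n) ℤ), Irreducible (toFrac G) →
    Nonempty (AdjoinRoot (toFrac G) ≃ₐ[RF n] AdjoinRoot (toFracQ Fq)) → AllPosDeg G

/-- The extension `ℚ(X)[Y]/(Fq)` presented by `Fq ∈ ℚ[X][Y]` is strongly
`n`-genuine: for any field `M` isomorphic over `ℚ(X)` to `ℚ(X)[Y]/(Fq)`, every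
intermediate field strictly containing `ℚ(X)` is `n`-genuine. -/
def StronglyGenuineExtOfQ {n : ℕ} (Fq : Polynomial (MvPolynomial (Fin n) ℚ)) : Prop :=
  ∀ (M : Type) [Field M] [Algebra (RF n) M],
    Nonempty (AdjoinRoot (toFracQ Fq) ≃ₐ[RF n] M) → IsStronglyGenuineExt n M

/-- An absolutely irreducible `F ∈ ℤ[Y,X₁,…,Xₙ]` is an `n`-genuine polynomial. -/
def IsGenuinePoly {n : ℕ} (F : Polynomial (MvPolynomial (Fin n) ℤ)) : Prop :=
  AbsIrred F ∧ GenuineExtOfQ (toQ F)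

/-- An absolutely irreducible `F ∈ ℤ[Y,X₁,…,Xₙ]` is a strongly `n`-genuine polynomial. -/
def IsStronglyGenuinePoly {n : ℕ} (F : Polynomial (MvPolynomial (Fin n) ℤ)) : Prop :=
  AbsIrred F ∧ StronglyGenuineExtOfQ (toQ F)

/-- The ring map `ℚ[X₁,…,Xₙ] → ℚ[X₁,…,Xₙ]` induced by the linear substitution
`Xᵢ ↦ Σⱼ σᵢⱼ Xⱼ`. -/
def lsubMv {n : ℕ} (σ : Matrix (Fin n) (Fin n) ℚ) :
    MvPolynomial (Fin n) ℚ →+* MvPolynomial (Fin n) ℚ :=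
  (MvPolynomial.aeval (R := ℚ)
    fun i => ∑ j, MvPolynomial.C (σ i j) * MvPolynomial.X j).toRingHom

/-- `F_σ(Y,X) := F(Y,σ(X))` for a linear change of variables `σ`. -/
def applyGL {n : ℕ} (σ : Matrix (Fin n) (Fin n) ℚ)
    (Fq : Polynomial (MvPolynomial (Fin n) ℚ)) : Polynomial (MvPolynomial (Fin n) ℚ) :=
  Fq.map (lsubMv σ)

/-- `F` is `(1,n)`-allowable: absolutely irreducible, monic in `Y`, and
`ℚ(X)[Y]/(F_σ)` is an `n`-genuine extension for every `σ ∈ GLₙ(ℚ)`. -/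
def IsAllowable {n : ℕ} (F : Polynomial (MvPolynomial (Fin n) ℤ)) : Prop :=
  AbsIrred F ∧ F.Monic ∧
    ∀ σ : Matrix (Fin n) (Fin n) ℚ, IsUnit σ.det → GenuineExtOfQ (applyGL σ (toQ F))

/-- `F` is strongly `(1,n)`-allowable: absolutely irreducible, monic in `Y`, and
`ℚ(X)[Y]/(F_σ)` is a strongly `n`-genuine extension for every `σ ∈ GLₙ(ℚ)`. -/
def IsStronglyAllowable {n : ℕ} (F : Polynomial (MvPolynomial (Fin n) ℤ)) : Prop :=
  AbsIrred F ∧ F.Monic ∧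
    ∀ σ : Matrix (Fin n) (Fin n) ℚ, IsUnit σ.det → StronglyGenuineExtOfQ (applyGL σ (toQ F))

/-- `F` has the form (1.2) with parameter `m`:
`F = Y^{md} + f₁(X) Y^{m(d-1)} + ⋯ + f_{d-1}(X) Y^m + f_d(X)` with `f_d ≠ 0`. -/
def HasForm (n m : ℕ) (F : Polynomial (MvPolynomial (Fin n) ℤ)) : Prop :=
  ∃ (d : ℕ) (f : ℕ → MvPolynomial (Fin n) ℤ), 1 ≤ d ∧ f d ≠ 0 ∧
    F = Polynomial.X ^ (m * d) +
      ∑ j ∈ Finset.Icc 1 d, Polynomial.C (f j) * Polynomial.X ^ (m * (d - j))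

/-- `P` has a linear factor in `Y`: `P = (Y − Q(X))·H̃(Y,X)`. -/
def HasLinearFactorY {n : ℕ} {R : Type*} [CommRing R]
    (P : Polynomial (MvPolynomial (Fin n) R)) : Prop :=
  ∃ (Q : MvPolynomial (Fin n) R) (H : Polynomial (MvPolynomial (Fin n) R)),
    P = (Polynomial.X - Polynomial.C Q) * H

/-- The canonical map `ℚ[X₁,…,Xₙ] → ℚ(X)[Y]/(F)`. -/
def structMap {n : ℕ} (F : Polynomial (MvPolynomial (Fin n) ℤ)) :
    MvPolynomial (Fin n) ℚ →+* AdjoinRoot (toFrac F) :=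
  (algebraMap (RF n) (AdjoinRoot (toFrac F))).comp
    (algebraMap (MvPolynomial (Fin n) ℚ) (RF n))

/-- `z ∈ ℚ(X)[Y]/(F)` lies in the subfield `ℚ((Xᵢ)_{i≠j})`: it can be written
as a quotient of two polynomials not involving `Xⱼ`. -/
def CoordMem {n : ℕ} (j : Fin n) (F : Polynomial (MvPolynomial (Fin n) ℤ))
    (z : AdjoinRoot (toFrac F)) : Prop :=
  ∃ a b : MvPolynomial (Fin n) ℚ,
    MvPolynomial.degreeOf j a = 0 ∧ MvPolynomial.degreeOf j b = 0 ∧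
    structMap F b ≠ 0 ∧ z * structMap F b = structMap F a

/-- `z ∈ ℚ(X)[Y]/(F)` is algebraic over the subfield `ℚ((Xᵢ)_{i≠j})`. -/
def AlgOverCoord {n : ℕ} (j : Fin n) (F : Polynomial (MvPolynomial (Fin n) ℤ))
    (z : AdjoinRoot (toFrac F)) : Prop :=
  ∃ P : Polynomial (AdjoinRoot (toFrac F)), P ≠ 0 ∧ (∀ k, CoordMem j F (P.coeff k)) ∧
    Polynomial.eval z P = 0

/-- Substitute `Xᵢ = xᵢ` for `i ∈ I` into `F`, over `ℚ̄`. -/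
def substSome {n : ℕ} (I : Finset (Fin n)) (x : Fin n → ℚ)
    (F : Polynomial (MvPolynomial (Fin n) ℤ)) :
    Polynomial (MvPolynomial (Fin n) (AlgebraicClosure ℚ)) :=
  (toQ F).map
    ((MvPolynomial.aeval (R := ℚ) fun i =>
      if i ∈ I then MvPolynomial.C (algebraMap ℚ (AlgebraicClosure ℚ) (x i))
      else MvPolynomial.X i).toRingHom)

/-- Substitute `Xᵢ = xᵢ` for all `i ≠ i₀` into `F`, over `ℚ̄`. -/
def substKeepFirst {n : ℕ} (i0 : Fin n) (x : {i : Fin n // i ≠ i0} → ℤ)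
    (F : Polynomial (MvPolynomial (Fin n) ℤ)) :
    Polynomial (MvPolynomial (Fin n) (AlgebraicClosure ℚ)) :=
  F.map
    ((MvPolynomial.aeval (R := ℤ) fun i =>
      if h : i = i0 then (MvPolynomial.X i : MvPolynomial (Fin n) (AlgebraicClosure ℚ))
      else MvPolynomial.C ((x ⟨i, h⟩ : ℤ) : AlgebraicClosure ℚ)).toRingHom)

/-- `‖L‖`: maximum absolute value of an entry of an integer matrix. -/
def matNorm {n : ℕ} (L : Matrix (Fin n) (Fin n) ℤ) : ℕ :=
  Finset.univ.sup fun p : Fin n × Fin n => (L p.1 p.2).natAbs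

/-- The standard additive character `e_p(a) = exp(2πi a/p)` on `ZMod p`. -/
def eZp (p : ℕ) (a : ZMod p) : ℂ :=
  Complex.exp (2 * Real.pi * Complex.I * (a.val : ℂ) / (p : ℂ))

section
lemma evalEval_congr (p : ℤ) (g : ℤ[X][X]) (x y x0 y0 : ℤ) (hx : p ∣ x - x0) (hy : p ∣ y - y0) :
    p ∣ g.evalEval x y - g.evalEval x0 y0 := by
  have h1 : p ∣ g.evalEval x y - g.evalEval x0 y :=
    hx.trans (Polynomial.sub_dvd_eval_sub x x0 _)
  have h2 : p ∣ g.evalEval x0 y - g.evalEval x0 y0 := by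
    rw [← Polynomial.map_evalRingHom_eval, ← Polynomial.map_evalRingHom_eval]
    exact hy.trans (Polynomial.sub_dvd_eval_sub y y0 _)
  have := dvd_add h1 h2
  simpa using this

lemma eval_eval_eq (g : ℤ[X][X]) (ψ : ℤ[X]) (x : ℤ) :
    (g.eval ψ).eval x = g.evalEval x (ψ.eval x) := by
  rw [← Polynomial.map_evalRingHom_eval, Polynomial.eval_map]
  have := Polynomial.hom_eval₂ g (RingHom.id _) (evalRingHom x) ψ
  simpa [Polynomial.eval₂_id] using this

lemma hensel_poly (p : ℕ) (hp : p.Prime) (g : ℤ[X][X]) (x0 y0 : ℤ)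
    (hg : ¬ (p : ℤ) ∣ g.derivative.evalEval x0 y0) (k : ℕ) :
    ∃ ψ : ℤ[X], ∀ x y : ℤ, (p : ℤ) ∣ x - x0 → (p : ℤ) ∣ y - y0 → g.evalEval x y = 0 →
      (p : ℤ) ^ (k + 1) ∣ y - ψ.eval x := by
  induction k with
  | zero => exact ⟨C y0, fun x y _ hy _ => by simpa using hy⟩
  | succ k ih =>
    obtain ⟨ψ, hψ⟩ := ih
    have hcop : IsCoprime (p : ℤ) (g.derivative.evalEval x0 y0) :=
      ((Nat.prime_iff_prime_int.mp hp).coprime_iff_not_dvd).2 hg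
    obtain ⟨a, h, hah⟩ := hcop
    refine ⟨ψ - C h * g.eval ψ, fun x y hx hy hxy => ?_⟩
    have hk := hψ x y hx hy hxy
    have hk1 : (p : ℤ) ∣ y - ψ.eval x := (dvd_pow_self _ (by omega)).trans hk
    rw [eval_sub, eval_mul, eval_C, eval_eval_eq]
    obtain ⟨c, hc⟩ := (g.map (evalRingHom x)).binomExpansion y (ψ.eval x - y)
    rw [← Polynomial.map_evalRingHom_eval] at hxy
    rw [add_sub_cancel, hxy, Polynomial.derivative_map, Polynomial.map_evalRingHom_eval,
      Polynomial.map_evalRingHom_eval] at hc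
    have hd := evalEval_congr p g.derivative x y x0 y0 hx hy
    have hW : (p : ℤ) ∣ 1 - h * (g.derivative.evalEval x y - c * (y - ψ.eval x)) := by
      obtain ⟨u, hu⟩ := hd
      obtain ⟨v, hv⟩ := hk1
      refine ⟨a - h * u + h * c * v, ?_⟩
      rw [hv]
      linear_combination (-1 : ℤ) * hah - h * hu
    have := mul_dvd_mul hk hW
    rw [pow_succ _ (k + 1)]
    have e : y - (ψ.eval x - h * g.evalEval x (ψ.eval x)) = (y - ψ.eval x) *
        (1 - h * (g.derivative.evalEval x y - c * (y - ψ.eval x))) := by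
      rw [hc]; ring
    rw [e]
    exact this

/-- the polynomial with given coefficients -/
noncomputable def mkPoly (n : ℕ) (c : Fin n → ℤ) : ℤ[X] := ∑ a : Fin n, C (c a) * X ^ (a : ℕ)

lemma mkPoly_natDegree (A : ℕ) (c : Fin (A + 1) → ℤ) : (mkPoly (A + 1) c).natDegree ≤ A := by
  refine Polynomial.natDegree_sum_le_of_forall_le _ _ fun i _ => ?_
  exact (natDegree_C_mul_X_pow_le _ _).trans (by omega)

lemma mkPoly_sub (n : ℕ) (c d : Fin n → ℤ) : mkPoly n (c - d) = mkPoly n c - mkPoly n d := by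
  simp [mkPoly, sub_mul, Finset.sum_sub_distrib]

lemma mkPoly_coeff (n : ℕ) (c : Fin n → ℤ) (a : Fin n) : (mkPoly n c).coeff a = c a := by
  simp [mkPoly, Polynomial.finsetSum_coeff, coeff_X_pow, Fin.val_inj]

lemma mkPoly_eval_le (A : ℕ) (c : Fin (A + 1) → ℤ) (x : ℤ) (N b : ℕ) (hx : |x| ≤ N)
    (hc : ∀ a, |c a| ≤ b * N ^ (A - (a : ℕ))) :
    |(mkPoly (A + 1) c).eval x| ≤ (A + 1) * (b * N ^ A) := by
  rw [mkPoly, Polynomial.eval_finsetSum]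
  refine (Finset.abs_sum_le_sum_abs _ _).trans ?_
  have : ∀ a ∈ (Finset.univ : Finset (Fin (A + 1))), |eval x (C (c a) * X ^ (a : ℕ))| ≤ (b : ℤ) * N ^ A := by
    intro a _
    simp only [eval_mul, eval_C, eval_pow, eval_X, abs_mul, abs_pow]
    calc |c a| * |x| ^ (a : ℕ) ≤ (b * N ^ (A - (a : ℕ))) * N ^ (a : ℕ) := by
          have := hc a
          gcongr
      _ = b * N ^ A := by
          rw [mul_assoc, ← pow_add]; congr 2; omega
  refine (Finset.sum_le_sum this).trans ?_
  simp

lemma exists_H (p N Y0 A : ℕ) (hN : 1 ≤ N) (hY : 1 ≤ Y0) (h1 : 16 * N ≤ p ^ 2) (h2 : 16 < p)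
    (h3 : Y0 ≤ 2 ^ A) : ∃ H : ℕ, p ^ (2 * (A + 1) + 1) < H ^ 2 * (N ^ A * Y0) ∧
      2 * (A + 1) * (H * (N ^ A * Y0)) < p ^ (2 * (A + 1)) := by
  set M := N ^ A * Y0 with hM
  have hMpos : 0 < M := by positivity
  have h8 : (A + 1) ^ 2 ≤ 8 ^ A := by
    clear * -
    induction A with
    | zero => simp
    | succ n ih =>
      rw [pow_succ 8]
      have : (n + 1 + 1) ^ 2 ≤ 8 * (n + 1) ^ 2 := by ring_nf; nlinarith [Nat.zero_le (n ^ 2)]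
      omega
  have hkey : 16 * (A + 1) ^ 2 * M < p ^ (2 * A + 1) := by
    calc 16 * (A + 1) ^ 2 * M ≤ 16 * 8 ^ A * (N ^ A * 2 ^ A) := by rw [hM]; gcongr
      _ = 16 * (16 * N) ^ A := by
          rw [mul_pow, show (16 : ℕ) ^ A = 8 ^ A * 2 ^ A by rw [← mul_pow]; norm_num]; ring
      _ ≤ 16 * (p ^ 2) ^ A := by gcongr
      _ < p * (p ^ 2) ^ A := by
          have : 0 < (p ^ 2) ^ A := by positivity
          nlinarith
      _ = p ^ (2 * A + 1) := by rw [← pow_mul]; ring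
  have hbig : M ≤ p ^ (2 * (A + 1) + 1) := by
    have : p ^ (2 * A + 1) ≤ p ^ (2 * (A + 1) + 1) := Nat.pow_le_pow_right (by omega) (by omega)
    have h0 : 1 ≤ 16 * (A + 1) ^ 2 := by nlinarith [sq_nonneg (A + 1), Nat.zero_le A]
    nlinarith
  set q := p ^ (2 * (A + 1) + 1) / M with hq
  have hq1 : 1 ≤ q := (Nat.one_le_div_iff hMpos).2 hbig
  have hs1 : 1 ≤ Nat.sqrt q := Nat.le_sqrt.2 (by omega)
  refine ⟨Nat.sqrt q + 1, ?_, ?_⟩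
  · have := Nat.lt_succ_sqrt q
    have h := Nat.lt_mul_div_succ (p ^ (2 * (A + 1) + 1)) hMpos
    rw [← hq] at h
    have : q + 1 ≤ (Nat.sqrt q + 1) ^ 2 := by rw [pow_two]; exact this
    nlinarith
  · have ha := Nat.sqrt_le q
    have hb : (Nat.sqrt q + 1) ^ 2 ≤ 4 * q := by nlinarith
    have hc : q * M ≤ p ^ (2 * (A + 1) + 1) := Nat.div_mul_le_self _ _
    refine lt_of_pow_lt_pow_left₀ 2 (by positivity) ?_
    calc (2 * (A + 1) * ((Nat.sqrt q + 1) * M)) ^ 2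
        = 4 * (A + 1) ^ 2 * M * ((Nat.sqrt q + 1) ^ 2 * M) := by ring
      _ ≤ 4 * (A + 1) ^ 2 * M * (4 * q * M) := by gcongr
      _ = 16 * (A + 1) ^ 2 * M * (q * M) := by ring
      _ ≤ 16 * (A + 1) ^ 2 * M * p ^ (2 * (A + 1) + 1) := by gcongr
      _ < p ^ (2 * A + 1) * p ^ (2 * (A + 1) + 1) := by
          have : 0 < p ^ (2 * (A + 1) + 1) := by positivity
          exact Nat.mul_lt_mul_of_pos_right hkey this
      _ = (p ^ (2 * (A + 1))) ^ 2 := by ring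

lemma pow_dvd_eval_of_coeff (p : ℤ) (s : ℕ) (w : ℤ[X]) (t : ℤ) (ht : p ∣ t)
    (hw : ∀ j < s, p ^ (s - j) ∣ w.coeff j) : p ^ s ∣ w.eval t := by
  rw [Polynomial.eval_eq_sum_range]
  refine Finset.dvd_sum fun j _ => ?_
  by_cases hj : j < s
  · have := mul_dvd_mul (hw j hj) (pow_dvd_pow_of_dvd ht j)
    rwa [← pow_add, Nat.sub_add_cancel hj.le] at this
  · exact Dvd.dvd.mul_left ((pow_dvd_pow p (by omega)).trans (pow_dvd_pow_of_dvd ht j)) _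

lemma card_prod (p s : ℕ) [NeZero p] :
    Fintype.card (∀ j : Fin s, ZMod (p ^ (s - (j : ℕ)))) ^ 2 = p ^ (s * (s + 1)) := by
  rw [Fintype.card_pi]
  simp only [ZMod.card]
  rw [Fin.prod_univ_eq_prod_range (fun j => p ^ (s - j)) s, Finset.prod_pow_eq_pow_sum, ← pow_mul]
  congr 1
  have : ∑ i ∈ Finset.range s, (s - i) = ∑ i ∈ Finset.range (s + 1), i := by
    rw [← Finset.sum_range_reflect (fun i => i) (s + 1), Finset.sum_range_succ]
    simp
  rw [this, Finset.sum_range_id_mul_two]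
  simp; ring

lemma class_aux (p : ℕ) (hp : p.Prime) (N Y0 A : ℕ) (hN : 1 ≤ N) (hY : 1 ≤ Y0)
    (h1 : 16 * N ≤ p ^ 2) (h2 : 16 < p) (h3 : Y0 ≤ 2 ^ A) (ψ : ℤ[X]) (x0 : ℤ) :
    ∃ P Q : ℤ[X], (P ≠ 0 ∨ Q ≠ 0) ∧ P.natDegree ≤ A ∧ Q.natDegree ≤ A ∧
      ∀ x y : ℤ, |x| ≤ N → |y| ≤ Y0 → (p : ℤ) ∣ x - x0 →
        (p : ℤ) ^ (2 * (A + 1)) ∣ y - ψ.eval x → P.eval x + y * Q.eval x = 0 := by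
  classical
  have : NeZero p := ⟨hp.ne_zero⟩
  obtain ⟨H, hH1, hH2⟩ := exists_H p N Y0 A hN hY h1 h2 h3
  set s := 2 * (A + 1) with hs
  let bd : Fin (A + 1) ⊕ Fin (A + 1) → ℕ :=
    Sum.elim (fun a => (H * Y0) * N ^ (A - (a : ℕ))) (fun a => H * N ^ (A - (a : ℕ)))
  let dom : Finset (Fin (A + 1) ⊕ Fin (A + 1) → ℕ) := Fintype.piFinset fun i => Finset.range (bd i)
  let W : (Fin (A + 1) ⊕ Fin (A + 1) → ℤ) → ℤ[X] := fun c =>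
    (taylor x0) (mkPoly (A + 1) (fun a => c (Sum.inl a)) + ψ * mkPoly (A + 1) (fun a => c (Sum.inr a)))
  let key : (Fin (A + 1) ⊕ Fin (A + 1) → ℕ) → (∀ j : Fin s, ZMod (p ^ (s - (j : ℕ)))) :=
    fun c j => (((W fun i => (c i : ℤ)).coeff j : ℤ) : ZMod (p ^ (s - (j : ℕ))))
  have hcard : (Finset.univ : Finset (∀ j : Fin s, ZMod (p ^ (s - (j : ℕ))))).card < dom.card := by
    refine lt_of_pow_lt_pow_left₀ 2 (by positivity) ?_
    rw [Finset.card_univ, card_prod, Fintype.card_piFinset]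
    simp only [Finset.card_range, Fintype.prod_sum_type, bd, Sum.elim_inl, Sum.elim_inr]
    rw [← Finset.prod_mul_distrib, ← Finset.prod_pow]
    have e1 : (∏ a : Fin (A + 1), (H * Y0 * N ^ (A - (a : ℕ)) * (H * N ^ (A - (a : ℕ)))) ^ 2)
        = (H ^ 2 * (N ^ A * Y0)) ^ (2 * (A + 1)) := by
      have : ∀ a : Fin (A + 1), (H * Y0 * N ^ (A - (a : ℕ)) * (H * N ^ (A - (a : ℕ)))) ^ 2
        = (H ^ 4 * Y0 ^ 2) * (N ^ 4) ^ (A - (a : ℕ)) := by intro a; ring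
      simp_rw [this]
      rw [Finset.prod_mul_distrib, Fin.prod_univ_eq_prod_range (fun j => (N ^ 4) ^ (A - j)) (A + 1),
        Finset.prod_pow_eq_pow_sum]
      have h' : ∑ i ∈ Finset.range (A + 1), (A - i) = ∑ i ∈ Finset.range (A + 1), i := by
        rw [← Finset.sum_range_reflect (fun i => i) (A + 1)]
        simp
      have h'' : (∑ i ∈ Finset.range (A + 1), i) * 2 = (A + 1) * A := by
        rw [Finset.sum_range_id_mul_two]; simp
      rw [h']
      simp only [Finset.prod_const, Finset.card_univ, Fintype.card_fin]
      rw [← pow_mul, show 4 * ∑ i ∈ Finset.range (A + 1), i = 2 * ((A + 1) * A) by omega]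
      ring
    rw [e1]
    calc p ^ (s * (s + 1)) = (p ^ (s + 1)) ^ (2 * (A + 1)) := by rw [← pow_mul, ← hs]; ring
      _ < _ := Nat.pow_lt_pow_left hH1 (by omega)
  obtain ⟨c, hc, d, hd, hne, hcd⟩ := Finset.exists_ne_map_eq_of_card_lt_of_maps_to (f := key) hcard
    (fun _ _ => by simp)
  let u : Fin (A + 1) ⊕ Fin (A + 1) → ℤ := fun i => (c i : ℤ) - d i
  refine ⟨mkPoly (A + 1) fun a => u (Sum.inl a), mkPoly (A + 1) fun a => u (Sum.inr a), ?_,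
    mkPoly_natDegree _ _, mkPoly_natDegree _ _, ?_⟩
  · by_contra hcon
    push Not at hcon
    apply hne
    funext i
    have : u i = 0 := by
      rcases i with a | a
      · rw [← mkPoly_coeff (A + 1) (fun a => u (Sum.inl a)) a, hcon.1]; simp
      · rw [← mkPoly_coeff (A + 1) (fun a => u (Sum.inr a)) a, hcon.2]; simp
    simp only [u] at this
    omega
  · intro x y hx hy hxx hyy
    have hub : ∀ i, |u i| ≤ bd i := by
      intro i
      have h1 := Finset.mem_range.1 (Fintype.mem_piFinset.1 hc i)
      have h2 := Finset.mem_range.1 (Fintype.mem_piFinset.1 hd i)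
      simp only [u]; rw [abs_le]; omega
    have hb1 := mkPoly_eval_le A (fun a => u (Sum.inl a)) x N (H * Y0) hx (fun a => by
      simpa [bd] using hub (Sum.inl a))
    have hb2 := mkPoly_eval_le A (fun a => u (Sum.inr a)) x N H hx (fun a => by
      simpa [bd] using hub (Sum.inr a))
    set P := mkPoly (A + 1) fun a => u (Sum.inl a) with hP
    set Q := mkPoly (A + 1) fun a => u (Sum.inr a) with hQ
    have hdv : (p : ℤ) ^ s ∣ P.eval x + y * Q.eval x := by
      have hWu : W u = W (fun i => (c i : ℤ)) - W (fun i => (d i : ℤ)) := by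
        simp only [W]
        rw [← map_sub]
        congr 1
        have e1 : (fun a => u (Sum.inl a)) = (fun a => (c (Sum.inl a) : ℤ)) - fun a => (d (Sum.inl a) : ℤ) := rfl
        have e2 : (fun a => u (Sum.inr a)) = (fun a => (c (Sum.inr a) : ℤ)) - fun a => (d (Sum.inr a) : ℤ) := rfl
        rw [e1, e2, mkPoly_sub, mkPoly_sub]
        ring
      have h := pow_dvd_eval_of_coeff p s (W u) (x - x0) hxx (by
        intro j hj
        have := congrFun hcd ⟨j, hj⟩
        simp only [key] at this
        rw [← sub_eq_zero, ← Int.cast_sub, ZMod.intCast_zmod_eq_zero_iff_dvd] at this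
        rw [hWu, coeff_sub]
        exact_mod_cast this)
      simp only [W, taylor_eval, sub_add_cancel, eval_add, eval_mul] at h
      rw [← hP, ← hQ] at h
      have := dvd_add h (Dvd.dvd.mul_right hyy (Q.eval x))
      have e : P.eval x + y * Q.eval x = P.eval x + ψ.eval x * Q.eval x + (y - ψ.eval x) * Q.eval x := by
        ring
      rw [e]
      exact this
    refine Int.eq_zero_of_abs_lt_dvd hdv ?_
    calc |P.eval x + y * Q.eval x| ≤ |P.eval x| + |y| * |Q.eval x| := by
          rw [← abs_mul]; exact abs_add_le _ _
      _ ≤ (A + 1) * ((H * Y0 : ℕ) * N ^ A) + Y0 * ((A + 1) * (H * N ^ A)) := by gcongr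
      _ = ((2 * (A + 1) * (H * (N ^ A * Y0)) : ℕ) : ℤ) := by push_cast; ring
      _ < ((p ^ s : ℕ) : ℤ) := by exact_mod_cast hH2
      _ = (p : ℤ) ^ s := by push_cast; rfl

end

section
/-- the cleared-denominator form of `f(-P/Q)` -/
noncomputable def clearW (f : ℤ[X][X]) (P Q : ℤ[X]) : ℤ[X] :=
  ∑ i ∈ Finset.range (f.natDegree + 1), f.coeff i * (Q ^ (f.natDegree - i) * (-P) ^ i)

lemma clearW_eval (f : ℤ[X][X]) (P Q : ℤ[X]) (x y : ℤ) (h : P.eval x + y * Q.eval x = 0)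
    (hf : f.evalEval x y = 0) : (clearW f P Q).eval x = 0 := by
  have hP : -(P.eval x) = y * Q.eval x := by linarith
  have : f.evalEval x y = ∑ i ∈ Finset.range (f.natDegree + 1), (f.coeff i).eval x * y ^ i := by
    rw [evalEval, eval_eq_sum_range (p := f), eval_finsetSum]
    simp
  rw [clearW, eval_finsetSum]
  calc _ = ∑ i ∈ Finset.range (f.natDegree + 1), (Q.eval x) ^ f.natDegree * ((f.coeff i).eval x * y ^ i) := by
        refine Finset.sum_congr rfl fun i hi => ?_
        have hi' : i ≤ f.natDegree := by simpa [Nat.lt_succ_iff] using hi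
        simp only [eval_mul, eval_pow, eval_neg, hP]
        rw [show (Q.eval x) ^ f.natDegree = (Q.eval x) ^ (f.natDegree - i) * (Q.eval x) ^ i by
          rw [← pow_add]; congr 1; omega]
        ring
    _ = 0 := by rw [← Finset.mul_sum, ← this, hf, mul_zero]

lemma clearW_natDegree (f : ℤ[X][X]) (P Q : ℤ[X]) (D A : ℕ) (hd : f.natDegree ≤ D)
    (hc : ∀ i, (f.coeff i).natDegree ≤ D) (hP : P.natDegree ≤ A) (hQ : Q.natDegree ≤ A) :
    (clearW f P Q).natDegree ≤ D + D * A := by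
  refine natDegree_sum_le_of_forall_le _ _ fun i hi => ?_
  have hi' : i ≤ f.natDegree := by simpa [Nat.lt_succ_iff] using hi
  refine natDegree_mul_le.trans (add_le_add (hc i) (natDegree_mul_le.trans ?_))
  have h1 : (Q ^ (f.natDegree - i)).natDegree ≤ (f.natDegree - i) * A :=
    natDegree_pow_le.trans (by gcongr)
  have h2 : ((-P) ^ i).natDegree ≤ i * A :=
    natDegree_pow_le.trans (by rw [natDegree_neg]; gcongr)
  calc _ ≤ (f.natDegree - i) * A + i * A := add_le_add h1 h2
    _ = f.natDegree * A := by rw [← add_mul]; congr 1; omega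
    _ ≤ D * A := by gcongr

lemma clearW_zero (f : ℤ[X][X]) (hf : f.Monic) (P Q : ℤ[X]) (hQ : Q ≠ 0) (h : clearW f P Q = 0) :
    ∃ q : ℤ[X], f.eval q = 0 ∧ Q * q = -P := by
  let K := FractionRing ℤ[X]
  have hQ' : algebraMap ℤ[X] K Q ≠ 0 := by
    simpa using hQ
  set t : K := algebraMap ℤ[X] K (-P) / algebraMap ℤ[X] K Q with ht
  have ht' : algebraMap ℤ[X] K Q * t = algebraMap ℤ[X] K (-P) := by rw [ht, mul_comm, div_mul_cancel₀ _ hQ']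
  have hz : eval₂ (algebraMap ℤ[X] K) t f = 0 := by
    have h1 := congrArg (algebraMap ℤ[X] K) h
    rw [clearW, map_sum, map_zero] at h1
    have h2 : (algebraMap ℤ[X] K Q) ^ f.natDegree * eval₂ (algebraMap ℤ[X] K) t f = 0 := by
      rw [← h1, eval₂_eq_sum_range, Finset.mul_sum]
      refine Finset.sum_congr rfl fun i hi => ?_
      have hi' : i ≤ f.natDegree := by simpa [Nat.lt_succ_iff] using hi
      simp only [map_mul, map_pow]
      rw [← ht', show (algebraMap ℤ[X] K Q) ^ f.natDegree
        = (algebraMap ℤ[X] K Q) ^ (f.natDegree - i) * (algebraMap ℤ[X] K Q) ^ i by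
          rw [← pow_add]; congr 1; omega]
      ring
    rcases mul_eq_zero.1 h2 with h3 | h3
    · exact absurd h3 (pow_ne_zero _ hQ')
    · exact h3
  obtain ⟨q, hq⟩ := IsIntegrallyClosed.algebraMap_eq_of_integral (R := ℤ[X]) (K := K) ⟨f, hf, hz⟩
  have hinj : Function.Injective (algebraMap ℤ[X] K) := IsFractionRing.injective _ _
  refine ⟨q, hinj ?_, hinj ?_⟩
  · rw [← hq, eval₂_at_apply] at hz
    simpa using hz
  · rw [map_mul, hq, ht']

lemma card_le_of_roots (S : Finset ℤ) (W : ℤ[X]) (hW : W ≠ 0) (n : ℕ) (hn : W.natDegree ≤ n)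
    (h : ∀ x ∈ S, W.eval x = 0) : S.card ≤ n := by
  classical
  have : S ⊆ W.roots.toFinset := fun x hx => by
    rw [Multiset.mem_toFinset, mem_roots hW]; exact h x hx
  exact (Finset.card_le_card this).trans ((Multiset.toFinset_card_le _).trans
    ((card_roots' W).trans hn))

lemma class_card (f : ℤ[X][X]) (hf : f.Monic) (P Q : ℤ[X]) (hPQ : P ≠ 0 ∨ Q ≠ 0) (D A : ℕ)
    (hd : f.natDegree ≤ D)
    (hc : ∀ i, (f.coeff i).natDegree ≤ D) (hP : P.natDegree ≤ A) (hQ : Q.natDegree ≤ A)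
    (S : Finset ℤ) (hS : ∀ x ∈ S, ∃ y, P.eval x + y * Q.eval x = 0 ∧ f.evalEval x y = 0 ∧
      ∀ r : ℤ[X], f.eval r = 0 → r.eval x ≠ y) : S.card ≤ D + D * A + A := by
  by_cases hQ0 : Q = 0
  · have hP0 : P ≠ 0 := by simpa [hQ0] using hPQ
    refine (card_le_of_roots S P hP0 A hP fun x hx => ?_).trans (by omega)
    obtain ⟨y, hy, -⟩ := hS x hx
    simpa [hQ0] using hy
  by_cases hW : clearW f P Q = 0
  · obtain ⟨q, hq, hqP⟩ := clearW_zero f hf P Q hQ0 hW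
    refine (card_le_of_roots S Q hQ0 A hQ fun x hx => ?_).trans (by omega)
    obtain ⟨y, hy, -, hr⟩ := hS x hx
    have h1 := congrArg (eval x) hqP
    rw [eval_mul, eval_neg] at h1
    have h2 : Q.eval x * (y - q.eval x) = 0 := by linarith
    rcases mul_eq_zero.1 h2 with h3 | h3
    · exact h3
    · exact absurd (by linarith) (hr q hq)
  · refine (card_le_of_roots S _ hW _ (clearW_natDegree f P Q D A hd hc hP hQ) fun x hx => ?_).trans
      (Nat.le_add_right _ _)
    obtain ⟨y, hy, hy2, -⟩ := hS x hx
    exact clearW_eval f P Q x y hy hy2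

end

section
lemma evalEval_eq_sum (f : ℤ[X][X]) (x y : ℤ) (n : ℕ) (hn : f.natDegree < n) :
    f.evalEval x y = ∑ i ∈ Finset.range n, (f.coeff i).eval x * y ^ i := by
  rw [evalEval, eval_eq_sum_range' (p := f) hn, eval_finsetSum]
  simp

lemma root_bound (g : ℤ[X]) (hg : g.Monic) (T : ℕ) (y : ℤ) (hy : g.eval y = 0)
    (hT : ∀ j, |g.coeff j| ≤ T) : |y| ≤ g.natDegree * T := by
  by_cases hy0 : y = 0
  · subst hy0; rw [abs_zero]; positivity
  have hy1 : 1 ≤ |y| := Int.one_le_abs hy0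
  rw [eval_eq_sum_range, Finset.sum_range_succ, coeff_natDegree, hg.leadingCoeff, one_mul] at hy
  set k := g.natDegree with hk
  have hk0 : k ≠ 0 := by
    intro h0
    rw [h0] at hy; simp at hy
  obtain ⟨m, hm⟩ : ∃ m, k = m + 1 := ⟨k - 1, by omega⟩
  clear_value k
  subst hm
  have h1 : |y| ^ (m + 1) ≤ (m + 1 : ℕ) * T * |y| ^ m := by
    rw [← abs_pow, show y ^ (m + 1) = -∑ x ∈ Finset.range (m + 1), g.coeff x * y ^ x by linarith,
      abs_neg]
    refine (Finset.abs_sum_le_sum_abs _ _).trans ?_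
    refine (Finset.sum_le_sum (g := fun _ => (T : ℤ) * |y| ^ m) fun j hj => ?_).trans ?_
    · rw [abs_mul, abs_pow]
      have := hT j
      have hj' : j ≤ m := by simpa [Nat.lt_succ_iff] using hj
      gcongr
    · simp [mul_assoc]
  have h2 : 0 < |y| ^ m := by positivity
  rw [pow_succ, mul_comm] at h1
  exact le_of_mul_le_mul_right h1 h2

lemma deriv_bound (f : ℤ[X][X]) (D T Y0 i : ℕ) (hd : f.natDegree ≤ D) (hi : i ≤ D) (hY : 1 ≤ Y0)
    (x y : ℤ) (hT : ∀ j, |(f.coeff j).eval x| ≤ T) (hy : |y| ≤ Y0) :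
    |(derivative^[i] f).evalEval x y| ≤ (((D + 1) * ((D + 1) ^ D * T * Y0 ^ D) : ℕ) : ℤ) := by
  have hdeg : (derivative^[i] f).natDegree < D + 1 := by
    have := natDegree_iterate_derivative f i
    omega
  rw [evalEval_eq_sum _ x y (D + 1) hdeg]
  refine (Finset.abs_sum_le_sum_abs _ _).trans ?_
  refine (Finset.sum_le_sum (g := fun _ => (((D + 1) ^ D * T * Y0 ^ D : ℕ) : ℤ)) fun j hj => ?_).trans ?_
  · have hj' : j ≤ D := by simpa [Nat.lt_succ_iff] using hj
    rw [coeff_iterate_derivative, abs_mul, abs_pow]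
    have hb : |eval x ((j + i).descFactorial i • f.coeff (j + i))| ≤ (((D + 1) ^ D * T : ℕ) : ℤ) := by
      rw [nsmul_eq_mul, eval_mul, eval_natCast, abs_mul, Nat.abs_cast]
      by_cases hji : j + i ≤ D
      · have h1 : (j + i).descFactorial i ≤ (D + 1) ^ D :=
          (Nat.descFactorial_le_pow _ _).trans ((Nat.pow_le_pow_left (by omega) _).trans
            (Nat.pow_le_pow_right (by omega) hi))
        have h2 := hT (j + i)
        push_cast
        have h1' : ((j + i).descFactorial i : ℤ) ≤ (D + 1) ^ D := by exact_mod_cast h1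
        gcongr
      · rw [coeff_eq_zero_of_natDegree_lt (by omega)]; simp
    have hb2 : |y| ^ j ≤ ((Y0 ^ D : ℕ) : ℤ) := by
      push_cast
      calc |y| ^ j ≤ (Y0 : ℤ) ^ j := by gcongr
        _ ≤ (Y0 : ℤ) ^ D := pow_le_pow_right₀ (by exact_mod_cast hY) hj'
    calc _ ≤ (((D + 1) ^ D * T : ℕ) : ℤ) * ((Y0 ^ D : ℕ) : ℤ) := by gcongr
      _ = _ := by push_cast; ring
  · simp

lemma exists_deriv (f : ℤ[X][X]) (hf : f.Monic) (x y : ℤ) (h : f.evalEval x y = 0) :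
    ∃ i < f.natDegree, (derivative^[i] f).evalEval x y = 0 ∧
      (derivative^[i + 1] f).evalEval x y ≠ 0 := by
  classical
  have hex : ∃ i, (derivative^[i] f).evalEval x y ≠ 0 := by
    refine ⟨f.natDegree, ?_⟩
    rw [evalEval_eq_sum _ x y 1 (by
      have := natDegree_iterate_derivative f f.natDegree
      omega)]
    simp [coeff_iterate_derivative, hf, Nat.descFactorial_self, Nat.factorial_ne_zero]
  have hspec := Nat.find_spec hex
  have hle : Nat.find hex ≤ f.natDegree := by
    apply Nat.find_min'
    rw [evalEval_eq_sum _ x y 1 (by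
      have := natDegree_iterate_derivative f f.natDegree
      omega)]
    simp [coeff_iterate_derivative, hf, Nat.descFactorial_self, Nat.factorial_ne_zero]
  have h0 : Nat.find hex ≠ 0 := by
    intro h0
    rw [h0] at hspec
    exact hspec h
  refine ⟨Nat.find hex - 1, by omega, ?_, ?_⟩
  · by_contra hc
    exact Nat.find_min hex (m := Nat.find hex - 1) (by omega) hc
  · rwa [Nat.sub_add_cancel (by omega)]

lemma exists_prime_not_dvd (Ps : Finset ℕ) (hPs : ∀ p ∈ Ps, p.Prime) (v : ℤ) (hv : v ≠ 0)
    (V : ℕ) (hV : |v| ≤ V) (hc : V < 2 ^ Ps.card) : ∃ p ∈ Ps, ¬ (p : ℤ) ∣ v := by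
  by_contra hcon
  push Not at hcon
  have h1 : ∏ p ∈ Ps, p ∣ v.natAbs := by
    refine Finset.prod_primes_dvd _ (fun p hp => (hPs p hp).prime) fun p hp => ?_
    exact Int.natCast_dvd.1 (hcon p hp)
  have h2 : 2 ^ Ps.card ≤ ∏ p ∈ Ps, p := by
    rw [← Finset.prod_const]
    exact Finset.prod_le_prod' fun p hp => (hPs p hp).two_le
  have h3 := Nat.le_of_dvd (Int.natAbs_pos.2 hv) h1
  have h4 : v.natAbs ≤ V := by
    have := Int.natCast_natAbs v
    omega
  omega

lemma roots_mod_card (f : ℤ[X][X]) (hf : f.Monic) (p : ℕ) (hp : p.Prime) (u : ℤ) :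
    ((Finset.range p).filter fun v : ℕ => (p : ℤ) ∣ f.evalEval u v).card ≤ f.natDegree := by
  classical
  have : Fact p.Prime := ⟨hp⟩
  set g : (ZMod p)[X] := (f.map (evalRingHom u)).map (Int.castRingHom (ZMod p)) with hg
  have hgm : g.Monic := (hf.map _).map _
  have hgd : g.natDegree = f.natDegree := by
    rw [hg, (hf.map _).natDegree_map, hf.natDegree_map]
  refine (Finset.card_le_card_of_injOn (t := g.roots.toFinset) (fun v : ℕ => (v : ZMod p)) ?_ ?_).trans
    ((Multiset.toFinset_card_le _).trans ((card_roots' g).trans hgd.le))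
  · intro v hv
    simp only [Finset.coe_filter, Finset.mem_range, Set.mem_ofPred_eq] at hv
    rw [Finset.mem_coe, Multiset.mem_toFinset, mem_roots hgm.ne_zero, IsRoot.def, hg, eval_map]
    have h1 := (Polynomial.eval₂_at_apply (Int.castRingHom (ZMod p)) (p := f.map (evalRingHom u)) (v : ℤ))
    simp only [eq_intCast, Int.cast_natCast] at h1
    rw [h1, Polynomial.map_evalRingHom_eval]
    exact (ZMod.intCast_zmod_eq_zero_iff_dvd _ _).2 hv.2
  · intro a ha b hb hab
    simp only [Finset.coe_filter, Finset.mem_range, Set.mem_ofPred_eq] at ha hb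
    have := (ZMod.natCast_eq_natCast_iff' a b p).1 hab
    rwa [Nat.mod_eq_of_lt ha.1, Nat.mod_eq_of_lt hb.1] at this

lemma curve_core (f : ℤ[X][X]) (hf : f.Monic) (D N T Y0 A Xb V : ℕ) (hN : 1 ≤ N)
    (hd : f.natDegree ≤ D) (hc : ∀ i, (f.coeff i).natDegree ≤ D)
    (hT : ∀ j, ∀ x : ℤ, |x| ≤ N → |(f.coeff j).eval x| ≤ T) (hY0 : Y0 = D * T + 1)
    (hA : Y0 ≤ 2 ^ A) (hV : V = (D + 1) * ((D + 1) ^ D * T * Y0 ^ D))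
    (Ps : Finset ℕ) (hPs : ∀ p ∈ Ps, p.Prime ∧ 16 * N ≤ p ^ 2 ∧ 16 < p ∧ p ≤ Xb)
    (hcard : V < 2 ^ Ps.card)
    (S : Finset ℤ) (hS : ∀ x ∈ S, |x| ≤ N ∧ ∃ y, f.evalEval x y = 0 ∧
      ∀ r : ℤ[X], f.eval r = 0 → r.eval x ≠ y) :
    S.card ≤ D * (Ps.card * (Xb * (D * (D + D * A + A)))) := by
  classical
  let good : ℕ → ℕ → ℕ → ℕ → ℤ → ℤ → Prop := fun i p u v x y =>
    f.evalEval x y = 0 ∧ (∀ r : ℤ[X], f.eval r = 0 → r.eval x ≠ y) ∧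
    (derivative^[i] f).evalEval x y = 0 ∧ ¬ (p : ℤ) ∣ (derivative^[i + 1] f).evalEval x y ∧
    (p : ℤ) ∣ x - u ∧ (p : ℤ) ∣ y - v ∧ |y| ≤ Y0
  let U : ℕ → ℕ → ℕ → ℕ → Finset ℤ := fun i p u v => S.filter fun x => ∃ y, good i p u v x y
  have hsub : S ⊆ (Finset.range D).biUnion fun i => Ps.biUnion fun p => (Finset.range p).biUnion
      fun u => ((Finset.range p).filter fun v : ℕ => (p : ℤ) ∣ f.evalEval u v).biUnion
        fun v => U i p u v := by
    intro x hx
    obtain ⟨hxN, y, hy, hr⟩ := hS x hx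
    obtain ⟨i, hi, hi0, hi1⟩ := exists_deriv f hf x y hy
    have hyb : |y| ≤ Y0 := by
      have h1 := root_bound (f.map (evalRingHom x)) (hf.map _) T y
        (by rw [Polynomial.map_evalRingHom_eval]; exact hy) (by
          intro j; rw [coeff_map]; exact hT j x hxN)
      rw [hf.natDegree_map] at h1
      have h2 : (f.natDegree : ℤ) * T ≤ D * T := by gcongr
      rw [hY0]; push_cast; linarith
    obtain ⟨p, hp, hpv⟩ := exists_prime_not_dvd Ps (fun p hp => (hPs p hp).1) _ hi1 V (by
      rw [hV]
      exact deriv_bound f D T Y0 (i + 1) hd (by omega) (by omega) x y (fun j => hT j x hxN) hyb) hcard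
    have hp0 : 0 < p := (hPs p hp).1.pos
    have hp0' : (0 : ℤ) < p := by exact_mod_cast hp0
    have key : ∀ z : ℤ, ((z % p).toNat : ℤ) = z % p ∧ (z % p).toNat < p ∧ (p : ℤ) ∣ z - (z % p).toNat := by
      intro z
      have h1 := Int.emod_nonneg z hp0'.ne'
      have h2 := Int.emod_lt_of_pos z hp0'
      have h3 : ((z % p).toNat : ℤ) = z % p := Int.toNat_of_nonneg h1
      refine ⟨h3, by omega, ?_⟩
      rw [h3]
      exact Int.dvd_self_sub_emod
    simp only [Finset.mem_biUnion, Finset.mem_range, Finset.mem_filter]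
    refine ⟨i, by omega, p, hp, (x % p).toNat, (key x).2.1, (y % p).toNat, ⟨(key y).2.1, ?_⟩, ?_⟩
    · have := evalEval_congr p f x y _ _ (key x).2.2 (key y).2.2
      rw [hy, zero_sub, dvd_neg] at this
      exact this
    · simp only [U, Finset.mem_filter]
      exact ⟨hx, y, hy, hr, hi0, hpv, (key x).2.2, (key y).2.2, hyb⟩
  have hU : ∀ i, ∀ p ∈ Ps, ∀ u v, (U i p u v).card ≤ D + D * A + A := by
    intro i p hp u v
    obtain ⟨hpp, hp1, hp2, -⟩ := hPs p hp
    rcases (U i p u v).eq_empty_or_nonempty with he | ⟨x0, hx0⟩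
    · rw [he]; simp
    simp only [U, Finset.mem_filter] at hx0
    obtain ⟨hx0S, y0, hg0⟩ := hx0
    obtain ⟨-, -, -, g4, g5, g6, -⟩ := hg0
    obtain ⟨ψ, hψ⟩ := hensel_poly p hpp (derivative^[i] f) x0 y0 (by
      rwa [← Function.iterate_succ_apply' derivative]) (2 * A + 1)
    obtain ⟨P, Q, hPQ, hPd, hQd, hcl⟩ := class_aux p hpp N Y0 A hN (by omega) hp1 hp2 hA ψ x0
    refine class_card f hf P Q hPQ D A hd hc hPd hQd _ fun x hx => ?_
    simp only [U, Finset.mem_filter] at hx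
    obtain ⟨hxS, y, h1, h2, h3, h4, h5, h6, h7⟩ := hx
    have hxx : (p : ℤ) ∣ x - x0 := by
      have := dvd_sub h5 g5
      rwa [sub_sub_sub_cancel_right] at this
    have hyy : (p : ℤ) ∣ y - y0 := by
      have := dvd_sub h6 g6
      rwa [sub_sub_sub_cancel_right] at this
    exact ⟨y, hcl x y (hS x hxS).1 h7 hxx (hψ x y hxx hyy h3), h1, h2⟩
  refine (Finset.card_le_card hsub).trans ?_
  refine (Finset.card_biUnion_le_card_mul _ _ _ fun i _ => ?_).trans (by rw [Finset.card_range])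
  refine Finset.card_biUnion_le_card_mul _ _ _ fun p hp => ?_
  obtain ⟨hpp, hp1, hp2, hp3⟩ := hPs p hp
  refine (Finset.card_biUnion_le_card_mul _ _ (D * (D + D * A + A)) fun u _ => ?_).trans (by
    rw [Finset.card_range]; gcongr)
  refine (Finset.card_biUnion_le_card_mul _ _ (D + D * A + A) fun v _ => hU i p hp u v).trans ?_
  gcongr
  exact (roots_mod_card f hf p hpp u).trans hd

end

section
lemma exists_primes (P M L : ℕ) (hL : P + M < 2 ^ L) (hL1 : 1 ≤ L) (hS : 1 ≤ P + M) :
    ∃ Ps : Finset ℕ, Ps.card = M ∧ ∀ p ∈ Ps, p.Prime ∧ P < p ∧ p ≤ 16 * (P + M) * L := by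
  set S := P + M with hSdef
  set Xn := 16 * S * L with hX
  have hSL : S ≤ S * L := Nat.le_mul_of_pos_right _ hL1
  have hLSL : L ≤ S * L := Nat.le_mul_of_pos_left _ hS
  have hX16 : 16 ≤ Xn := by rw [hX]; nlinarith
  have hpi : S ≤ Nat.primeCounting Xn := by
    have h := Chebyshev.pi_ge Xn
    have hl2 : 0 < Real.log 2 := Real.log_pos (by norm_num)
    have hLlt : L < 2 ^ L := Nat.lt_two_pow_self
    have hXle : Xn ≤ 2 ^ (2 * L + 4) := by
      calc Xn = 16 * S * L := hX
        _ ≤ 16 * 2 ^ L * 2 ^ L := by gcongr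
        _ = 2 ^ (2 * L + 4) := by ring
    have hlogX : Real.log Xn ≤ (2 * L + 4 : ℕ) * Real.log 2 := by
      rw [← Real.log_pow]
      apply Real.log_le_log (by positivity)
      exact_mod_cast hXle
    have hlogX1 : Real.log (Xn + 1) ≤ (2 * L + 5 : ℕ) * Real.log 2 := by
      rw [← Real.log_pow]
      apply Real.log_le_log (by positivity)
      have : Xn + 1 ≤ 2 ^ (2 * L + 5) := by
        rw [pow_succ]; omega
      exact_mod_cast this
    have hpos : 0 < Real.log Xn := Real.log_pos (by exact_mod_cast (by omega : 1 < Xn))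
    rw [div_le_iff₀ hpos] at h
    by_contra hcon
    push Not at hcon
    have h1 : (Nat.primeCounting Xn : ℝ) * Real.log Xn ≤ S * ((2 * L + 4 : ℕ) * Real.log 2) := by
      have : (Nat.primeCounting Xn : ℝ) ≤ S := by exact_mod_cast hcon.le
      gcongr
    have h2 : (Xn : ℝ) * Real.log 2 ≤ (S * (2 * L + 4) + (2 * L + 5) : ℕ) * Real.log 2 := by
      push_cast at *
      nlinarith
    have h3 : (Xn : ℝ) ≤ (S * (2 * L + 4) + (2 * L + 5) : ℕ) := le_of_mul_le_mul_right h2 hl2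
    have h4 : Xn ≤ S * (2 * L + 4) + (2 * L + 5) := by exact_mod_cast h3
    rw [hX] at h4
    nlinarith
  have hcard : M ≤ ((Finset.Ioc P Xn).filter Nat.Prime).card := by
    have h1 : Nat.primeCounting Xn = ((Finset.range (Xn + 1)).filter Nat.Prime).card := by
      rw [Nat.primeCounting, Nat.primeCounting', Nat.count_eq_card_filter_range]
    have h2 : (Finset.range (Xn + 1)).filter Nat.Prime ⊆
        (Finset.Icc 1 P) ∪ (Finset.Ioc P Xn).filter Nat.Prime := by
      intro p hp
      simp only [Finset.mem_filter, Finset.mem_range] at hp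
      have := hp.2.one_lt
      simp only [Finset.mem_union, Finset.mem_Icc, Finset.mem_filter, Finset.mem_Ioc, hp.2, and_true]
      omega
    have h3 := (Finset.card_le_card h2).trans (Finset.card_union_le _ _)
    rw [← h1] at h3
    simp only [Nat.card_Icc] at h3
    omega
  obtain ⟨Ps, hsub, hPs⟩ := Finset.exists_subset_card_eq hcard
  refine ⟨Ps, hPs, fun p hp => ?_⟩
  have := hsub hp
  simp only [Finset.mem_filter, Finset.mem_Ioc] at this
  exact ⟨this.2, this.1.1, this.1.2⟩

lemma one_le_log (T : ℕ) (hT : 3 ≤ T) : 1 ≤ Real.log T := by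
  rw [Real.le_log_iff_exp_le (by positivity)]
  have h1 := Real.exp_one_lt_d9
  have : (3 : ℝ) ≤ T := by exact_mod_cast hT
  linarith

lemma natlog_bound (T v E : ℕ) (hT : 3 ≤ T) (hv : v ≤ T ^ E) :
    ((Nat.log 2 v + 1 : ℕ) : ℝ) ≤ (2 * E + 1) * Real.log T := by
  have hl := one_le_log T hT
  by_cases hv0 : v = 0
  · subst hv0; simp; nlinarith [Nat.cast_nonneg (α := ℝ) E]
  have h1 : 2 ^ Nat.log 2 v ≤ T ^ E := (Nat.pow_log_le_self 2 hv0).trans hv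
  have h2 : (Nat.log 2 v : ℝ) * Real.log 2 ≤ E * Real.log T := by
    rw [← Real.log_pow, ← Real.log_pow]
    apply Real.log_le_log (by positivity)
    exact_mod_cast h1
  have h3 := Real.log_two_gt_d9
  have h4 : (Nat.log 2 v : ℝ) ≤ 2 * E * Real.log T := by
    nlinarith [Nat.cast_nonneg (α := ℝ) (Nat.log 2 v)]
  push_cast
  nlinarith

set_option maxHeartbeats 1000000 in
theorem curve_lemma (D : ℕ) : ∃ C : ℝ, 0 < C ∧ ∀ N T : ℕ, 1 ≤ N → N + 2 ≤ T → ∀ f : ℤ[X][X],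
    f.Monic → f.natDegree ≤ D → (∀ i, (f.coeff i).natDegree ≤ D) →
    (∀ j, ∀ x : ℤ, |x| ≤ N → |(f.coeff j).eval x| ≤ T) → ∀ S : Finset ℤ,
    (∀ x ∈ S, |x| ≤ N ∧ ∃ y, f.evalEval x y = 0 ∧ ∀ r : ℤ[X], f.eval r = 0 → r.eval x ≠ y) →
    (S.card : ℝ) ≤ C * (Real.sqrt N * Real.log T ^ 4) := by
  set E : ℕ := 2 * (D * (D + 1)) + 1 with hE
  refine ⟨D * ((2 * E + 1) * (16 * (25 + 2 * E) * (2 * (E + 4 : ℕ) + 1) * (D * (D + (D + 1) * (2 * (D + 1 : ℕ) + 1))))) + 1,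
    by positivity, ?_⟩
  intro N T hN hNT f hf hd hc hT S hS
  have hT3 : 3 ≤ T := by omega
  have hl := one_le_log T hT3
  set ℓ := Real.log T with hℓ
  set Y0 := D * T + 1 with hY0
  set V := (D + 1) * ((D + 1) ^ D * T * Y0 ^ D) with hV
  set A := Nat.log 2 Y0 + 1 with hA
  set M := Nat.log 2 V + 1 with hM
  set P := 4 * Nat.sqrt N + 20 with hP
  set L := Nat.log 2 (P + M) + 1 with hL
  have hDT : D + 1 ≤ T ^ D := by
    have h1 : D < 2 ^ D := Nat.lt_two_pow_self
    have h2 : 2 ^ D ≤ T ^ D := Nat.pow_le_pow_left (by omega) _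
    omega
  have hY0T : Y0 ≤ T ^ (D + 1) := by
    calc Y0 ≤ (D + 1) * T := by rw [hY0]; nlinarith
      _ ≤ T ^ D * T := by gcongr
      _ = T ^ (D + 1) := by ring
  have hVT : V ≤ T ^ E := by
    calc V ≤ T ^ D * ((T ^ D) ^ D * T * (T ^ (D + 1)) ^ D) := by rw [hV]; gcongr
      _ = T ^ E := by rw [hE]; ring
  have hMb : (M : ℝ) ≤ (2 * E + 1) * ℓ := natlog_bound T V E hT3 hVT
  have hAb : (A : ℝ) ≤ (2 * (D + 1 : ℕ) + 1) * ℓ := natlog_bound T Y0 (D + 1) hT3 hY0T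
  have hsN : Nat.sqrt N ≤ N := Nat.sqrt_le_self N
  have hPM : P + M ≤ T ^ (E + 4) := by
    have h1 : M ≤ T ^ E + 1 := by
      have := Nat.log_le_self 2 V
      omega
    have h2 : 1 ≤ T ^ E := Nat.one_le_pow _ _ (by omega)
    have h4 : T ^ (E + 4) = T ^ E * T ^ 4 := by ring
    have h6 : 4 * T + 22 ≤ T ^ 4 := by
      have : 3 ^ 3 ≤ T ^ 3 := Nat.pow_le_pow_left hT3 3
      have : T ^ 4 = T ^ 3 * T := by ring
      nlinarith
    rw [h4]
    nlinarith
  have hLb : (L : ℝ) ≤ (2 * (E + 4 : ℕ) + 1) * ℓ := natlog_bound T (P + M) (E + 4) hT3 hPM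
  obtain ⟨Ps, hPs, hPs2⟩ := exists_primes P M L (by rw [hL]; exact Nat.lt_pow_succ_log_self (by norm_num) _)
    (by omega) (by omega)
  have hcore := curve_core f hf D N T Y0 A (16 * (P + M) * L) V hN hd hc hT hY0
    (by rw [hA]; exact (Nat.lt_pow_succ_log_self (by norm_num) _).le) hV Ps (by
      intro p hp
      obtain ⟨h1, h2, h3⟩ := hPs2 p hp
      refine ⟨h1, ?_, by omega, h3⟩
      have := Nat.lt_succ_sqrt N
      have h5 : 4 * (Nat.sqrt N + 1) ≤ p := by omega
      have h6 : (4 * (Nat.sqrt N + 1)) ^ 2 ≤ p ^ 2 := Nat.pow_le_pow_left h5 2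
      have h7 : N < (Nat.sqrt N + 1) * (Nat.sqrt N + 1) := this
      nlinarith) (by rw [hPs, hM]; exact Nat.lt_pow_succ_log_self (by norm_num) _) S hS
  rw [hPs] at hcore
  have hs1 : 1 ≤ Real.sqrt N := by
    rw [Real.one_le_sqrt]; exact_mod_cast hN
  have hsq : (Nat.sqrt N : ℝ) ≤ Real.sqrt N := Real.nat_sqrt_le_real_sqrt
  set s := Real.sqrt N with hs
  have hPb : (P : ℝ) ≤ 24 * s := by rw [hP]; push_cast; linarith
  have hPMb : ((P + M : ℕ) : ℝ) ≤ (25 + 2 * E) * (s * ℓ) := by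
    push_cast
    have h1 : s ≤ s * ℓ := by nlinarith
    have h2 : ℓ ≤ s * ℓ := by nlinarith
    have h3 : (2 * (E : ℝ) + 1) * ℓ ≤ (2 * E + 1) * (s * ℓ) := by gcongr
    nlinarith
  have hlast : ((D + D * A + A : ℕ) : ℝ) ≤ (D + (D + 1) * (2 * (D + 1 : ℕ) + 1)) * ℓ := by
    have h1 : (D : ℝ) ≤ D * ℓ := by nlinarith [Nat.cast_nonneg (α := ℝ) D]
    have h2 : ((D : ℝ) + 1) * A ≤ (D + 1) * ((2 * (D + 1 : ℕ) + 1) * ℓ) := by gcongr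
    calc ((D + D * A + A : ℕ) : ℝ) = D + ((D : ℝ) + 1) * A := by push_cast; ring
      _ ≤ D * ℓ + (D + 1) * ((2 * (D + 1 : ℕ) + 1) * ℓ) := add_le_add h1 h2
      _ = _ := by ring
  clear_value ℓ s L M A P V Y0 E
  have hr : (S.card : ℝ) ≤ ((D * (M * (16 * (P + M) * L * (D * (D + D * A + A)))) : ℕ) : ℝ) := by
    exact_mod_cast hcore
  refine hr.trans ?_
  calc ((D * (M * (16 * (P + M) * L * (D * (D + D * A + A)))) : ℕ) : ℝ)
      = D * (M * (16 * ((P + M : ℕ) : ℝ) * L * (D * ((D + D * A + A : ℕ) : ℝ)))) := by push_cast; ring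
    _ ≤ D * (((2 * E + 1) * ℓ) * (16 * ((25 + 2 * E) * (s * ℓ)) * ((2 * (E + 4 : ℕ) + 1) * ℓ) *
        (D * ((D + (D + 1) * (2 * (D + 1 : ℕ) + 1)) * ℓ)))) := by gcongr
    _ = (D * ((2 * E + 1) * (16 * (25 + 2 * E) * (2 * (E + 4 : ℕ) + 1) * (D * (D + (D + 1) * (2 * (D + 1 : ℕ) + 1)))))) * (s * ℓ ^ 4) := by
        ring
    _ ≤ _ := by
        apply mul_le_mul_of_nonneg_right _ (by positivity)
        linarith

end

section
/-- polynomial of degree `< E` with prescribed coefficients -/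
noncomputable def mkP {R : Type*} [CommRing R] (E : ℕ) (v : Fin E → R) : R[X] :=
  ∑ a : Fin E, C (v a) * X ^ (a : ℕ)

lemma mkP_coeff {R : Type*} [CommRing R] (E : ℕ) (v : Fin E → R) (a : ℕ) :
    (mkP E v).coeff a = if h : a < E then v ⟨a, h⟩ else 0 := by
  simp only [mkP, finsetSum_coeff, coeff_C_mul, coeff_X_pow, mul_ite, mul_one, mul_zero]
  split_ifs with h
  · rw [Finset.sum_eq_single ⟨a, h⟩]
    · simp
    · intro b _ hb
      rw [if_neg]
      rintro rfl
      exact hb rfl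
    · simp
  · refine Finset.sum_eq_zero fun b _ => ?_
    rw [if_neg]
    have := b.2
    omega

lemma mkP_degree_lt {R : Type*} [CommRing R] (E : ℕ) (v : Fin E → R) : (mkP E v).degree < E := by
  rw [degree_lt_iff_coeff_zero]
  intro m hm
  rw [mkP_coeff, dif_neg (by omega)]

lemma mkP_map {R S : Type*} [CommRing R] [CommRing S] (φ : R →+* S) (E : ℕ) (v : Fin E → R) :
    (mkP E v).map φ = mkP E (fun a => φ (v a)) := by
  simp [mkP, Polynomial.map_sum]

/-- monic bivariate polynomial with prescribed coefficients -/
noncomputable def MP {R : Type*} [CommRing R] (k E : ℕ) (h : Fin k × Fin E → R) : R[X][X] :=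
  X ^ k + mkP k (fun b => mkP E (fun a => h (b, a)))

lemma MP_monic {R : Type*} [CommRing R] (k E : ℕ) (h : Fin k × Fin E → R) : (MP k E h).Monic :=
  monic_X_pow_add (mkP_degree_lt _ _)

lemma MP_natDegree {R : Type*} [CommRing R] [Nontrivial R] (k E : ℕ) (h : Fin k × Fin E → R) :
    (MP k E h).natDegree = k := by
  refine natDegree_eq_of_degree_eq_some ?_
  rw [MP, degree_add_eq_left_of_degree_lt, degree_X_pow]
  rw [degree_X_pow]; exact mkP_degree_lt _ _

lemma MP_coeff_coeff {R : Type*} [CommRing R] (k E : ℕ) (h : Fin k × Fin E → R) (b : Fin k) (a : Fin E) :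
    ((MP k E h).coeff b).coeff a = h (b, a) := by
  have : (b : ℕ) ≠ k := b.2.ne
  simp [MP, mkP_coeff, coeff_X_pow, this]

lemma MP_map {R S : Type*} [CommRing R] [CommRing S] (φ : R →+* S) (k E : ℕ) (h : Fin k × Fin E → R) :
    (MP k E h).map (mapRingHom φ) = MP k E (fun v => φ (h v)) := by
  simp [MP, mkP_map]

lemma MP_coeff_natDegree {R : Type*} [CommRing R] (k D : ℕ) (h : Fin k × Fin (D + 1) → R) (j : ℕ) :
    ((MP k (D + 1) h).coeff j).natDegree ≤ D := by
  rw [MP, coeff_add, mkP_coeff, coeff_X_pow]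
  split_ifs with h1 h2 h2
  · omega
  · simp
  · rw [zero_add]
    rw [natDegree_le_iff_coeff_eq_zero]
    intro N hN
    rw [mkP_coeff, dif_neg (by omega)]
  · simp

lemma MP_surj {R : Type*} [CommRing R] (k E : ℕ) (f : R[X][X]) (hf : f.Monic)
    (hk : f.natDegree = k) (hE : ∀ j < k, ∀ a, E ≤ a → (f.coeff j).coeff a = 0) :
    f = MP k E (fun v => (f.coeff v.1).coeff v.2) := by
  ext j a
  rw [MP, coeff_add, mkP_coeff, coeff_X_pow]
  rcases lt_trichotomy j k with h | h | h
  · rw [if_neg h.ne, dif_pos h, zero_add, mkP_coeff]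
    split_ifs with h2
    · rfl
    · exact hE j h a (by omega)
  · rw [if_pos h, dif_neg (by omega), add_zero, h, ← hk, coeff_natDegree, hf.leadingCoeff]
  · rw [if_neg h.ne', dif_neg (by omega), coeff_eq_zero_of_natDegree_lt (p := f) (by omega)]; simp

lemma MP_inj {R : Type*} [CommRing R] (k E : ℕ) (h h' : Fin k × Fin E → R) (hh : MP k E h = MP k E h') :
    h = h' := by
  funext v
  rw [← MP_coeff_coeff k E h v.1 v.2, hh, MP_coeff_coeff]

/-- X-degree of bivariate polynomials is additive -/
lemma swap_coeff_coeff {R : Type*} [CommRing R] (f : R[X][X]) (a b : ℕ) :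
    ((Bivariate.swap f).coeff a).coeff b = (f.coeff b).coeff a := by
  induction f using Polynomial.induction_on' with
  | add p q hp hq => simp [hp, hq]
  | monomial n p =>
    induction p using Polynomial.induction_on' with
    | add p q hp hq => simp only [map_add, coeff_add, hp, hq]
    | monomial m r =>
      rw [Bivariate.swap_monomial_monomial]
      simp only [coeff_monomial]
      split_ifs <;> simp_all [coeff_monomial]

lemma coeff_natDegree_of_mul {R : Type*} [CommRing R] [IsDomain R] (D : ℕ) (f g h : R[X][X])
    (hfg : g * h = f) (hf0 : f ≠ 0) (hf : ∀ j, (f.coeff j).natDegree ≤ D) (j : ℕ) :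
    (g.coeff j).natDegree ≤ D := by
  have hh0 : h ≠ 0 := by rintro rfl; simp at hfg; exact hf0 hfg.symm
  have hg0 : g ≠ 0 := by rintro rfl; simp at hfg; exact hf0 hfg.symm
  have hs : (Bivariate.swap f).natDegree ≤ D := by
    rw [natDegree_le_iff_coeff_eq_zero]
    intro N hN
    ext b
    rw [swap_coeff_coeff, coeff_zero]
    exact coeff_eq_zero_of_natDegree_lt ((hf b).trans_lt hN)
  have hs2 : (Bivariate.swap g).natDegree ≤ D := by
    rw [← hfg, map_mul, natDegree_mul (by simpa using hg0) (by simpa using hh0)] at hs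
    omega
  rw [natDegree_le_iff_coeff_eq_zero]
  intro N hN
  rw [← swap_coeff_coeff, coeff_eq_zero_of_natDegree_lt (hs2.trans_lt hN), coeff_zero]

/-! ### Universal factorization -/

section univ
variable (k1 k2 D : ℕ)

/-- index type of coefficients of the two factors -/
abbrev FIdx (k1 k2 D : ℕ) := (Fin k1 × Fin (D + 1)) ⊕ (Fin k2 × Fin (D + 1))
/-- index type of the coefficients of the product -/
abbrev PIdx (k1 k2 D : ℕ) := Fin (k1 + k2) × Fin (2 * D + 1)

/-- coefficients of the product of two monic polynomials -/
noncomputable def prodCoeff {R : Type*} [CommRing R] (h : FIdx k1 k2 D → R) : PIdx k1 k2 D → R := fun v =>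
  ((MP k1 (D + 1) (fun u => h (Sum.inl u)) * MP k2 (D + 1) (fun u => h (Sum.inr u))).coeff v.1).coeff v.2

lemma prodCoeff_spec {R : Type*} [CommRing R] (h : FIdx k1 k2 D → R) :
    MP (k1 + k2) (2 * D + 1) (prodCoeff k1 k2 D h) =
    MP k1 (D + 1) (fun u => h (Sum.inl u)) * MP k2 (D + 1) (fun u => h (Sum.inr u)) := by
  nontriviality R
  symm
  refine MP_surj _ _ _ ((MP_monic _ _ _).mul (MP_monic _ _ _)) ?_ ?_
  · rw [(MP_monic _ _ _).natDegree_mul (MP_monic _ _ _), MP_natDegree, MP_natDegree]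
  · intro j _ a ha
    rw [coeff_mul, finsetSum_coeff]
    refine Finset.sum_eq_zero fun p _ => ?_
    apply coeff_eq_zero_of_natDegree_lt
    refine natDegree_mul_le.trans_lt ?_
    have h1 := MP_coeff_natDegree k1 D (fun u => h (Sum.inl u)) p.1
    have h2 := MP_coeff_natDegree k2 D (fun u => h (Sum.inr u)) p.2
    omega

lemma prodCoeff_map {R S : Type*} [CommRing R] [CommRing S] (φ : R →+* S) (h : FIdx k1 k2 D → R)
    (v : PIdx k1 k2 D) :
    φ (prodCoeff k1 k2 D h v) = prodCoeff k1 k2 D (fun u => φ (h u)) v := by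
  have := MP_map φ _ _ (prodCoeff k1 k2 D h)
  rw [prodCoeff_spec, Polynomial.map_mul, MP_map, MP_map] at this
  have h2 := prodCoeff_spec k1 k2 D (fun u => φ (h u))
  rw [this] at h2
  exact (congrFun (MP_inj _ _ _ _ h2) v).symm

/-- universal map -/
noncomputable def univMap : MvPolynomial (PIdx k1 k2 D) ℤ →+* MvPolynomial (FIdx k1 k2 D) ℤ :=
  (MvPolynomial.aeval (prodCoeff k1 k2 D (fun u => MvPolynomial.X u))).toRingHom

lemma univMap_X (v) : univMap k1 k2 D (MvPolynomial.X v) =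
    prodCoeff k1 k2 D (fun u => MvPolynomial.X u) v := by
  simp [univMap]

lemma univMap_comp {R : Type*} [CommRing R] (h : FIdx k1 k2 D → R) :
    (MvPolynomial.eval₂Hom (Int.castRingHom R) h).comp (univMap k1 k2 D) =
    MvPolynomial.eval₂Hom (Int.castRingHom R) (prodCoeff k1 k2 D h) := by
  apply MvPolynomial.ringHom_ext
  · intro r; simp [univMap]
  · intro v
    rw [RingHom.comp_apply, univMap_X, prodCoeff_map]
    simp

lemma univMap_integral : (univMap k1 k2 D).IsIntegral := by
  let _ : Algebra (MvPolynomial (PIdx k1 k2 D) ℤ) (MvPolynomial (FIdx k1 k2 D) ℤ) :=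
    (univMap k1 k2 D).toAlgebra
  let _ : Algebra (MvPolynomial (PIdx k1 k2 D) ℤ)[X] (MvPolynomial (FIdx k1 k2 D) ℤ)[X] :=
    Polynomial.algebra _ _
  have hspec := prodCoeff_spec k1 k2 D (fun u => (MvPolynomial.X u : MvPolynomial (FIdx k1 k2 D) ℤ))
  set H1 := MP k1 (D + 1) (fun u => (MvPolynomial.X (Sum.inl u) : MvPolynomial (FIdx k1 k2 D) ℤ)) with hH1
  set H2 := MP k2 (D + 1) (fun u => (MvPolynomial.X (Sum.inr u) : MvPolynomial (FIdx k1 k2 D) ℤ)) with hH2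
  set p := MP (k1 + k2) (2 * D + 1) (fun v => (MvPolynomial.X v : MvPolynomial (PIdx k1 k2 D) ℤ)) with hp
  have hpm : p.map (algebraMap (MvPolynomial (PIdx k1 k2 D) ℤ)[X] (MvPolynomial (FIdx k1 k2 D) ℤ)[X]) = H1 * H2 := by
    rw [← hspec]
    change p.map (mapRingHom (univMap k1 k2 D)) = _
    rw [hp, MP_map]
    congr 1
    funext v
    exact univMap_X _ _ _ v
  have key : ∀ u : FIdx k1 k2 D, IsIntegral (MvPolynomial (PIdx k1 k2 D) ℤ)
      (MvPolynomial.X u : MvPolynomial (FIdx k1 k2 D) ℤ) := by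
    rintro (u | u)
    · have h1 := isIntegral_coeff_of_dvd p H1 (MP_monic _ _ _) (MP_monic _ _ _)
        (hpm ▸ Dvd.intro _ rfl) u.1
      have h2 := (Polynomial.isIntegral_iff_isIntegral_coeff.1 h1) u.2
      rwa [hH1, MP_coeff_coeff] at h2
    · have h1 := isIntegral_coeff_of_dvd p H2 (MP_monic _ _ _) (MP_monic _ _ _)
        (hpm ▸ Dvd.intro_left _ rfl) u.1
      have h2 := (Polynomial.isIntegral_iff_isIntegral_coeff.1 h1) u.2
      rwa [hH2, MP_coeff_coeff] at h2
  intro q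
  change IsIntegral (MvPolynomial (PIdx k1 k2 D) ℤ) q
  induction q using MvPolynomial.induction_on with
  | C a => 
    have : (MvPolynomial.C a : MvPolynomial (FIdx k1 k2 D) ℤ) =
      algebraMap (MvPolynomial (PIdx k1 k2 D) ℤ) _ (MvPolynomial.C a) := by
        change _ = univMap k1 k2 D _
        simp [univMap]
    rw [this]; exact isIntegral_algebraMap
  | add p q hp hq => exact hp.add hq
  | mul_X p n hp => exact hp.mul (key n)

end univ

lemma integral_lift {U A K : Type*} [CommRing U] [CommRing A] [Field K] [IsAlgClosed K]
    (ψ : U →+* A) (hψ : ψ.IsIntegral) (c : U →+* K) (hc : RingHom.ker ψ ≤ RingHom.ker c) :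
    ∃ c' : A →+* K, c'.comp ψ = c := by
  let _ : Algebra U A := ψ.toAlgebra
  have hI : Algebra.IsIntegral U A := ⟨hψ⟩
  have hP : (RingHom.ker c).IsPrime := RingHom.ker_isPrime c
  obtain ⟨Q, -, hQ, hQP⟩ := Ideal.exists_ideal_over_prime_of_isIntegral (R := U) (S := A) (RingHom.ker c) ⊥ hc
  -- the map U → K factors
  let A' := A ⧸ Q
  let P := RingHom.ker c
  let φ : U ⧸ P →+* A ⧸ Q := Ideal.quotientMap Q ψ hQP.ge
  have hφ : Function.Injective φ := Ideal.quotientMap_injective' hQP.le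
  let cK : U ⧸ P →+* K := RingHom.kerLift c
  have hcK : Function.Injective cK := RingHom.kerLift_injective c
  let _ : Algebra (U ⧸ P) (A ⧸ Q) := φ.toAlgebra
  let _ : Algebra (U ⧸ P) K := cK.toAlgebra
  have hf1 : Module.IsTorsionFree (U ⧸ P) (A ⧸ Q) := Module.isTorsionFree_iff_algebraMap_injective.2 hφ
  have hf2 : Module.IsTorsionFree (U ⧸ P) K := Module.isTorsionFree_iff_algebraMap_injective.2 hcK
  have : Algebra.IsAlgebraic (U ⧸ P) (A ⧸ Q) := by
    have : Algebra.IsIntegral (U ⧸ P) (A ⧸ Q) := by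
      constructor
      intro x
      obtain ⟨a, rfl⟩ := Ideal.Quotient.mk_surjective x
      obtain ⟨p, hp, hpa⟩ := hψ a
      refine ⟨p.map (Ideal.Quotient.mk P), hp.map _, ?_⟩
      rw [eval₂_map]
      have e : (algebraMap (U ⧸ P) (A ⧸ Q)).comp (Ideal.Quotient.mk P) = (Ideal.Quotient.mk Q).comp ψ := by
        ext u; rfl
      rw [e, ← Polynomial.hom_eval₂, hpa, map_zero]
    exact Algebra.IsIntegral.isAlgebraic
  let L : A ⧸ Q →ₐ[U ⧸ P] K := IsAlgClosed.lift
  refine ⟨L.toRingHom.comp (Ideal.Quotient.mk Q), ?_⟩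
  ext u
  have := L.commutes (Ideal.Quotient.mk P u)
  exact this

end

section
lemma sz_count {R : Type*} [CommRing R] [IsDomain R] (φ : ℤ → R) (hφ : Function.Injective φ)
    (m E N : ℕ) (g : MvPolynomial (Fin m) R) (hg : g ≠ 0) (hE : g.totalDegree ≤ E)
    (S : Finset (Fin m → ℤ)) (hS : ∀ x ∈ S, (∀ i, |x i| ≤ N) ∧ MvPolynomial.eval (fun i => φ (x i)) g = 0) :
    S.card * (2 * N + 1) ≤ E * (2 * N + 1) ^ m := by
  classical
  have h := MvPolynomial.schwartz_zippel_totalDegree hg ((Finset.Icc (-(N : ℤ)) N).image φ)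
  have hc : ((Finset.Icc (-(N : ℤ)) N).image φ).card = 2 * N + 1 := by
    rw [Finset.card_image_of_injective _ hφ, Int.card_Icc]; omega
  have h2 : S.card ≤ (Finset.filter (fun f => MvPolynomial.eval f g = 0)
      (Fintype.piFinset fun _ : Fin m => (Finset.Icc (-(N : ℤ)) N).image φ)).card := by
    refine Finset.card_le_card_of_injOn (fun x i => φ (x i)) ?_ ?_
    · intro x hx
      obtain ⟨h1, h2⟩ := hS x hx
      simp only [Finset.coe_filter, Fintype.mem_piFinset, Finset.mem_image, Finset.mem_Icc]
      exact ⟨fun i => ⟨x i, abs_le.1 (h1 i), rfl⟩, h2⟩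
    · intro x _ y _ hxy
      funext i
      exact hφ (congrFun hxy i)
  rw [hc] at h
  rw [div_le_div_iff₀ (by positivity) (by positivity)] at h
  have h3 := (mul_le_mul_left h2 (2 * N + 1))
  refine h3.trans (le_trans ?_ (mul_le_mul_left hE _))
  exact_mod_cast h

lemma totalDegree_root (m D : ℕ) (f : (MvPolynomial (Fin m) ℤ)[X]) (hf : f.Monic)
    (hD : ∀ j, (f.coeff j).totalDegree ≤ D) (r : MvPolynomial (Fin m) ℤ) (hr : f.eval r = 0) :
    r.totalDegree ≤ D := by
  by_cases hr0 : r = 0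
  · simp [hr0]
  rcases Nat.eq_zero_or_pos f.natDegree with h0 | hpos
  · rw [hf.natDegree_eq_zero.1 h0] at hr; simp at hr
  have hpow : ∀ k, (r ^ k).totalDegree = k * r.totalDegree := by
    intro k
    induction k with
    | zero => simp
    | succ k ih => rw [pow_succ, MvPolynomial.totalDegree_mul_of_isDomain (pow_ne_zero _ hr0) hr0, ih]; ring
  rw [eval_eq_sum_range, Finset.sum_range_succ, hf.coeff_natDegree, one_mul] at hr
  have e : r ^ f.natDegree = -(∑ i ∈ Finset.range f.natDegree, f.coeff i * r ^ i) := by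
    linear_combination hr
  have h1 := hpow f.natDegree
  rw [e, MvPolynomial.totalDegree_neg] at h1
  have h2 : (∑ i ∈ Finset.range f.natDegree, f.coeff i * r ^ i).totalDegree ≤
      D + (f.natDegree - 1) * r.totalDegree := by
    refine (MvPolynomial.totalDegree_finsetSum _ _).trans (Finset.sup_le fun i hi => ?_)
    refine (MvPolynomial.totalDegree_mul _ _).trans (add_le_add (hD i) ?_)
    rw [hpow]
    exact Nat.mul_le_mul_right _ (by have := Finset.mem_range.1 hi; omega)
  obtain ⟨k, hk⟩ : ∃ k, f.natDegree = k + 1 := ⟨f.natDegree - 1, by omega⟩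
  rw [hk] at h1 h2
  simp only [Nat.add_sub_cancel] at h2
  nlinarith

lemma subst_totalDegree {σ τ : Type*} (D : ℕ) (q : MvPolynomial σ ℤ) :
    ∃ B : ℕ, ∀ c : σ → MvPolynomial τ ℤ, (∀ v, (c v).totalDegree ≤ D) →
      (MvPolynomial.eval₂Hom (Int.castRingHom (MvPolynomial τ ℤ)) c q).totalDegree ≤ B := by
  induction q using MvPolynomial.induction_on with
  | C a => refine ⟨0, fun c _ => ?_⟩; simp [← MvPolynomial.algebraMap_eq]
           rw [show ((a : MvPolynomial τ ℤ)) = MvPolynomial.C a by simp, MvPolynomial.totalDegree_C]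
  | add p q hp hq =>
    obtain ⟨B1, h1⟩ := hp
    obtain ⟨B2, h2⟩ := hq
    refine ⟨max B1 B2, fun c hc => ?_⟩
    rw [map_add]
    exact (MvPolynomial.totalDegree_add _ _).trans (max_le_max (h1 c hc) (h2 c hc))
  | mul_X p n hp =>
    obtain ⟨B1, h1⟩ := hp
    refine ⟨B1 + D, fun c hc => ?_⟩
    rw [map_mul]
    refine (MvPolynomial.totalDegree_mul _ _).trans (add_le_add (h1 c hc) ?_)
    simpa using hc n

lemma subst_value {σ : Type*} (q : MvPolynomial σ ℤ) :
    ∃ B : ℕ, ∀ T : ℕ, 3 ≤ T → ∀ a : σ → ℤ, (∀ v, |a v| ≤ T) →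
      |MvPolynomial.eval₂Hom (Int.castRingHom ℤ) a q| ≤ (T : ℤ) ^ B := by
  induction q using MvPolynomial.induction_on with
  | C a =>
    refine ⟨a.natAbs, fun T hT c _ => ?_⟩
    simp only [MvPolynomial.coe_eval₂Hom, MvPolynomial.eval₂_C]
    rw [eq_intCast, Int.cast_id, Int.abs_eq_natAbs]
    have h1 : a.natAbs < 2 ^ a.natAbs := Nat.lt_two_pow_self
    have h2 : 2 ^ a.natAbs ≤ T ^ a.natAbs := Nat.pow_le_pow_left (by omega) _
    exact_mod_cast (h1.le.trans h2)
  | add p q hp hq =>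
    obtain ⟨B1, h1⟩ := hp
    obtain ⟨B2, h2⟩ := hq
    refine ⟨B1 + B2 + 1, fun T hT c hc => ?_⟩
    rw [map_add]
    have hT' : (3 : ℤ) ≤ T := by exact_mod_cast hT
    have e1 : (T : ℤ) ^ B1 ≤ T ^ (B1 + B2) := pow_le_pow_right₀ (by linarith) (by omega)
    have e2 : (T : ℤ) ^ B2 ≤ T ^ (B1 + B2) := pow_le_pow_right₀ (by linarith) (by omega)
    have e3 : (0 : ℤ) < T ^ (B1 + B2) := by positivity
    calc _ ≤ _ := abs_add_le _ _
      _ ≤ (T : ℤ) ^ B1 + T ^ B2 := add_le_add (h1 T hT c hc) (h2 T hT c hc)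
      _ ≤ T ^ (B1 + B2 + 1) := by rw [pow_succ]; nlinarith
  | mul_X p n hp =>
    obtain ⟨B1, h1⟩ := hp
    refine ⟨B1 + 1, fun T hT c hc => ?_⟩
    rw [map_mul, abs_mul, pow_succ]
    refine mul_le_mul (h1 T hT c hc) ?_ (abs_nonneg _) (by positivity)
    simpa using hc n

lemma exists_chi (k1 k2 D : ℕ) (u : FIdx k1 k2 D) :
    ∃ χ : (MvPolynomial (PIdx k1 k2 D) ℤ)[X], χ.Monic ∧
      ∀ (R : Type) [CommRing R] (h : FIdx k1 k2 D → R) (c : PIdx k1 k2 D → R),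
        prodCoeff k1 k2 D h = c →
        (χ.map (MvPolynomial.eval₂Hom (Int.castRingHom R) c)).eval (h u) = 0 := by
  obtain ⟨χ, h1, h2⟩ := univMap_integral k1 k2 D (MvPolynomial.X u)
  refine ⟨χ, h1, fun R _ h c hc => ?_⟩
  rw [eval_map, ← hc, ← univMap_comp]
  have := congrArg (MvPolynomial.eval₂Hom (Int.castRingHom R) h) h2
  rw [hom_eval₂] at this
  simpa using this

end

section
/-- the multivariable point-counting statement, in `m` variables -/
def TP (m : ℕ) : Prop := ∀ D : ℕ, ∃ C : ℝ, 0 < C ∧ ∀ N T : ℕ, 1 ≤ N → N + 2 ≤ T →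
  ∀ f : (MvPolynomial (Fin m) ℤ)[X], f.Monic → f.natDegree ≤ D →
  (∀ j, (f.coeff j).totalDegree ≤ D) →
  (∀ j, ∀ x : Fin m → ℤ, (∀ i, |x i| ≤ N) → |MvPolynomial.eval x (f.coeff j)| ≤ T) →
  ∀ S : Finset (Fin m → ℤ),
  (∀ x ∈ S, (∀ i, |x i| ≤ N) ∧ ∃ y, (f.map (MvPolynomial.eval x)).eval y = 0 ∧
    ∀ r, f.eval r = 0 → MvPolynomial.eval x r ≠ y) →
  (S.card : ℝ) * Real.sqrt N ≤ C * ((N : ℝ) ^ m * Real.log T ^ 4)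

lemma sz_real {R : Type*} [CommRing R] [IsDomain R] (φ : ℤ → R) (hφ : Function.Injective φ)
    (m E N : ℕ) (hN : 1 ≤ N) (g : MvPolynomial (Fin m) R) (hg : g ≠ 0) (hE : g.totalDegree ≤ E)
    (S : Finset (Fin m → ℤ)) (hS : ∀ x ∈ S, (∀ i, |x i| ≤ N) ∧ MvPolynomial.eval (fun i => φ (x i)) g = 0) :
    (S.card : ℝ) * N ≤ E * 3 ^ m * (N : ℝ) ^ m := by
  have h := sz_count φ hφ m E N g hg hE S hS
  have h1 : ((S.card * (2 * N + 1) : ℕ) : ℝ) ≤ ((E * (2 * N + 1) ^ m : ℕ) : ℝ) := by exact_mod_cast h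
  push_cast at h1
  have hN' : (1 : ℝ) ≤ N := by exact_mod_cast hN
  have h2 : (2 * (N : ℝ) + 1) ^ m ≤ (3 * N) ^ m := pow_le_pow_left₀ (by positivity) (by linarith) _
  rw [mul_pow] at h2
  have h3 : (0 : ℝ) ≤ S.card := by positivity
  have h4 : (0 : ℝ) ≤ E := by positivity
  calc (S.card : ℝ) * N ≤ S.card * (2 * N + 1) := by nlinarith
    _ ≤ E * (2 * N + 1) ^ m := h1
    _ ≤ E * (3 ^ m * N ^ m) := by gcongr
    _ = _ := by ring

/-- combine the bounds on the sizes of the coefficients of a fixed polynomial -/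
lemma chi_bounds (m k1 k2 D D0 : ℕ) (χ : (MvPolynomial (PIdx k1 k2 D) ℤ)[X]) (hχ : χ.Monic) :
    ∃ B : ℕ, 1 ≤ B ∧ ∀ c : PIdx k1 k2 D → MvPolynomial (Fin m) ℤ, (∀ v, (c v).totalDegree ≤ D0) →
      ∀ f, f = χ.map (MvPolynomial.eval₂Hom (Int.castRingHom (MvPolynomial (Fin m) ℤ)) c) →
      f.Monic ∧ f.natDegree ≤ B ∧ (∀ j, (f.coeff j).totalDegree ≤ B) ∧
      ∀ T : ℕ, 3 ≤ T → ∀ x : Fin m → ℤ, (∀ v, |MvPolynomial.eval x (c v)| ≤ T) →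
        ∀ j, |MvPolynomial.eval x (f.coeff j)| ≤ ((T ^ B : ℕ) : ℤ) := by
  have h1 := fun j => subst_totalDegree (τ := Fin m) D0 (χ.coeff j)
  have h2 := fun j => subst_value (χ.coeff j)
  choose B1 hB1 using h1
  choose B2 hB2 using h2
  set K := χ.natDegree + 1
  refine ⟨K + ∑ j ∈ Finset.range K, B1 j + ∑ j ∈ Finset.range K, B2 j, by omega, ?_⟩
  rintro c hc f rfl
  refine ⟨hχ.map _, ?_, ?_, ?_⟩
  · exact natDegree_map_le.trans (by omega)
  · intro j
    rw [coeff_map]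
    by_cases hj : j ∈ Finset.range K
    · refine (hB1 j c hc).trans ?_
      have := Finset.single_le_sum (f := B1) (fun i _ => Nat.zero_le _) hj
      omega
    · rw [coeff_eq_zero_of_natDegree_lt (by simp [K] at hj; omega)]; simp
  · intro T hT x hx j
    rw [coeff_map]
    by_cases hj : j ∈ Finset.range K
    · have e : MvPolynomial.eval x (MvPolynomial.eval₂Hom (Int.castRingHom (MvPolynomial (Fin m) ℤ)) c (χ.coeff j))
          = MvPolynomial.eval₂Hom (Int.castRingHom ℤ) (fun v => MvPolynomial.eval x (c v)) (χ.coeff j) := by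
        rw [← RingHom.comp_apply]
        congr 1
        apply MvPolynomial.ringHom_ext <;> simp
      rw [e]
      refine (hB2 j T hT _ hx).trans ?_
      have := Finset.single_le_sum (f := B2) (fun i _ => Nat.zero_le _) hj
      push_cast
      exact pow_le_pow_right₀ (by exact_mod_cast (by omega : 1 ≤ T)) (by omega)
    · rw [coeff_eq_zero_of_natDegree_lt (by simp [K] at hj; omega)]; simp

lemma lemB (m : ℕ) (hTP : TP m) (k1 k2 D D0 : ℕ) : ∃ C : ℝ, 0 < C ∧ ∀ N T : ℕ, 1 ≤ N → N + 2 ≤ T →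
    ∀ c : PIdx k1 k2 D → MvPolynomial (Fin m) ℤ, (∀ v, (c v).totalDegree ≤ D0) →
    (∀ v, ∀ x : Fin m → ℤ, (∀ i, |x i| ≤ N) → |MvPolynomial.eval x (c v)| ≤ T) →
    ∀ S : Finset (Fin m → ℤ),
    (∀ x ∈ S, (∀ i, |x i| ≤ N) ∧ ∃ h : FIdx k1 k2 D → ℤ,
      prodCoeff k1 k2 D h = (fun v => MvPolynomial.eval x (c v)) ∧
      ∀ r : FIdx k1 k2 D → MvPolynomial (Fin m) ℤ, prodCoeff k1 k2 D r = c →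
        (fun u => MvPolynomial.eval x (r u)) ≠ h) →
    (S.card : ℝ) * Real.sqrt N ≤ C * ((N : ℝ) ^ m * Real.log T ^ 4) := by
  classical
  have hchi := exists_chi k1 k2 D
  choose χ hχm hχ using hchi
  have hb := fun u => chi_bounds m k1 k2 D D0 (χ u) (hχm u)
  choose B hB1 hB using hb
  have ht := fun u => hTP (B u)
  choose Cu hCu0 hCu using ht
  -- degree bound for roots
  obtain ⟨Br, hBr⟩ : ∃ Br, ∀ u, B u ≤ Br := ⟨∑ u, B u, fun u =>
    Finset.single_le_sum (f := B) (fun i _ => Nat.zero_le _) (Finset.mem_univ u)⟩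
  have hd := fun v : PIdx k1 k2 D => subst_totalDegree (τ := Fin m) Br (univMap k1 k2 D (MvPolynomial.X v))
  choose D1 hD1 using hd
  set E := ∑ v, D1 v + D0 with hE
  set V := Fintype.card (PIdx k1 k2 D)
  set W := ∏ u, B u
  refine ⟨(∑ u, Cu u * (B u : ℝ) ^ 4) + W * V * (E * 3 ^ m) + 1, ?_, ?_⟩
  · have : 0 ≤ ∑ u, Cu u * (B u : ℝ) ^ 4 := Finset.sum_nonneg fun u _ => by have := hCu0 u; positivity
    positivity
  intro N T hN hT c hc hcv S hS
  have hN' : (1 : ℝ) ≤ N := by exact_mod_cast hN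
  have hlog : 1 ≤ Real.log T := one_le_log T (by omega)
  choose! hbox h hprod hne using hS
  set f : FIdx k1 k2 D → (MvPolynomial (Fin m) ℤ)[X] := fun u =>
    (χ u).map (MvPolynomial.eval₂Hom (Int.castRingHom (MvPolynomial (Fin m) ℤ)) c) with hf
  have hfB := fun u => hB u c hc (f u) rfl
  have hroot : ∀ u, ∀ x ∈ S, ((f u).map (MvPolynomial.eval x)).eval (h x u) = 0 := by
    intro u x hx
    have := hχ u ℤ (h x) _ (hprod x hx)
    rw [hf, Polynomial.map_map]
    convert this using 3
    apply MvPolynomial.ringHom_ext <;> simp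
  set Su : FIdx k1 k2 D → Finset (Fin m → ℤ) := fun u =>
    S.filter (fun x => ∀ r, (f u).eval r = 0 → MvPolynomial.eval x r ≠ h x u) with hSu
  have hSuc : ∀ u, ((Su u).card : ℝ) * Real.sqrt N ≤ Cu u * (B u : ℝ) ^ 4 * ((N : ℝ) ^ m * Real.log T ^ 4) := by
    intro u
    have hTT : N + 2 ≤ T ^ (B u) := hT.trans (Nat.le_self_pow (by have := hB1 u; omega) T)
    have := hCu u N (T ^ B u) hN hTT (f u) (hfB u).1 (hfB u).2.1 (hfB u).2.2.1
      (fun j x hx => (hfB u).2.2.2 T (by omega) x (fun v => hcv v x hx) j) (Su u) (by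
        intro x hx
        rw [hSu, Finset.mem_filter] at hx
        exact ⟨hbox x hx.1, h x u, hroot u x hx.1, hx.2⟩)
    push_cast at this
    rw [Real.log_pow, mul_pow] at this
    calc _ ≤ _ := this
      _ = _ := by ring
  -- good points
  set RT := Fintype.piFinset (fun u => (f u).roots.toFinset) with hRT
  have hRTc : RT.card ≤ W := by
    rw [hRT, Fintype.card_piFinset]
    refine Finset.prod_le_prod' fun u _ => ?_
    exact (Multiset.toFinset_card_le _).trans ((card_roots' _).trans (hfB u).2.1)
  set Z : (FIdx k1 k2 D → MvPolynomial (Fin m) ℤ) × PIdx k1 k2 D → Finset (Fin m → ℤ) := fun p =>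
    if prodCoeff k1 k2 D p.1 p.2 - c p.2 = 0 then ∅ else
    S.filter (fun x => MvPolynomial.eval x (prodCoeff k1 k2 D p.1 p.2 - c p.2) = 0) with hZ
  have hZc : ∀ p ∈ RT ×ˢ Finset.univ, ((Z p).card : ℝ) * N ≤ E * 3 ^ m * (N : ℝ) ^ m := by
    intro p hp
    rw [hZ]
    dsimp only
    split_ifs with h0
    · simp; positivity
    · refine sz_real (fun z => z) (fun _ _ h => h) m E N hN _ h0 ?_ _ ?_
      · refine (MvPolynomial.totalDegree_sub _ _).trans (max_le ?_ ?_)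
        · have e : prodCoeff k1 k2 D p.1 p.2 = MvPolynomial.eval₂Hom (Int.castRingHom (MvPolynomial (Fin m) ℤ)) p.1
              (univMap k1 k2 D (MvPolynomial.X p.2)) := by
            rw [← RingHom.comp_apply, univMap_comp]; simp
          rw [e]
          refine (hD1 p.2 p.1 (fun u => ?_)).trans ?_
          · have hp1 := (Finset.mem_product.1 hp).1
            rw [hRT, Fintype.mem_piFinset] at hp1
            have := hp1 u
            rw [Multiset.mem_toFinset, mem_roots (hfB u).1.ne_zero] at this
            exact (totalDegree_root m (B u) (f u) (hfB u).1 (hfB u).2.2.1 _ this).trans (hBr u)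
          · have := Finset.single_le_sum (f := D1) (fun i _ => Nat.zero_le _) (Finset.mem_univ p.2)
            omega
        · exact (hc _).trans (by omega)
      · intro x hx
        rw [Finset.mem_filter] at hx
        exact ⟨hbox x hx.1, hx.2⟩
  have hcover : S ⊆ (Finset.univ.biUnion Su) ∪ ((RT ×ˢ Finset.univ).biUnion Z) := by
    intro x hx
    rw [Finset.mem_union]
    by_contra hcon
    push Not at hcon
    obtain ⟨hc1, hc2⟩ := hcon
    have hex : ∀ u, ∃ r, (f u).eval r = 0 ∧ MvPolynomial.eval x r = h x u := by
      intro u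
      by_contra hcc
      push Not at hcc
      exact hc1 (Finset.mem_biUnion.2 ⟨u, Finset.mem_univ _, Finset.mem_filter.2 ⟨hx, hcc⟩⟩)
    choose r hr1 hr2 using hex
    have hrc : prodCoeff k1 k2 D r ≠ c := fun hcc => hne x hx r hcc (funext hr2)
    obtain ⟨v, hv⟩ := Function.ne_iff.1 hrc
    apply hc2
    refine Finset.mem_biUnion.2 ⟨(r, v), ?_, ?_⟩
    · refine Finset.mem_product.2 ⟨?_, Finset.mem_univ _⟩
      rw [hRT, Fintype.mem_piFinset]
      intro u
      rw [Multiset.mem_toFinset, mem_roots (hfB u).1.ne_zero]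
      exact hr1 u
    · rw [hZ]
      dsimp only
      rw [if_neg (sub_ne_zero.2 hv), Finset.mem_filter]
      refine ⟨hx, ?_⟩
      rw [map_sub, prodCoeff_map, funext hr2, hprod x hx]
      ring
  have hcard : (S.card : ℝ) ≤ ∑ u, ((Su u).card : ℝ) + ∑ p ∈ RT ×ˢ Finset.univ, ((Z p).card : ℝ) := by
    have h1 := Finset.card_le_card hcover
    have h2 := h1.trans (Finset.card_union_le _ _)
    have h3 := h2.trans (add_le_add Finset.card_biUnion_le Finset.card_biUnion_le)
    exact_mod_cast h3
  have hsq : Real.sqrt N ≤ N := by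
    rw [Real.sqrt_le_left (by linarith)]; nlinarith
  have hZs : ∑ p ∈ RT ×ˢ Finset.univ, ((Z p).card : ℝ) * Real.sqrt N ≤ W * V * (E * 3 ^ m * (N : ℝ) ^ m) := by
    calc _ ≤ ∑ p ∈ RT ×ˢ (Finset.univ : Finset (PIdx k1 k2 D)), (E * 3 ^ m * (N : ℝ) ^ m) := by
          refine Finset.sum_le_sum fun p hp => le_trans ?_ (hZc p hp)
          gcongr
      _ ≤ _ := by
          rw [Finset.sum_const, nsmul_eq_mul, Finset.card_product, Finset.card_univ]
          push_cast
          gcongr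
  have hl4 : 1 ≤ Real.log T ^ 4 := one_le_pow₀ hlog
  have hNm : (0 : ℝ) < (N : ℝ) ^ m := by positivity
  calc (S.card : ℝ) * Real.sqrt N ≤ (∑ u, ((Su u).card : ℝ) + ∑ p ∈ RT ×ˢ Finset.univ, ((Z p).card : ℝ)) * Real.sqrt N := by
        gcongr
    _ = ∑ u, ((Su u).card : ℝ) * Real.sqrt N + ∑ p ∈ RT ×ˢ Finset.univ, ((Z p).card : ℝ) * Real.sqrt N := by
        rw [add_mul, Finset.sum_mul, Finset.sum_mul]
    _ ≤ ∑ u, Cu u * (B u : ℝ) ^ 4 * ((N : ℝ) ^ m * Real.log T ^ 4) + W * V * (E * 3 ^ m * (N : ℝ) ^ m) :=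
        add_le_add (Finset.sum_le_sum fun u _ => hSuc u) hZs
    _ ≤ ∑ u, Cu u * (B u : ℝ) ^ 4 * ((N : ℝ) ^ m * Real.log T ^ 4) + W * V * (E * 3 ^ m * ((N : ℝ) ^ m * Real.log T ^ 4)) := by
        gcongr
        nlinarith
    _ ≤ _ := by
        rw [← Finset.sum_mul]
        have : 0 ≤ (N : ℝ) ^ m * Real.log T ^ 4 := by positivity
        nlinarith

end

section
lemma lagrange_bound (D : ℕ) : ∃ K : ℕ, 1 ≤ K ∧ ∀ p : ℤ[X], p.natDegree ≤ D → ∀ T : ℕ,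
    (∀ i : ℕ, i ≤ D → |p.eval (i : ℤ)| ≤ T) → ∀ j, |p.coeff j| ≤ ((K * T : ℕ) : ℤ) := by
  classical
  set v : ℕ → ℚ := fun i => (i : ℚ)
  set s := Finset.range (D + 1)
  set A : ℚ := ∑ j ∈ s, ∑ i ∈ s, |(Lagrange.basis s v i).coeff j| with hA
  obtain ⟨K, hK⟩ := exists_nat_ge A
  refine ⟨K + 1, by omega, fun p hp T hT j => ?_⟩
  by_cases hj : j ∈ s
  swap
  · rw [coeff_eq_zero_of_natDegree_lt (by simp [s] at hj; omega)]; simp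
  have hvs : Set.InjOn v s := fun a _ b _ h => by simpa [v] using h
  have hdeg : (p.map (Int.castRingHom ℚ)).degree < s.card := by
    rw [Finset.card_range]
    refine lt_of_le_of_lt degree_map_le (lt_of_le_of_lt degree_le_natDegree ?_)
    exact_mod_cast Nat.lt_succ_of_le hp
  have h := Lagrange.eq_interpolate hvs hdeg
  have h2 : ((p.coeff j : ℤ) : ℚ) = ∑ i ∈ s, ((p.eval (i : ℤ) : ℤ) : ℚ) * (Lagrange.basis s v i).coeff j := by
    have h3 := congrArg (fun q => q.coeff j) h
    simp only [coeff_map, Lagrange.interpolate_apply, finsetSum_coeff, coeff_C_mul] at h3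
    rw [eq_intCast] at h3
    rw [h3]
    refine Finset.sum_congr rfl fun i _ => ?_
    congr 1
    simp [v]
  have h4 : |((p.coeff j : ℤ) : ℚ)| ≤ T * A := by
    rw [h2]
    refine (Finset.abs_sum_le_sum_abs _ _).trans ?_
    calc _ ≤ ∑ i ∈ s, T * |(Lagrange.basis s v i).coeff j| := by
          refine Finset.sum_le_sum fun i hi => ?_
          rw [abs_mul]
          refine mul_le_mul_of_nonneg_right ?_ (abs_nonneg _)
          have := hT i (by simp [s] at hi; omega)
          exact_mod_cast this
      _ = T * ∑ i ∈ s, |(Lagrange.basis s v i).coeff j| := by rw [Finset.mul_sum]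
      _ ≤ T * A := by
          refine mul_le_mul_of_nonneg_left ?_ (by positivity)
          exact Finset.single_le_sum (f := fun j => ∑ i ∈ s, |(Lagrange.basis s v i).coeff j|)
            (fun _ _ => Finset.sum_nonneg fun _ _ => abs_nonneg _) hj
  have h5 : |((p.coeff j : ℤ) : ℚ)| ≤ ((((K + 1) * T : ℕ) : ℤ) : ℚ) := by
    refine h4.trans ?_
    push_cast
    have : (0 : ℚ) ≤ T := by positivity
    nlinarith
  exact_mod_cast h5

lemma fibre_count (m : ℕ) (S : Finset (Fin (m + 1) → ℤ)) (Q : Finset (Fin m → ℤ))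
    (hQ : ∀ x ∈ S, Fin.tail x ∈ Q) (K : ℝ)
    (hK : ∀ x' ∈ Q, ∀ S0 : Finset ℤ, (∀ a ∈ S0, (Fin.cons a x' : Fin (m + 1) → ℤ) ∈ S) → (S0.card : ℝ) ≤ K) :
    (S.card : ℝ) ≤ Q.card * K := by
  classical
  rw [Finset.card_eq_sum_card_fiberwise (s := S) (f := fun x : Fin (m + 1) → ℤ => (Fin.tail x : Fin m → ℤ)) (t := Q)
    (fun x hx => hQ x hx)]
  push_cast
  rw [← nsmul_eq_mul]
  refine Finset.sum_le_card_nsmul _ _ _ fun x' hx' => ?_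
  have hinj : Set.InjOn (fun x : Fin (m + 1) → ℤ => x 0) (S.filter fun x => Fin.tail x = x') := by
    intro x hx y hy hxy
    simp only [Finset.coe_filter] at hx hy
    rw [← Fin.cons_self_tail x, ← Fin.cons_self_tail y, hx.2, hy.2]
    simp only at hxy
    rw [hxy]
  rw [← Finset.card_image_of_injOn hinj]
  refine hK x' hx' _ ?_
  intro a ha
  obtain ⟨x, hx, rfl⟩ := Finset.mem_image.1 ha
  rw [Finset.mem_filter] at hx
  rw [← hx.2, Fin.cons_self_tail]
  exact hx.1

lemma factor_MP {R : Type*} [CommRing R] [IsDomain R] (k1 k2 D : ℕ) (f a b : R[X][X])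
    (ha : a.Monic) (hb : b.Monic) (hab : a * b = f) (h1 : a.natDegree = k1) (h2 : b.natDegree = k2)
    (hf : ∀ j, (f.coeff j).natDegree ≤ D) :
    ∃ h : FIdx k1 k2 D → R, a = MP k1 (D + 1) (fun u => h (Sum.inl u)) ∧
      b = MP k2 (D + 1) (fun u => h (Sum.inr u)) ∧
      prodCoeff k1 k2 D h = fun v => (f.coeff v.1).coeff v.2 := by
  have hf0 : f ≠ 0 := hab ▸ (ha.mul hb).ne_zero
  have da := coeff_natDegree_of_mul D f a b hab hf0 hf
  have db := coeff_natDegree_of_mul D f b a (by rw [mul_comm]; exact hab) hf0 hf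
  have ea := MP_surj k1 (D + 1) a ha h1 (fun j _ i hi => coeff_eq_zero_of_natDegree_lt (by have := da j; omega))
  have eb := MP_surj k2 (D + 1) b hb h2 (fun j _ i hi => coeff_eq_zero_of_natDegree_lt (by have := db j; omega))
  refine ⟨Sum.elim (fun v => (a.coeff v.1).coeff v.2) (fun v => (b.coeff v.1).coeff v.2), ?_, ?_, ?_⟩
  · simpa using ea
  · simpa using eb
  · funext v
    rw [prodCoeff]
    simp only [Sum.elim_inl, Sum.elim_inr]
    rw [← ea, ← eb, hab]

lemma box_card (m N : ℕ) : (Fintype.piFinset (fun _ : Fin m => Finset.Icc (-(N : ℤ)) N)).card = (2 * N + 1) ^ m := by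
  rw [Fintype.card_piFinset]
  simp
  congr 1; omega

lemma box_mem (m N : ℕ) (x : Fin m → ℤ) :
    x ∈ Fintype.piFinset (fun _ : Fin m => Finset.Icc (-(N : ℤ)) N) ↔ ∀ i, |x i| ≤ N := by
  simp [Fintype.mem_piFinset, abs_le]

lemma box_card_le (m N : ℕ) (hN : 1 ≤ N) : (((2 * N + 1) ^ m : ℕ) : ℝ) ≤ 3 ^ m * (N : ℝ) ^ m := by
  rw [← mul_pow]
  push_cast
  have : (1 : ℝ) ≤ N := by exact_mod_cast hN
  exact pow_le_pow_left₀ (by positivity) (by linarith) _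

lemma TP_zero : TP 0 := by
  intro D
  refine ⟨1, one_pos, fun N T hN hT f hf _ _ _ S hS => ?_⟩
  have : S = ∅ := by
    by_contra hne
    obtain ⟨x, hx⟩ := Finset.nonempty_iff_ne_empty.2 hne
    obtain ⟨-, y, hy, hr⟩ := hS x hx
    refine hr (MvPolynomial.C y) ?_ (by simp)
    have h1 : MvPolynomial.eval x (f.eval (MvPolynomial.C y)) = 0 := by
      rw [← Polynomial.eval₂_hom, ← eval_map]
      simpa using hy
    rw [MvPolynomial.eq_C_of_isEmpty (eval (MvPolynomial.C y) f)] at h1 ⊢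
    rw [MvPolynomial.eval_C] at h1
    rw [h1, map_zero]
  rw [this]
  simp
  positivity

end

section
lemma spec_eval (m : ℕ) (x0 : ℤ) (x' : Fin m → ℤ) (f : (MvPolynomial (Fin (m + 1)) ℤ)[X]) (y : ℤ) :
    (f.map (MvPolynomial.eval (Fin.cons x0 x' : Fin (m + 1) → ℤ))).eval y =
    ((f.map (MvPolynomial.finSuccEquiv ℤ m : MvPolynomial (Fin (m + 1)) ℤ →+* (MvPolynomial (Fin m) ℤ)[X])).map
      (mapRingHom (MvPolynomial.eval x'))).evalEval x0 y := by
  rw [Polynomial.map_map]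
  have : (MvPolynomial.eval (Fin.cons x0 x' : Fin (m + 1) → ℤ)) = (evalRingHom x0).comp
      ((mapRingHom (MvPolynomial.eval x')).comp
        (MvPolynomial.finSuccEquiv ℤ m : MvPolynomial (Fin (m + 1)) ℤ →+* (MvPolynomial (Fin m) ℤ)[X])) := by
    apply RingHom.ext
    intro p
    rw [MvPolynomial.eval_eq_eval_mv_eval']
    rfl
  rw [this, ← Polynomial.map_map, evalEval]
  rw [← coe_evalRingHom x0, Polynomial.eval, Polynomial.eval, hom_eval₂, eval₂_map]
  simp

lemma TP_succ (m : ℕ) (hTP : TP m) : TP (m + 1) := by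
  classical
  intro D
  obtain ⟨C1, hC1, hcurve⟩ := curve_lemma D
  obtain ⟨K, hK1, hK⟩ := lagrange_bound D
  have hB := fun k2 => lemB m hTP 1 k2 D D
  choose CB hCB0 hCB using hB
  have hKl : 0 ≤ Real.log K := Real.log_natCast_nonneg K
  set CC := ∑ k ∈ Finset.range (D + 1), CB k with hCC
  have hCCk : ∀ k ≤ D, CB k ≤ CC := fun k hk =>
    Finset.single_le_sum (f := CB) (fun i _ => (hCB0 i).le) (Finset.mem_range.2 (by omega))
  have hCC0 : 0 ≤ CC := Finset.sum_nonneg fun i _ => (hCB0 i).le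
  refine ⟨3 ^ m * C1 + 3 * CC * (1 + Real.log K) ^ 4 + (3 * (D + 1)) ^ (m + 1) * (D + 1), by positivity, ?_⟩
  intro N T hN hT f hf hfD hfd hfv S hS
  have hN' : (1 : ℝ) ≤ N := by exact_mod_cast hN
  have hlog : 1 ≤ Real.log T := one_le_log T (by omega)
  have hl4 : 1 ≤ Real.log T ^ 4 := one_le_pow₀ hlog
  have hsq : Real.sqrt N ≤ N := by
    rw [Real.sqrt_le_left (by linarith)]; nlinarith
  have hSbox : S.card ≤ (2 * N + 1) ^ (m + 1) := by
    rw [← box_card]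
    exact Finset.card_le_card fun x hx => (box_mem _ _ _).2 (hS x hx).1
  rcases lt_or_ge N D with hND | hND
  · -- trivial bound
    have h1 : (S.card : ℝ) ≤ 3 ^ (m + 1) * (N : ℝ) ^ (m + 1) :=
      le_trans (by exact_mod_cast hSbox) (box_card_le (m + 1) N hN)
    have h2 : (N : ℝ) ≤ D + 1 := by exact_mod_cast (by omega : N ≤ D + 1)
    have h3 : (1 : ℝ) ≤ (N : ℝ) ^ (m + 1) * Real.log T ^ 4 := by
      have : (1 : ℝ) ≤ (N : ℝ) ^ (m + 1) := one_le_pow₀ hN'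
      nlinarith
    have h4 : (N : ℝ) ^ (m + 1) ≤ ((D : ℝ) + 1) ^ (m + 1) := pow_le_pow_left₀ (by positivity) h2 _
    calc (S.card : ℝ) * Real.sqrt N ≤ (3 ^ (m + 1) * ((D : ℝ) + 1) ^ (m + 1)) * (D + 1) := by
          refine mul_le_mul (h1.trans ?_) (hsq.trans h2) (by positivity) (by positivity)
          gcongr
      _ = (3 * ((D : ℝ) + 1)) ^ (m + 1) * (D + 1) := by rw [mul_pow]
      _ ≤ (3 ^ m * C1 + 3 * CC * (1 + Real.log K) ^ 4 + (3 * ((D : ℝ) + 1)) ^ (m + 1) * (D + 1)) * 1 := by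
          have : 0 ≤ 3 ^ m * C1 + 3 * CC * (1 + Real.log K) ^ 4 := by positivity
          linarith
      _ ≤ _ := by gcongr
  -- main case
  choose! hbox y hy hne using hS
  rcases Nat.eq_zero_or_pos f.natDegree with hd0 | hdpos
  · have : S = ∅ := by
      by_contra hne
      obtain ⟨x, hx⟩ := Finset.nonempty_iff_ne_empty.2 hne
      have := hy x hx
      rw [hf.natDegree_eq_zero.1 hd0] at this
      simp at this
    rw [this]; simp; positivity
  obtain ⟨k2, hk2⟩ : ∃ k2, f.natDegree = 1 + k2 := ⟨f.natDegree - 1, by omega⟩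
  set ι : MvPolynomial (Fin (m + 1)) ℤ →+* (MvPolynomial (Fin m) ℤ)[X] :=
    (MvPolynomial.finSuccEquiv ℤ m : MvPolynomial (Fin (m + 1)) ℤ →+* (MvPolynomial (Fin m) ℤ)[X]) with hι
  set F := f.map ι with hF
  have hFm : F.Monic := hf.map _
  have hFk : F.natDegree = 1 + k2 := by rw [hF, hf.natDegree_map, hk2]
  have hFX : ∀ j, (F.coeff j).natDegree ≤ D := by
    intro j
    rw [hF, coeff_map]
    change (MvPolynomial.finSuccEquiv ℤ m (f.coeff j)).natDegree ≤ D
    rw [MvPolynomial.natDegree_finSuccEquiv]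
    exact (MvPolynomial.degreeOf_le_totalDegree _ _).trans (hfd j)
  have hFc : ∀ j a, ((F.coeff j).coeff a).totalDegree ≤ D := by
    intro j a
    rw [hF, coeff_map]
    change ((MvPolynomial.finSuccEquiv ℤ m (f.coeff j)).coeff a).totalDegree ≤ D
    by_cases h0 : (MvPolynomial.finSuccEquiv ℤ m (f.coeff j)).coeff a = 0
    · rw [h0]; simp
    have := MvPolynomial.totalDegree_coeff_finSuccEquiv_add_le (f.coeff j) a h0
    have := hfd j
    omega
  set c : PIdx 1 k2 D → MvPolynomial (Fin m) ℤ := fun v => (F.coeff v.1).coeff v.2 with hc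
  have hFMP : F = MP (1 + k2) (2 * D + 1) c :=
    MP_surj _ _ F hFm hFk (fun j _ a ha => coeff_eq_zero_of_natDegree_lt (by have := hFX j; omega))
  have hFv : ∀ (x' : Fin m → ℤ), (∀ i, |x' i| ≤ N) → ∀ j, ∀ x : ℤ, |x| ≤ N →
      |((F.map (mapRingHom (MvPolynomial.eval x'))).coeff j).eval x| ≤ T := by
    intro x' hx' j x hx
    have := hfv j (Fin.cons x x') (by
      intro i
      refine Fin.cases ?_ ?_ i
      · simpa using hx
      · intro i; simpa using hx' i)
    rw [MvPolynomial.eval_eq_eval_mv_eval'] at this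
    rw [coeff_map, hF, coeff_map]
    exact this
  have hFx : ∀ (x' : Fin m → ℤ) j, ((F.map (mapRingHom (MvPolynomial.eval x'))).coeff j).natDegree ≤ D := by
    intro x' j
    rw [coeff_map]
    exact natDegree_map_le.trans (hFX j)
  have hcv : ∀ v, ∀ x' : Fin m → ℤ, (∀ i, |x' i| ≤ N) → |MvPolynomial.eval x' (c v)| ≤ ((K * T : ℕ) : ℤ) := by
    intro v x' hx'
    have := hK _ (hFx x' v.1) T (fun i hi => hFv x' hx' v.1 i (by
      rw [abs_of_nonneg (by positivity)]; exact_mod_cast hi.trans hND)) v.2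
    rw [coeff_map, coe_mapRingHom, coeff_map] at this
    exact this
  -- split
  set P1 : (Fin (m + 1) → ℤ) → Prop := fun x => ∀ r : ℤ[X],
    (F.map (mapRingHom (MvPolynomial.eval (Fin.tail x)))).eval r = 0 → r.eval (x 0) ≠ y x with hP1
  have hroot : ∀ x ∈ S, (F.map (mapRingHom (MvPolynomial.eval (Fin.tail x)))).evalEval (x 0) (y x) = 0 := by
    intro x hx
    have := hy x hx
    rw [← Fin.cons_self_tail x, spec_eval] at this
    rw [Fin.cons_self_tail] at this
    exact this
  have hS1 : ((S.filter P1).card : ℝ) ≤ (2 * N + 1) ^ m * (C1 * (Real.sqrt N * Real.log T ^ 4)) := by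
    have h1 := fibre_count m (S.filter P1) (Fintype.piFinset (fun _ : Fin m => Finset.Icc (-(N : ℤ)) N))
      (fun x hx => (box_mem _ _ _).2 fun i => hbox x (Finset.mem_filter.1 hx).1 _)
      (C1 * (Real.sqrt N * Real.log T ^ 4)) (by
        intro x' hx' S0 hS0
        rw [box_mem] at hx'
        refine hcurve N T hN hT (F.map (mapRingHom (MvPolynomial.eval x'))) (hFm.map _)
          ?_ (hFx x') (hFv x' hx') S0 ?_
        · rw [hFm.natDegree_map, hFk]; omega
        · intro a ha
          have := hS0 a ha
          rw [Finset.mem_filter] at this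
          have h2 := hbox _ this.1 0
          have h3 := hroot _ this.1
          have h4 := this.2
          rw [hP1] at h4
          simp only [Fin.cons_zero, Fin.tail_cons] at h2 h3 h4
          exact ⟨h2, _, h3, h4⟩)
    rw [box_card] at h1
    push_cast at h1
    exact h1
  set Q := (S.filter (fun x => ¬ P1 x)).image (fun x => (Fin.tail x : Fin m → ℤ)) with hQ
  have hS2 : ((S.filter (fun x => ¬ P1 x)).card : ℝ) ≤ Q.card * (3 * N) := by
    refine fibre_count m _ Q (fun x hx => Finset.mem_image_of_mem _ hx) (3 * N) ?_
    intro x' _ S0 hS0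
    have h1 : S0 ⊆ Finset.Icc (-(N : ℤ)) N := by
      intro a ha
      have := hbox _ (Finset.mem_filter.1 (hS0 a ha)).1 0
      simp only [Fin.cons_zero] at this
      exact Finset.mem_Icc.2 (abs_le.1 this)
    have h2 := Finset.card_le_card h1
    rw [Int.card_Icc] at h2
    have h3 : S0.card ≤ 3 * N := by omega
    exact_mod_cast h3
  have hKT : N + 2 ≤ K * T := hT.trans (Nat.le_mul_of_pos_left _ hK1)
  have hQc := hCB k2 N (K * T) hN hKT c (fun v => hFc _ _) hcv Q (by
    intro x' hx'
    rw [hQ, Finset.mem_image] at hx'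
    obtain ⟨x, hx, rfl⟩ := hx'
    rw [Finset.mem_filter] at hx
    obtain ⟨hxS, hxP⟩ := hx
    refine ⟨fun i => hbox x hxS _, ?_⟩
    rw [hP1] at hxP
    push Not at hxP
    obtain ⟨r0, hr0, hr0y⟩ := hxP
    set G := F.map (mapRingHom (MvPolynomial.eval (Fin.tail x : Fin m → ℤ))) with hG
    have hGm : G.Monic := hFm.map _
    have hGk : G.natDegree = 1 + k2 := by rw [hG, hFm.natDegree_map, hFk]
    obtain ⟨g, hg⟩ := dvd_iff_isRoot.2 hr0
    have hgm : g.Monic := (monic_X_sub_C r0).of_mul_monic_left (hg ▸ hGm)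
    have hgk : g.natDegree = k2 := by
      rw [hg, (monic_X_sub_C r0).natDegree_mul hgm, natDegree_X_sub_C] at hGk
      omega
    obtain ⟨h, ha, hb, hh⟩ := factor_MP 1 k2 D G (X - C r0) g (monic_X_sub_C r0) hgm hg.symm
      (natDegree_X_sub_C _) hgk (hFx _)
    refine ⟨h, ?_, ?_⟩
    · rw [hh]
      funext v
      rw [hG, coeff_map, coe_mapRingHom, coeff_map]
    · intro r hr hrh
      have e1 := prodCoeff_spec 1 k2 D r
      rw [hr, ← hFMP] at e1
      set A := MP 1 (D + 1) (fun u => r (Sum.inl u)) with hA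
      have hA1 : A = X + C (A.coeff 0) := (MP_monic _ _ _).eq_X_add_C (MP_natDegree _ _ _)
      set q := - A.coeff 0 with hq
      have hA2 : A = X - C q := by rw [hA1, hq]; simp
      have hFq : F.eval q = 0 := by
        rw [e1, eval_mul, hA2]; simp
      have hqr : q.map (MvPolynomial.eval (Fin.tail x : Fin m → ℤ)) = r0 := by
        have h5 := MP_map (MvPolynomial.eval (Fin.tail x : Fin m → ℤ)) 1 (D + 1) (fun u => r (Sum.inl u))
        have h6 : (fun v => MvPolynomial.eval (Fin.tail x : Fin m → ℤ) (r (Sum.inl v))) = fun u => h (Sum.inl u) := by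
          funext u
          exact congrFun hrh (Sum.inl u)
        rw [h6, ← ha, ← hA, hA2] at h5
        simpa using h5
      refine hne x hxS ((MvPolynomial.finSuccEquiv ℤ m).symm q) ?_ ?_
      · apply (MvPolynomial.finSuccEquiv ℤ m).injective
        rw [map_zero, ← hFq, hF, eval_map]
        have := Polynomial.hom_eval₂ f (RingHom.id _) ι ((MvPolynomial.finSuccEquiv ℤ m).symm q)
        rw [RingHom.comp_id] at this
        have e2 : ι ((MvPolynomial.finSuccEquiv ℤ m).symm q) = q := AlgEquiv.apply_symm_apply _ _
        rw [e2] at this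
        exact this
      · rw [← hr0y, ← hqr]
        conv_lhs => rw [← Fin.cons_self_tail x]
        rw [MvPolynomial.eval_eq_eval_mv_eval', AlgEquiv.apply_symm_apply])
  have hk2D : k2 ≤ D := by omega
  have hlogKT : Real.log ((K * T : ℕ) : ℝ) ≤ (1 + Real.log K) * Real.log T := by
    push_cast
    rw [Real.log_mul (by positivity) (by have : 0 < T := by omega
                                         positivity)]
    nlinarith
  have hlogKT0 : 0 ≤ Real.log ((K * T : ℕ) : ℝ) := Real.log_natCast_nonneg _
  have hQc2 : (Q.card : ℝ) * Real.sqrt N ≤ CC * (1 + Real.log K) ^ 4 * ((N : ℝ) ^ m * Real.log T ^ 4) := by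
    calc _ ≤ _ := hQc
      _ ≤ CC * ((N : ℝ) ^ m * ((1 + Real.log K) * Real.log T) ^ 4) := by
          have := hCCk k2 hk2D
          gcongr
      _ = _ := by ring
  have hsplit : (S.card : ℝ) = (S.filter P1).card + (S.filter (fun x => ¬ P1 x)).card := by
    exact_mod_cast (Finset.card_filter_add_card_filter_not P1).symm
  have hss : Real.sqrt N * Real.sqrt N = N := Real.mul_self_sqrt (by positivity)
  have hbc := box_card_le m N hN
  push_cast at hbc
  have A1 : ((S.filter P1).card : ℝ) * Real.sqrt N ≤ 3 ^ m * C1 * ((N : ℝ) ^ (m + 1) * Real.log T ^ 4) := by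
    calc _ ≤ (2 * N + 1) ^ m * (C1 * (Real.sqrt N * Real.log T ^ 4)) * Real.sqrt N := by gcongr
      _ = (2 * N + 1) ^ m * (C1 * (N * Real.log T ^ 4)) := by
          linear_combination (2 * (N : ℝ) + 1) ^ m * C1 * Real.log T ^ 4 * hss
      _ ≤ 3 ^ m * (N : ℝ) ^ m * (C1 * (N * Real.log T ^ 4)) := by gcongr
      _ = _ := by ring
  have A2 : ((S.filter (fun x => ¬ P1 x)).card : ℝ) * Real.sqrt N ≤
      3 * CC * (1 + Real.log K) ^ 4 * ((N : ℝ) ^ (m + 1) * Real.log T ^ 4) := by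
    calc _ ≤ Q.card * (3 * N) * Real.sqrt N := by gcongr
      _ = (Q.card * Real.sqrt N) * (3 * N) := by ring
      _ ≤ CC * (1 + Real.log K) ^ 4 * ((N : ℝ) ^ m * Real.log T ^ 4) * (3 * N) := by gcongr
      _ = _ := by ring
  rw [hsplit, add_mul, add_mul, add_mul]
  have A3 : 0 ≤ (3 * ((D : ℝ) + 1)) ^ (m + 1) * (D + 1) * ((N : ℝ) ^ (m + 1) * Real.log T ^ 4) := by positivity
  linarith

theorem TP_all (m : ℕ) : TP m := by
  induction m with
  | zero => exact TP_zero
  | succ m ih => exact TP_succ m ih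

end

section
lemma evalEval_mapmap {R S : Type*} [CommRing R] [CommRing S] (φ : R →+* S) (f : R[X][X]) (x y : R) :
    (f.map (mapRingHom φ)).evalEval (φ x) (φ y) = φ (f.evalEval x y) := by
  have : (evalEvalRingHom (φ x) (φ y)).comp (mapRingHom (mapRingHom φ)) = φ.comp (evalEvalRingHom x y) := by
    apply Polynomial.ringHom_ext
    · intro a
      induction a using Polynomial.induction_on' with
      | add p q hp hq => simp_all
      | monomial n a => simp [evalEval]
    · simp [evalEval]
  exact RingHom.congr_fun this f

lemma double_root (f : ℤ[X][X]) (hf : f.Monic)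
    (hirr : Irreducible (f.map (mapRingHom (Int.castRingHom ℚ))))
    (a b : (AlgebraicClosure ℚ)[X][X]) (ha : a.Monic) (hb : b.Monic)
    (hab : a * b = f.map (mapRingHom (Int.castRingHom (AlgebraicClosure ℚ))))
    (ha0 : 0 < a.natDegree) (hb0 : 0 < b.natDegree) (x y : ℤ) (hxy : f.evalEval x y = 0) :
    f.derivative.evalEval x y = 0 := by
  classical
  set ι := Int.castRingHom (AlgebraicClosure ℚ) with hι
  set p := f.map (mapRingHom ι) with hp
  have hpm : p.Monic := hf.map _
  set ε := evalEvalRingHom (ι x) (ι y) with hε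
  have hε0 : ε p = 0 := by
    rw [hε, coe_evalEvalRingHom, hp, evalEval_mapmap, hxy, map_zero]
  have hex : ∃ n, ∃ h : (AlgebraicClosure ℚ)[X][X], h.Monic ∧ h ∣ p ∧ ε h = 0 ∧ h.natDegree = n :=
    ⟨_, p, hpm, dvd_rfl, hε0, rfl⟩
  obtain ⟨h, hm, hdvd, hεh, hn⟩ := Nat.find_spec hex
  have hmin : ∀ g : (AlgebraicClosure ℚ)[X][X], g.Monic → g ∣ p → ε g = 0 → h.natDegree ≤ g.natDegree := by
    intro g h1 h2 h3
    rw [hn]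
    exact Nat.find_min' hex ⟨g, h1, h2, h3, rfl⟩
  have hlt : h.natDegree < p.natDegree := by
    have e : ε a * ε b = 0 := by rw [← map_mul, hab, hε0]
    have hk : p.natDegree = a.natDegree + b.natDegree := by rw [← hab, ha.natDegree_mul hb]
    rcases mul_eq_zero.1 e with e | e
    · have := hmin a ha ⟨b, hab.symm⟩ e; omega
    · have := hmin b hb ⟨a, by rw [mul_comm]; exact hab.symm⟩ e; omega
  have hh1 : h ≠ 1 := by rintro rfl; simp at hεh
  have hpos : 0 < h.natDegree := by
    rcases Nat.eq_zero_or_pos h.natDegree with h0 | h0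
    · exact absurd (hm.natDegree_eq_zero.1 h0) hh1
    · exact h0
  have hirrh : Irreducible h := by
    rw [hm.irreducible_iff_natDegree]
    refine ⟨hh1, fun u v hu hv huv => ?_⟩
    have e : ε u * ε v = 0 := by rw [← map_mul, huv, hεh]
    have hk : h.natDegree = u.natDegree + v.natDegree := by rw [← huv, hu.natDegree_mul hv]
    rcases mul_eq_zero.1 e with e | e
    · have := hmin u hu (dvd_trans ⟨v, huv.symm⟩ hdvd) e; omega
    · have := hmin v hv (dvd_trans ⟨u, by rw [mul_comm]; exact huv.symm⟩ hdvd) e; omega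
  -- not defined over ℚ
  have hσ : ∃ σ : (AlgebraicClosure ℚ) ≃ₐ[ℚ] (AlgebraicClosure ℚ),
      h.map (mapRingHom (σ : (AlgebraicClosure ℚ) →+* (AlgebraicClosure ℚ))) ≠ h := by
    by_contra hcon
    push Not at hcon
    have : Algebra.IsAlgebraic ℚ (AlgebraicClosure ℚ) := AlgebraicClosure.isAlgebraic ℚ
    have : IsAlgClosure ℚ (AlgebraicClosure ℚ) := ⟨inferInstance, inferInstance⟩
    have : Normal ℚ (AlgebraicClosure ℚ) := IsAlgClosure.normal _ _
    have : IsGalois ℚ (AlgebraicClosure ℚ) := IsGalois.mk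
    have hrat : ∀ j i, ∃ q : ℚ, algebraMap ℚ (AlgebraicClosure ℚ) q = (h.coeff j).coeff i := by
      intro j i
      have := (InfiniteGalois.mem_range_algebraMap_iff_fixed (k := ℚ) ((h.coeff j).coeff i)).2 (by
        intro σ
        have h1 := congrArg (fun g => (g.coeff j).coeff i) (hcon σ)
        simpa using h1)
      exact this
    have hlift : h ∈ lifts (mapRingHom (algebraMap ℚ (AlgebraicClosure ℚ))) := by
      rw [lifts_iff_coeff_lifts]
      intro j
      have : h.coeff j ∈ lifts (algebraMap ℚ (AlgebraicClosure ℚ)) := by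
        rw [lifts_iff_coeff_lifts]
        intro i
        obtain ⟨q, hq⟩ := hrat j i
        exact ⟨q, hq⟩
      obtain ⟨q, hq⟩ := (mem_lifts _).1 this
      exact ⟨q, hq⟩
    obtain ⟨h0, hh0, hd0, hm0⟩ := lifts_and_natDegree_eq_and_monic hlift hm
    have hinj : Function.Injective (mapRingHom (algebraMap ℚ (AlgebraicClosure ℚ))) :=
      map_injective _ (algebraMap ℚ (AlgebraicClosure ℚ)).injective
    have hpQ : p = (f.map (mapRingHom (Int.castRingHom ℚ))).map (mapRingHom (algebraMap ℚ (AlgebraicClosure ℚ))) := by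
      rw [hp, Polynomial.map_map, mapRingHom_comp]
      congr 2
    rw [← hh0, hpQ, map_dvd_map _ hinj hm0] at hdvd
    obtain ⟨g, hg⟩ := hdvd
    have hfm : (f.map (mapRingHom (Int.castRingHom ℚ))).Monic := hf.map _
    have hgm : g.Monic := hm0.of_mul_monic_left (hg ▸ hfm)
    have hk : p.natDegree = h0.natDegree + g.natDegree := by
      rw [hpQ, hfm.natDegree_map, hg, hm0.natDegree_mul hgm]
    rcases ((hfm.irreducible_iff_natDegree).1 hirr).2 h0 g hm0 hgm hg.symm with e | e
    · omega
    · omega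
  obtain ⟨σ, hσ⟩ := hσ
  set h' := h.map (mapRingHom (σ : (AlgebraicClosure ℚ) →+* (AlgebraicClosure ℚ))) with hh'
  have hm' : h'.Monic := hm.map _
  have hp' : p.map (mapRingHom (σ : (AlgebraicClosure ℚ) →+* (AlgebraicClosure ℚ))) = p := by
    rw [hp, Polynomial.map_map, mapRingHom_comp]
    congr 2
    exact RingHom.ext_int _ _
  have hdvd' : h' ∣ p := by
    rw [← hp']
    exact Polynomial.map_dvd _ hdvd
  have hεh' : ε h' = 0 := by
    have := evalEval_mapmap (σ : (AlgebraicClosure ℚ) →+* (AlgebraicClosure ℚ)) h (ι x) (ι y)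
    have e1 : ∀ z : ℤ, (σ : (AlgebraicClosure ℚ) →+* (AlgebraicClosure ℚ)) (ι z) = ι z := by
      intro z; simp [hι]
    rw [e1, e1] at this
    change evalEval _ _ _ = 0
    rw [hh', this]
    change _ = 0 at hεh
    change evalEval _ _ _ = 0 at hεh
    rw [hεh, map_zero]
  have hprime : Prime h := hirrh.prime
  obtain ⟨g, hg⟩ := hdvd'
  have hnd : ¬ h ∣ h' := by
    intro hd
    apply hσ
    refine eq_of_monic_of_dvd_of_natDegree_le hm hm' hd ?_
    rw [hh', hm.natDegree_map]
  rw [hg] at hdvd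
  have hgd := (hprime.dvd_or_dvd hdvd).resolve_left hnd
  obtain ⟨g2, hg2⟩ := hgd
  have hder : ε (derivative p) = 0 := by
    rw [hg, hg2]
    simp only [derivative_mul, map_add, map_mul, hεh, hεh']
    ring
  rw [hp, derivative_map] at hder
  change evalEval _ _ _ = 0 at hder
  rw [evalEval_mapmap] at hder
  exact (injective_iff_map_eq_zero ι).1 (RingHom.injective_int ι) _ hder

lemma det_natDegree_le {R : Type*} [CommRing R] (n D : ℕ) (M : Matrix (Fin n) (Fin n) R[X])
    (hM : ∀ i j, (M i j).natDegree ≤ D) : M.det.natDegree ≤ n * D := by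
  rw [Matrix.det_apply]
  refine natDegree_sum_le_of_forall_le _ _ fun σ _ => ?_
  refine (natDegree_smul_le _ _).trans ?_
  refine (natDegree_prod_le _ _).trans ?_
  refine (Finset.sum_le_card_nsmul _ _ D fun i _ => hM _ _).trans ?_
  simp

lemma fibre_bound (D : ℕ) (f : ℤ[X][X]) (hf : f.Monic) (hfD : f.natDegree ≤ D)
    (hfX : ∀ j, (f.coeff j).natDegree ≤ D)
    (hirr : Irreducible (f.map (mapRingHom (Int.castRingHom ℚ))))
    (a b : (AlgebraicClosure ℚ)[X][X]) (ha : a.Monic) (hb : b.Monic)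
    (hab : a * b = f.map (mapRingHom (Int.castRingHom (AlgebraicClosure ℚ))))
    (ha0 : 0 < a.natDegree) (hb0 : 0 < b.natDegree)
    (S : Finset ℤ) (hS : ∀ x ∈ S, ∃ y : ℤ, f.evalEval x y = 0) : S.card ≤ (D + D) * D := by
  classical
  set k := f.natDegree with hk
  set δ : ℤ[X] := resultant f f.derivative k (k - 1) with hδ
  have hkpos : k ≠ 0 := by
    intro h0
    rw [hf.natDegree_eq_zero.1 h0, Polynomial.map_one] at hirr
    exact not_irreducible_one hirr
  have hfm : (f.map (mapRingHom (Int.castRingHom ℚ))).Monic := hf.map _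
  have hδ0 : δ ≠ 0 := by
    have h1 := (hfm.irreducible_iff_irreducible_map_fraction_map (K := FractionRing ℚ[X])).1 hirr
    set φ := (algebraMap ℚ[X] (FractionRing ℚ[X])).comp (mapRingHom (Int.castRingHom ℚ)) with hφ
    rw [Polynomial.map_map, ← hφ] at h1
    have h2 : IsCoprime (f.map φ) (derivative (f.map φ)) := h1.separable
    have h3 : resultant (f.map φ) (derivative (f.map φ)) ≠ 0 := resultant_ne_zero _ _ h2
    intro h0
    apply h3
    have e1 : (f.map φ).natDegree = k := hf.natDegree_map _
    have e2 : (derivative (f.map φ)).natDegree = k - 1 := by rw [natDegree_derivative, e1]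
    rw [e1, e2, derivative_map, resultant_map_map, ← hδ, h0, map_zero]
  have hδd : δ.natDegree ≤ (D + D) * D := by
    have : δ.natDegree ≤ (k + (k - 1)) * D := by
      refine det_natDegree_le _ D _ ?_
      intro i j
      rw [sylvester, Matrix.of_apply]
      induction j using Fin.addCases with
      | left j =>
        rw [Fin.addCases_left]
        split_ifs
        · rw [coeff_derivative]
          refine natDegree_mul_le.trans ?_
          have h1 := hfX (i - j + 1)
          have h2 : (((i - j : ℕ) : ℤ[X]) + 1).natDegree = 0 := by
            have := natDegree_natCast (R := ℤ) (i - j + 1)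
            push_cast at this
            exact this
          rw [h2]; simpa using h1
        · simp
      | right j =>
        rw [Fin.addCases_right]
        split_ifs
        · exact hfX _
        · simp
    exact this.trans (Nat.mul_le_mul_right _ (by omega))
  have hroot : ∀ x ∈ S, δ.eval x = 0 := by
    intro x hx
    obtain ⟨y, hy⟩ := hS x hx
    have hy' := double_root f hf hirr a b ha hb hab ha0 hb0 x y hy
    obtain ⟨p, q, -, -, hpq⟩ := exists_mul_add_mul_eq_C_resultant f f.derivative (m := k) (n := k - 1)
      le_rfl (natDegree_derivative_le _) (Or.inl hkpos)
    rw [← hδ] at hpq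
    have h1 := congrArg (evalEvalRingHom x y) hpq
    rw [map_add, map_mul, map_mul, coe_evalEvalRingHom, hy, hy'] at h1
    simpa [evalEval] using h1.symm
  have : S ⊆ δ.roots.toFinset := by
    intro x hx
    rw [Multiset.mem_toFinset, mem_roots hδ0]
    exact hroot x hx
  exact (Finset.card_le_card this).trans ((Multiset.toFinset_card_le _).trans ((card_roots' _).trans hδd))

/-- a monic factorization over `ℚ` is integral -/
lemma int_factor (k1 k2 D : ℕ) (f : ℤ[X][X]) (hfX : ∀ j, (f.coeff j).natDegree ≤ D) (a b : ℚ[X][X])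
    (ha : a.Monic) (hb : b.Monic) (hab : a * b = f.map (mapRingHom (Int.castRingHom ℚ)))
    (h1 : a.natDegree = k1) (h2 : b.natDegree = k2) :
    ∃ h : FIdx k1 k2 D → ℤ, prodCoeff k1 k2 D h = (fun v => (f.coeff v.1).coeff v.2) ∧
      a = MP k1 (D + 1) (fun u => ((h (Sum.inl u) : ℤ) : ℚ)) := by
  obtain ⟨h, e1, e2, e3⟩ := factor_MP k1 k2 D _ a b ha hb hab h1 h2 (by
    intro j; rw [coeff_map]; exact natDegree_map_le.trans (hfX j))
  have hintg : ∀ u, ∃ z : ℤ, (z : ℚ) = h u := by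
    intro u
    obtain ⟨χ, hχm, hχ⟩ := exists_chi k1 k2 D u
    have := hχ ℚ h _ rfl
    have hI : IsIntegral ℤ (h u) := by
      refine ⟨χ.map (MvPolynomial.eval₂Hom (Int.castRingHom ℤ) (fun v : PIdx k1 k2 D => (f.coeff v.1).coeff v.2)), hχm.map _, ?_⟩
      rw [← eval_map, Polynomial.map_map]
      have e4 : (algebraMap ℤ ℚ).comp (MvPolynomial.eval₂Hom (Int.castRingHom ℤ) (fun v : PIdx k1 k2 D => (f.coeff v.1).coeff v.2))
          = MvPolynomial.eval₂Hom (Int.castRingHom ℚ) (prodCoeff k1 k2 D h) := by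
        rw [e3]
        apply MvPolynomial.ringHom_ext <;> simp
      rw [e4]
      exact this
    obtain ⟨z, hz⟩ := IsIntegrallyClosed.isIntegral_iff.1 hI
    exact ⟨z, by simpa using hz⟩
  choose z hz using hintg
  refine ⟨z, ?_, ?_⟩
  · funext v
    have h4 := prodCoeff_map k1 k2 D (Int.castRingHom ℚ) z v
    have h5 : (fun u => (Int.castRingHom ℚ) (z u)) = h := by funext u; simpa using hz u
    rw [h5, e3] at h4
    simp only [coeff_map, coe_mapRingHom] at h4
    exact (Int.castRingHom ℚ).injective_int h4
  · rw [e1]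
    congr 1
    funext u
    exact (hz _).symm

end

section
/-- single out the variable `i` -/
noncomputable def ei {m : ℕ} (R : Type*) [CommRing R] (i : Fin (m + 1)) :
    MvPolynomial (Fin (m + 1)) R ≃ₐ[R] (MvPolynomial (Fin m) R)[X] :=
  (MvPolynomial.renameEquiv R i.cycleRange).trans (MvPolynomial.finSuccEquiv R m)

lemma ei_X_self {m : ℕ} (R : Type*) [CommRing R] (i : Fin (m + 1)) :
    ei R i (MvPolynomial.X i) = X := by
  simp [ei, MvPolynomial.finSuccEquiv_X_zero]

lemma ei_X_succAbove {m : ℕ} (R : Type*) [CommRing R] (i : Fin (m + 1)) (j : Fin m) :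
    ei R i (MvPolynomial.X (i.succAbove j)) = C (MvPolynomial.X j) := by
  simp [ei, MvPolynomial.finSuccEquiv_X_succ]

lemma ei_C {m : ℕ} (R : Type*) [CommRing R] (i : Fin (m + 1)) (r : R) :
    ei R i (MvPolynomial.C r) = C (MvPolynomial.C r) := by
  have := (ei R i).commutes r
  simpa using this

lemma ei_rename {m : ℕ} (R : Type*) [CommRing R] (i : Fin (m + 1)) (p : MvPolynomial (Fin m) R) :
    ei R i (MvPolynomial.rename i.succAbove p) = C p := by
  have : ((ei R i : MvPolynomial (Fin (m + 1)) R →+* (MvPolynomial (Fin m) R)[X])).comp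
      ((MvPolynomial.rename i.succAbove : MvPolynomial (Fin m) R →ₐ[R] _) : MvPolynomial (Fin m) R →+* MvPolynomial (Fin (m + 1)) R) = C := by
    apply MvPolynomial.ringHom_ext
    · intro r; simp [ei_C]
    · intro j; simp [ei_X_succAbove]
  exact RingHom.congr_fun this p

/-- extensionality for maps out of the polynomial ring, singling out `i` -/
lemma ei_hom_ext {m : ℕ} {R S : Type*} [CommRing R] [CommRing S] (i : Fin (m + 1))
    {f g : MvPolynomial (Fin (m + 1)) R →+* S} (hC : ∀ r, f (MvPolynomial.C r) = g (MvPolynomial.C r))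
    (hi : f (MvPolynomial.X i) = g (MvPolynomial.X i))
    (hs : ∀ j, f (MvPolynomial.X (i.succAbove j)) = g (MvPolynomial.X (i.succAbove j))) : f = g := by
  apply MvPolynomial.ringHom_ext hC
  intro k
  rcases Fin.eq_self_or_eq_succAbove i k with rfl | ⟨j, rfl⟩
  · exact hi
  · exact hs j

lemma ei_map {m : ℕ} {R S : Type*} [CommRing R] [CommRing S] (φ : R →+* S) (i : Fin (m + 1))
    (p : MvPolynomial (Fin (m + 1)) R) :
    ei S i (MvPolynomial.map φ p) = (ei R i p).map (MvPolynomial.map φ) := by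
  have : ((ei S i : MvPolynomial (Fin (m + 1)) S →+* (MvPolynomial (Fin m) S)[X])).comp (MvPolynomial.map φ)
     = (mapRingHom (MvPolynomial.map φ)).comp (ei R i : MvPolynomial (Fin (m + 1)) R →+* (MvPolynomial (Fin m) R)[X]) := by
    apply ei_hom_ext i
    · intro r; simp [ei_C]
    · simp [ei_X_self]
    · intro j; simp [ei_X_succAbove]
  exact RingHom.congr_fun this p

lemma ei_eval {m : ℕ} {R : Type*} [CommRing R] (i : Fin (m + 1)) (x0 : R) (x' : Fin m → R)
    (p : MvPolynomial (Fin (m + 1)) R) :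
    MvPolynomial.eval (i.insertNth x0 x' : Fin (m + 1) → R) p = ((ei R i p).map (MvPolynomial.eval x')).eval x0 := by
  have : (MvPolynomial.eval (i.insertNth x0 x' : Fin (m + 1) → R))
     = ((evalRingHom x0).comp (mapRingHom (MvPolynomial.eval x'))).comp (ei R i : MvPolynomial (Fin (m + 1)) R →+* (MvPolynomial (Fin m) R)[X]) := by
    apply ei_hom_ext i
    · intro r; simp [ei_C]
    · simp [ei_X_self]
    · intro j; simp [ei_X_succAbove]
  exact RingHom.congr_fun this p

lemma ei_natDegree {m : ℕ} {R : Type*} [CommRing R] (i : Fin (m + 1)) (p : MvPolynomial (Fin (m + 1)) R) :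
    (ei R i p).natDegree ≤ p.totalDegree := by
  rw [ei, AlgEquiv.trans_apply, MvPolynomial.natDegree_finSuccEquiv]
  refine (MvPolynomial.degreeOf_le_totalDegree _ _).trans ?_
  rw [MvPolynomial.renameEquiv_apply]
  exact MvPolynomial.totalDegree_rename_le _ _

lemma ei_coeff_totalDegree {m : ℕ} {R : Type*} [CommRing R] (i : Fin (m + 1)) (p : MvPolynomial (Fin (m + 1)) R) (j : ℕ) :
    ((ei R i p).coeff j).totalDegree ≤ p.totalDegree := by
  by_cases h : (ei R i p).coeff j = 0
  · rw [h]; simp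
  rw [ei, AlgEquiv.trans_apply, MvPolynomial.renameEquiv_apply] at h ⊢
  have := MvPolynomial.totalDegree_coeff_finSuccEquiv_add_le _ j h
  have h2 := MvPolynomial.totalDegree_rename_le i.cycleRange p
  omega

lemma exists_rename {m : ℕ} {R : Type*} [CommRing R] (i : Fin (m + 1)) (p : MvPolynomial (Fin (m + 1)) R)
    (h : p.degreeOf i = 0) : ∃ q, MvPolynomial.rename i.succAbove q = p := by
  have h1 : (ei R i p).natDegree = 0 := by
    rw [ei, AlgEquiv.trans_apply, MvPolynomial.natDegree_finSuccEquiv, MvPolynomial.renameEquiv_apply]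
    have := MvPolynomial.degreeOf_rename_of_injective (p := p) (i.cycleRange).injective i
    rw [Fin.cycleRange_self] at this
    rw [this, h]
  rw [natDegree_eq_zero] at h1
  obtain ⟨q, hq⟩ := h1
  refine ⟨q, ?_⟩
  apply (ei R i).injective
  rw [ei_rename, hq]

lemma degreeOf_rename_succAbove {m : ℕ} {R : Type*} [CommRing R] (i : Fin (m + 1)) (q : MvPolynomial (Fin m) R) :
    (MvPolynomial.rename i.succAbove q).degreeOf i = 0 := by
  have h1 : (ei R i (MvPolynomial.rename i.succAbove q)).natDegree = 0 := by
    rw [ei_rename, natDegree_C]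
  rw [ei, AlgEquiv.trans_apply, MvPolynomial.natDegree_finSuccEquiv, MvPolynomial.renameEquiv_apply] at h1
  have := MvPolynomial.degreeOf_rename_of_injective (p := MvPolynomial.rename i.succAbove q) (i.cycleRange).injective i
  rw [Fin.cycleRange_self] at this
  rw [← this, h1]

section fields
variable {m : ℕ} (i : Fin (m + 1))
variable (K' : Type) [Field K'] [Algebra (MvPolynomial (Fin m) ℚ) K'] [IsFractionRing (MvPolynomial (Fin m) ℚ) K']
variable (Kn : Type) [Field Kn] [Algebra (MvPolynomial (Fin (m + 1)) ℚ) Kn]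
  [IsFractionRing (MvPolynomial (Fin (m + 1)) ℚ) Kn]
variable (L : Type) [Field L] [Algebra K' L]
variable (Λ : Type) [Field Λ] [Algebra L[X] Λ] [IsFractionRing L[X] Λ]

/-- `ℚ[X] → K'[X_i]` -/
noncomputable def tauK : MvPolynomial (Fin (m + 1)) ℚ →+* K'[X] :=
  (mapRingHom (algebraMap (MvPolynomial (Fin m) ℚ) K')).comp
    (ei ℚ i : MvPolynomial (Fin (m + 1)) ℚ →+* (MvPolynomial (Fin m) ℚ)[X])

/-- `ℚ[X] → L[X_i]` -/
noncomputable def tau : MvPolynomial (Fin (m + 1)) ℚ →+* L[X] :=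
  (mapRingHom (algebraMap K' L)).comp (tauK i K')

lemma tau_injective : Function.Injective (tau i K' L) := by
  have h1 : Function.Injective (mapRingHom (algebraMap K' L)) :=
    map_injective _ (algebraMap K' L).injective
  have h2 : Function.Injective (mapRingHom (algebraMap (MvPolynomial (Fin m) ℚ) K')) :=
    map_injective _ (IsFractionRing.injective (MvPolynomial (Fin m) ℚ) K')
  intro a b hab
  exact (ei ℚ i).injective (h2 (h1 hab))

lemma jpre_injective : Function.Injective ((algebraMap L[X] Λ).comp (tau i K' L)) := by
  intro a b hab
  exact tau_injective i K' L (IsFractionRing.injective L[X] Λ hab)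

/-- `ℚ(X) → L(X_i)` -/
noncomputable def jj : Kn →+* Λ :=
  IsFractionRing.lift (jpre_injective i K' L Λ)

lemma jj_algebraMap (a : MvPolynomial (Fin (m + 1)) ℚ) :
    jj i K' Kn L Λ (algebraMap _ _ a) = algebraMap L[X] Λ (tau i K' L a) := by
  rw [jj, IsFractionRing.lift_algebraMap]; rfl

/-- renaming as a ring homomorphism -/
noncomputable def ren : MvPolynomial (Fin m) ℚ →+* MvPolynomial (Fin (m + 1)) ℚ :=
  (MvPolynomial.rename i.succAbove : MvPolynomial (Fin m) ℚ →ₐ[ℚ] MvPolynomial (Fin (m + 1)) ℚ).toRingHom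

lemma ren_injective : Function.Injective (ren i) :=
  MvPolynomial.rename_injective _ Fin.succAbove_right_injective

lemma rren_injective :
    Function.Injective ((algebraMap (MvPolynomial (Fin (m + 1)) ℚ) Kn).comp (ren i)) := by
  intro a b hab
  exact ren_injective i (IsFractionRing.injective (MvPolynomial (Fin (m + 1)) ℚ) Kn hab)

/-- inclusion of `ℚ(X_j, j ≠ i)` in `ℚ(X)` -/
noncomputable def uu : K' →+* Kn :=
  IsFractionRing.lift (rren_injective i Kn)

lemma uu_algebraMap (a : MvPolynomial (Fin m) ℚ) :
    uu i K' Kn (algebraMap _ _ a) = algebraMap _ _ (MvPolynomial.rename i.succAbove a) := by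
  rw [uu, IsFractionRing.lift_algebraMap]; rfl

lemma jj_uu (a : K') :
    jj i K' Kn L Λ (uu i K' Kn a) = algebraMap L[X] Λ (C (algebraMap K' L a)) := by
  have : (jj i K' Kn L Λ).comp (uu i K' Kn) = ((algebraMap L[X] Λ).comp C).comp (algebraMap K' L) := by
    apply IsLocalization.ringHom_ext (nonZeroDivisors (MvPolynomial (Fin m) ℚ))
    apply MvPolynomial.ringHom_ext
    · intro p; simp [uu_algebraMap, jj_algebraMap, tau, tauK, ei_C]
    · intro p; simp [uu_algebraMap, jj_algebraMap, tau, tauK, ei_X_succAbove]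
  exact RingHom.congr_fun this a

end fields

end

section
lemma exists_gamma {k : Type} [Field k] (F G : k[X]) (M : Type) [Field M] [Algebra k M]
    (e : AdjoinRoot F ≃ₐ[k] M) (M' : IntermediateField k M) (hM' : M' ≠ ⊥)
    (e' : AdjoinRoot G ≃ₐ[k] M') :
    ∃ γ : AdjoinRoot F, aeval γ G = 0 ∧ ∀ r : k, γ ≠ algebraMap k _ r := by
  set γ0 : M := (e' (AdjoinRoot.root G) : M) with hγ0
  have h0 : aeval γ0 G = 0 := by
    have h1 : aeval (AdjoinRoot.root G) G = 0 := by rw [AdjoinRoot.aeval_eq, AdjoinRoot.mk_self]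
    have h2 : γ0 = (M'.val.comp e'.toAlgHom) (AdjoinRoot.root G) := rfl
    rw [h2, aeval_algHom_apply, h1, map_zero]
  refine ⟨e.symm γ0, ?_, ?_⟩
  · have : e.symm γ0 = e.symm.toAlgHom γ0 := rfl
    rw [this, aeval_algHom_apply, h0, map_zero]
  · intro r hr
    have hr' : γ0 = algebraMap k M r := by
      rw [← e.commutes, ← hr, e.apply_symm_apply]
    apply hM'
    rw [eq_bot_iff]
    intro x hx
    obtain ⟨p, hp⟩ := AdjoinRoot.mk_surjective (e'.symm ⟨x, hx⟩)
    have h2 : x = aeval γ0 p := by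
      have h3 : (⟨x, hx⟩ : M') = e' (AdjoinRoot.mk G p) := by rw [hp, e'.apply_symm_apply]
      have h4 : x = (M'.val.comp e'.toAlgHom) (AdjoinRoot.mk G p) := congrArg Subtype.val h3
      rw [h4, ← AdjoinRoot.aeval_eq, ← aeval_algHom_apply]
      rfl
    rw [IntermediateField.mem_bot]
    refine ⟨p.eval r, ?_⟩
    rw [h2, hr', aeval_algebraMap_apply]
    simp

lemma map_degX_zero {m : ℕ} (i : Fin (m + 1)) (G : (MvPolynomial (Fin (m + 1)) ℤ)[X]) (h : degX G i = 0) :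
    ∃ G0 : (MvPolynomial (Fin m) ℤ)[X],
      G0.map ((MvPolynomial.rename i.succAbove : MvPolynomial (Fin m) ℤ →ₐ[ℤ] _).toRingHom) = G := by
  have : G ∈ lifts ((MvPolynomial.rename i.succAbove : MvPolynomial (Fin m) ℤ →ₐ[ℤ] MvPolynomial (Fin (m+1)) ℤ).toRingHom) := by
    rw [lifts_iff_coeff_lifts]
    intro k
    by_cases hk : k ∈ G.support
    · have h1 : (G.coeff k).degreeOf i ≤ degX G i :=
        Finset.le_sup (f := fun k => (G.coeff k).degreeOf i) hk
      obtain ⟨q, hq⟩ := exists_rename i (G.coeff k) (by omega)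
      exact ⟨q, hq⟩
    · rw [notMem_support_iff.1 hk]
      exact ⟨0, map_zero _⟩
  exact (mem_lifts _).1 this

section fields
variable {m : ℕ} (i : Fin (m + 1))
variable (K' : Type) [Field K'] [Algebra (MvPolynomial (Fin m) ℚ) K'] [IsFractionRing (MvPolynomial (Fin m) ℚ) K']
variable (Kn : Type) [Field Kn] [Algebra (MvPolynomial (Fin (m + 1)) ℚ) Kn]
  [IsFractionRing (MvPolynomial (Fin (m + 1)) ℚ) Kn]
variable (L : Type) [Field L] [Algebra K' L]

lemma map_jj (Λ : Type) [Field Λ] [Algebra L[X] Λ] [IsFractionRing L[X] Λ]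
    (F : (MvPolynomial (Fin (m + 1)) ℤ)[X]) :
    ((toQ F).map (algebraMap _ Kn)).map (jj i K' Kn L Λ) = ((toQ F).map (tau i K' L)).map (algebraMap L[X] Λ) := by
  rw [Polynomial.map_map, Polynomial.map_map]
  congr 1
  exact RingHom.ext fun a => jj_algebraMap i K' Kn L Λ a

lemma h3core [IsAlgClosed L] (R G : (MvPolynomial (Fin (m + 1)) ℤ)[X]) (hR : R.Monic)
    (hirr : Irreducible ((toQ R).map (tau i K' L)))
    (hG : (toQ G).map (algebraMap _ Kn) ≠ 0) (hGi : degX G i = 0)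
    (F : Kn[X]) (hF : F = (toQ R).map (algebraMap _ Kn)) (γ : AdjoinRoot F)
    (hγ : aeval γ ((toQ G).map (algebraMap _ Kn)) = 0) : ∃ r : Kn, γ = algebraMap Kn _ r := by
  let Λ := FractionRing L[X]
  set Gf := (toQ G).map (algebraMap _ Kn) with hGf
  have hRQ : (toQ R).Monic := hR.map _
  have hFm : F.Monic := by rw [hF]; exact hRQ.map _
  have hFL : ((toQ R).map (tau i K' L)).Monic := hRQ.map _
  have hirrΛ := (hFL.irreducible_iff_irreducible_map_fraction_map (K := Λ)).1 hirr
  rw [← map_jj i K' Kn L Λ, ← hF] at hirrΛ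
  have hF0 : 0 < F.natDegree := by
    have := hirrΛ.natDegree_pos
    rwa [hFm.natDegree_map] at this
  obtain ⟨Φ0, hΦ0⟩ := AdjoinRoot.mk_surjective γ
  set Φ := Φ0 %ₘ F with hΦ
  have hγΦ : γ = AdjoinRoot.mk F Φ := by
    rw [← hΦ0, AdjoinRoot.mk_eq_mk]
    have := modByMonic_add_div Φ0 F
    exact ⟨Φ0 /ₘ F, by rw [hΦ]; linear_combination -this⟩
  have hΦd : Φ.natDegree < F.natDegree :=
    natDegree_modByMonic_lt _ hFm (by rintro h; rw [h] at hF0; simp at hF0)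
  have hdvd : F ∣ Gf.comp Φ := by
    rw [← AdjoinRoot.mk_eq_zero, ← hγ, hγΦ]
    have : aeval (AdjoinRoot.mk F Φ) Gf = aeval (AdjoinRoot.mkₐ F Φ) Gf := rfl
    rw [this, aeval_algHom_apply]
    rfl
  obtain ⟨G0, hG0⟩ := map_degX_zero i G hGi
  -- the polynomial over L
  set g : L[X] := (G0.map (MvPolynomial.map (Int.castRingHom ℚ))).map ((algebraMap K' L).comp (algebraMap _ K')) with hg
  have hGg : (toQ G).map (tau i K' L) = g.map C := by
    rw [hg, toQ, ← hG0, Polynomial.map_map, Polynomial.map_map, Polynomial.map_map, Polynomial.map_map]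
    congr 1
    apply MvPolynomial.ringHom_ext
    · intro r; simp
    · intro j; simp [tau, tauK, ei_X_succAbove]
  have hGΛ : Gf.map (jj i K' Kn L Λ) = g.map ((algebraMap L[X] Λ).comp C) := by
    rw [hGf, map_jj, hGg, Polynomial.map_map]
  have hg0 : g ≠ 0 := by
    intro h0
    rw [h0, Polynomial.map_zero, Polynomial.map_eq_zero] at hGΛ
    exact hG hGΛ
  have hsplit := IsAlgClosed.splits g
  have hdvd2 : F.map (jj i K' Kn L Λ) ∣ (Gf.map (jj i K' Kn L Λ)).comp (Φ.map (jj i K' Kn L Λ)) := by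
    rw [← map_comp]
    exact Polynomial.map_dvd _ hdvd
  rw [hGΛ, hsplit.eq_prod_roots, Polynomial.map_mul, map_C, mul_comp, C_comp] at hdvd2
  have hu : IsUnit (C (((algebraMap L[X] Λ).comp C) g.leadingCoeff)) := by
    rw [isUnit_C, isUnit_iff_ne_zero, _root_.map_ne_zero]
    exact leadingCoeff_ne_zero.2 hg0
  rw [hu.dvd_mul_left, Polynomial.map_multiset_prod, multiset_prod_comp] at hdvd2
  have hprime : Prime (F.map (jj i K' Kn L Λ)) := hirrΛ.prime
  obtain ⟨w, hw, hdw⟩ := hprime.exists_mem_multiset_dvd hdvd2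
  simp only [Multiset.map_map, Multiset.mem_map, Function.comp] at hw
  obtain ⟨θ, -, rfl⟩ := hw
  simp only [Polynomial.map_sub, map_X, map_C, sub_comp, X_comp, C_comp] at hdw
  set t := ((algebraMap L[X] Λ).comp C) θ with ht
  have hz : Φ.map (jj i K' Kn L Λ) - C t = 0 := by
    apply eq_zero_of_dvd_of_natDegree_lt hdw
    rw [natDegree_sub_C, natDegree_map, natDegree_map]
    exact hΦd
  have h0 : Φ.natDegree = 0 := by
    rw [← natDegree_map (jj i K' Kn L Λ), sub_eq_zero.1 hz, natDegree_C]
  rw [natDegree_eq_zero] at h0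
  obtain ⟨r, hr⟩ := h0
  exact ⟨r, by rw [hγΦ, ← hr, AdjoinRoot.mk_C]; rfl⟩

end fields

end

section
lemma coeff_field_degree {K L : Type} [Field K] [Field L] [Algebra K L] [IsAlgClosed L]
    [Algebra.IsAlgebraic K L] [CharZero K] (f : K[X][X]) (hf : f.Monic) (q : L[X])
    (hq : (f.map (mapRingHom (algebraMap K L))).eval q = 0) :
    ∃ θ : L, (minpoly K θ).natDegree ≤ f.natDegree ∧ ∀ a, ∃ s : K[X], aeval θ s = q.coeff a := by
  classical
  set S : Set L := (q.coeffs : Set L) with hS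
  set κ := IntermediateField.adjoin K S with hκ
  have hfin : FiniteDimensional K κ := by
    have : Finite S := Finset.finite_toSet q.coeffs
    exact IntermediateField.finiteDimensional_adjoin fun x _ => Algebra.IsIntegral.isIntegral x
  have hmem : ∀ a, q.coeff a ∈ κ := by
    intro a
    by_cases h : q.coeff a = 0
    · rw [h]; exact zero_mem _
    · apply IntermediateField.subset_adjoin
      rw [hS]
      exact coeff_mem_coeffs h
  have hlift : q ∈ lifts (κ.val : κ →+* L) := by
    rw [lifts_iff_coeff_lifts]
    intro a
    exact ⟨⟨q.coeff a, hmem a⟩, rfl⟩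
  obtain ⟨q0, hq0⟩ := (mem_lifts _).1 hlift
  have hcomp : ∀ σ : κ →ₐ[K] L, mapRingHom (algebraMap K L) =
      (mapRingHom (σ : κ →+* L)).comp (mapRingHom (algebraMap K κ)) := by
    intro σ
    rw [mapRingHom_comp]
    congr 1
    ext x
    simp
  have hev : ∀ σ : κ →ₐ[K] L, (f.map (mapRingHom (algebraMap K L))).eval (q0.map (σ : κ →+* L))
      = ((f.map (mapRingHom (algebraMap K κ))).eval q0).map (σ : κ →+* L) := by
    intro σ
    rw [hcomp σ, ← Polynomial.map_map, ← coe_mapRingHom (σ : κ →+* L), eval_map_apply]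
  have h0 : (f.map (mapRingHom (algebraMap K κ))).eval q0 = 0 := by
    have := hev κ.val
    rw [hq0, hq] at this
    exact (Polynomial.map_eq_zero _).1 this.symm
  have hcard : Module.finrank K κ ≤ f.natDegree := by
    rw [← AlgHom.card K κ L]
    set FL := f.map (mapRingHom (algebraMap K L)) with hFL
    have hm : FL.Monic := hf.map _
    have : Fintype.card (κ →ₐ[K] L) ≤ FL.roots.toFinset.card := by
      rw [← Finset.card_univ]
      apply Finset.card_le_card_of_injOn (fun σ : κ →ₐ[K] L => q0.map (σ : κ →+* L))
      · intro σ _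
        simp only [Finset.mem_coe, Multiset.mem_toFinset]
        rw [mem_roots hm.ne_zero, IsRoot.def, hev, h0, Polynomial.map_zero]
      · intro σ _ σ' _ h
        apply IntermediateField.algHom_ext_of_eq_adjoin K hκ
        intro x hx
        have hxκ : x ∈ κ := IntermediateField.subset_adjoin K S hx
        rw [hS] at hx
        obtain ⟨a, -, ha⟩ := mem_coeffs_iff.1 (Finset.mem_coe.1 hx)
        have h1 := congrArg (fun p => coeff p a) h
        simp only [coeff_map] at h1
        have h2 : q0.coeff a = ⟨x, hxκ⟩ := by
          apply Subtype.ext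
          change ((q0.coeff a : κ) : L) = x
          rw [ha]
          conv_rhs => rw [← hq0, coeff_map]
          rfl
        rw [h2] at h1
        exact h1
    refine this.trans ((Multiset.toFinset_card_le _).trans ((card_roots' _).trans ?_))
    rw [hf.natDegree_map]
  obtain ⟨α, hα⟩ := Field.exists_primitive_element K κ
  have hintg : IsIntegral K α := Algebra.IsIntegral.isIntegral α
  refine ⟨κ.val α, ?_, ?_⟩
  · have h1 : minpoly K (κ.val α) = minpoly K α := minpoly.algHom_eq κ.val κ.val.toRingHom.injective α
    have h2 := IntermediateField.adjoin.finrank hintg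
    rw [hα, IntermediateField.finrank_top'] at h2
    rw [h1, ← h2]
    exact hcard
  · intro a
    have h1 : (⟨q.coeff a, hmem a⟩ : κ) ∈ (IntermediateField.adjoin K {α}).toSubalgebra := by
      rw [IntermediateField.mem_toSubalgebra, hα]; trivial
    rw [IntermediateField.adjoin_simple_toSubalgebra_of_isAlgebraic hintg.isAlgebraic,
      Algebra.adjoin_singleton_eq_range_aeval] at h1
    obtain ⟨s, hs⟩ := h1
    refine ⟨s, ?_⟩
    rw [aeval_algHom_apply]
    have : aeval α s = (⟨q.coeff a, hmem a⟩ : κ) := hs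
    rw [this]
    rfl

lemma exists_clear {m : ℕ} (K' : Type) [Field K'] [Algebra (MvPolynomial (Fin m) ℚ) K']
    [IsFractionRing (MvPolynomial (Fin m) ℚ) K'] (g : K'[X]) :
    ∃ (G0 : (MvPolynomial (Fin m) ℤ)[X]) (b : K'), b ≠ 0 ∧
      G0.map ((algebraMap (MvPolynomial (Fin m) ℚ) K').comp (MvPolynomial.map (Int.castRingHom ℚ))) = C b * g := by
  set φ := (algebraMap (MvPolynomial (Fin m) ℚ) K').comp (MvPolynomial.map (Int.castRingHom ℚ)) with hφ
  let _ : Algebra (MvPolynomial (Fin m) ℤ) K' := φ.toAlgebra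
  have hinj : Function.Injective φ := by
    intro a b hab
    exact MvPolynomial.map_injective _ (RingHom.injective_int _) (IsFractionRing.injective (MvPolynomial (Fin m) ℚ) K' hab)
  have : FaithfulSMul (MvPolynomial (Fin m) ℤ) K' := (faithfulSMul_iff_algebraMap_injective _ _).2 hinj
  have hden : ∀ p : MvPolynomial (Fin m) ℚ, ∃ (N : ℤ) (p' : MvPolynomial (Fin m) ℤ), N ≠ 0 ∧
      MvPolynomial.map (Int.castRingHom ℚ) p' = MvPolynomial.C (N : ℚ) * p := by
    intro p
    induction p using MvPolynomial.induction_on' with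
    | monomial u a =>
      refine ⟨a.den, MvPolynomial.monomial u a.num, by exact_mod_cast a.den_nz, ?_⟩
      rw [MvPolynomial.map_monomial, MvPolynomial.C_mul_monomial]
      congr 1
      simp
    | add p q hp hq =>
      obtain ⟨N, p', hN, h1⟩ := hp
      obtain ⟨N', q', hN', h2⟩ := hq
      refine ⟨N * N', MvPolynomial.C N' * p' + MvPolynomial.C N * q', mul_ne_zero hN hN', ?_⟩
      rw [map_add, map_mul, map_mul, h1, h2]
      simp
      ring
  have hfr : IsFractionRing (MvPolynomial (Fin m) ℤ) K' := by
    apply IsFractionRing.of_field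
    intro z
    obtain ⟨x, y, hy, rfl⟩ := IsFractionRing.div_surjective (A := MvPolynomial (Fin m) ℚ) z
    obtain ⟨N, p', hN, h1⟩ := hden x
    obtain ⟨N', q', hN', h2⟩ := hden y
    refine ⟨MvPolynomial.C N' * p', MvPolynomial.C N * q', ?_⟩
    change _ = φ _ / φ _
    rw [map_mul, map_mul]
    simp only [hφ, RingHom.comp_apply, h1, h2, map_mul, MvPolynomial.map_C]
    have e : ∀ N : ℤ, N ≠ 0 → (algebraMap (MvPolynomial (Fin m) ℚ) K') (MvPolynomial.C (N : ℚ)) ≠ 0 := by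
      intro N hN h
      rw [map_eq_zero_iff _ (IsFractionRing.injective (MvPolynomial (Fin m) ℚ) K')] at h
      simp [hN] at h
    have e1 := e N hN
    have e2 := e N' hN'
    have e3 : (algebraMap (MvPolynomial (Fin m) ℚ) K') y ≠ 0 := IsFractionRing.to_map_ne_zero_of_mem_nonZeroDivisors hy
    simp only [eq_intCast]
    field_simp
  obtain ⟨b, hb⟩ := IsLocalization.integerNormalization_map_to_map (nonZeroDivisors (MvPolynomial (Fin m) ℤ)) g
  refine ⟨_, φ b, ?_, hb.trans ?_⟩
  · intro h
    have := hinj (h.trans (map_zero φ).symm)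
    exact nonZeroDivisors.ne_zero b.2 this
  · ext k
    rw [coeff_smul, coeff_C_mul]
    exact Algebra.smul_def _ _

section fields
variable {m : ℕ} (i : Fin (m + 1))
variable (K' : Type) [Field K'] [Algebra (MvPolynomial (Fin m) ℚ) K'] [IsFractionRing (MvPolynomial (Fin m) ℚ) K']
variable (Kn : Type) [Field Kn] [Algebra (MvPolynomial (Fin (m + 1)) ℚ) Kn]
  [IsFractionRing (MvPolynomial (Fin (m + 1)) ℚ) Kn]
variable (L : Type) [Field L] [Algebra K' L]

lemma h2core [IsAlgClosed L] [Algebra.IsAlgebraic K' L] (R : (MvPolynomial (Fin (m + 1)) ℤ)[X]) (hR : R.Monic)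
    (F : Kn[X]) (hF : F = (toQ R).map (algebraMap _ Kn)) (hFirr : Irreducible F)
    (q : L[X]) (hq : ((toQ R).map (tau i K' L)).eval q = 0) :
    ∃ G : (MvPolynomial (Fin (m + 1)) ℤ)[X], Irreducible ((toQ G).map (algebraMap _ Kn)) ∧
      Nonempty (AdjoinRoot ((toQ G).map (algebraMap _ Kn)) ≃ₐ[Kn] AdjoinRoot F) ∧ degX G i = 0 := by
  let Λ := FractionRing L[X]
  have hRQ : (toQ R).Monic := hR.map _
  have hFm : F.Monic := by rw [hF]; exact hRQ.map _
  have hch : CharZero K' := charZero_of_injective_algebraMap (IsFractionRing.injective (MvPolynomial (Fin m) ℚ) K')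
  obtain ⟨θ, hθd, hθ⟩ := coeff_field_degree (K := K') (L := L) ((toQ R).map (tauK i K')) (hRQ.map _) q (by
    rw [Polynomial.map_map]; exact hq)
  rw [hRQ.natDegree_map] at hθd
  set g := minpoly K' θ with hg
  have hθint : IsIntegral K' θ := Algebra.IsIntegral.isIntegral θ
  have hgm : g.Monic := minpoly.monic hθint
  let _ : Algebra Kn Λ := (jj i K' Kn L Λ).toAlgebra
  have halg : algebraMap Kn Λ = jj i K' Kn L Λ := rfl
  set q' : Λ := algebraMap L[X] Λ q with hq'
  set θ' : Λ := algebraMap L[X] Λ (C θ) with hθ'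
  have hu : ∀ s : K'[X], aeval θ' (s.map (uu i K' Kn)) = algebraMap L[X] Λ (C (aeval θ s)) := by
    intro s
    rw [aeval_def, halg, eval₂_map]
    have : (jj i K' Kn L Λ).comp (uu i K' Kn) = ((algebraMap L[X] Λ).comp C).comp (algebraMap K' L) :=
      RingHom.ext fun a => jj_uu i K' Kn L Λ a
    rw [this, hθ', aeval_def, hom_eval₂, hom_eval₂, RingHom.comp_assoc]
  have hqF : aeval q' F = 0 := by
    rw [aeval_def, halg, ← eval_map, hF, map_jj, hq', eval_map_apply, hq, map_zero]
  have hFmin : F = minpoly Kn q' := minpoly.eq_of_irreducible_of_monic hFirr hqF hFm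
  have hq'int : IsIntegral Kn q' := ⟨F, hFm, hqF⟩
  have hgθ : aeval θ' (g.map (uu i K' Kn)) = 0 := by
    rw [hu, hg, minpoly.aeval, map_zero, map_zero]
  have hθ'int : IsIntegral Kn θ' := ⟨g.map (uu i K' Kn), hgm.map _, hgθ⟩
  have hmem : q' ∈ IntermediateField.adjoin Kn {θ'} := by
    have e1 : q' = ∑ a ∈ Finset.range (q.natDegree + 1), algebraMap L[X] Λ (C (q.coeff a)) * (algebraMap L[X] Λ X) ^ a := by
      rw [hq']
      conv_lhs => rw [q.as_sum_range_C_mul_X_pow]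
      simp
    rw [e1]
    refine sum_mem fun a _ => mul_mem ?_ (pow_mem ?_ _)
    · obtain ⟨s, hs⟩ := hθ a
      rw [← hs, ← hu]
      have : IntermediateField.adjoin Kn {θ'} = IntermediateField.adjoin Kn {θ'} := rfl
      have h2 : θ' ∈ IntermediateField.adjoin Kn {θ'} := IntermediateField.mem_adjoin_simple_self Kn θ'
      have h3 := aeval_algHom_apply (IntermediateField.adjoin Kn {θ'}).val ⟨θ', h2⟩ (s.map (uu i K' Kn))
      change aeval θ' _ = _ at h3
      rw [h3]
      exact Subtype.mem _
    · have : algebraMap L[X] Λ X = algebraMap Kn Λ (algebraMap (MvPolynomial (Fin (m+1)) ℚ) Kn (MvPolynomial.X i)) := by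
        rw [halg, jj_algebraMap]
        simp [tau, tauK, ei_X_self]
      rw [this]
      exact IntermediateField.algebraMap_mem _ _
  have hle : IntermediateField.adjoin Kn {q'} ≤ IntermediateField.adjoin Kn {θ'} := by
    rw [IntermediateField.adjoin_simple_le_iff]; exact hmem
  have f1 := IntermediateField.adjoin.finrank hq'int
  have f2 := IntermediateField.adjoin.finrank hθ'int
  rw [← hFmin, hF, hRQ.natDegree_map] at f1
  have hfd : FiniteDimensional Kn (IntermediateField.adjoin Kn {θ'}) := IntermediateField.adjoin.finiteDimensional hθ'int
  have f3 : Module.finrank Kn (IntermediateField.adjoin Kn {q'}) ≤ Module.finrank Kn (IntermediateField.adjoin Kn {θ'}) :=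
    IntermediateField.finrank_le_of_le_right hle
  have hdv : minpoly Kn θ' ∣ g.map (uu i K' Kn) := minpoly.dvd _ _ hgθ
  have f4 : (minpoly Kn θ').natDegree ≤ g.natDegree := by
    have := natDegree_le_of_dvd hdv (hgm.map _).ne_zero
    rwa [hgm.natDegree_map] at this
  have heq : IntermediateField.adjoin Kn {q'} = IntermediateField.adjoin Kn {θ'} :=
    IntermediateField.eq_of_le_of_finrank_eq hle (by omega)
  have hmp : g.map (uu i K' Kn) = minpoly Kn θ' :=
    eq_of_monic_of_dvd_of_natDegree_le (minpoly.monic hθ'int) (hgm.map _) hdv (by rw [hgm.natDegree_map]; omega)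
  obtain ⟨G0, b, hb, hG0⟩ := exists_clear (m := m) K' g
  set G := G0.map ((MvPolynomial.rename i.succAbove : MvPolynomial (Fin m) ℤ →ₐ[ℤ] MvPolynomial (Fin (m + 1)) ℤ).toRingHom) with hG
  have hGf : (toQ G).map (algebraMap _ Kn) = C (uu (m := m) i K' Kn b) * minpoly Kn θ' := by
    rw [← hmp, ← map_C, ← Polynomial.map_mul, ← hG0, hG, toQ, Polynomial.map_map, Polynomial.map_map, Polynomial.map_map]
    congr 1
    apply MvPolynomial.ringHom_ext
    · intro r; simp
    · intro j; simp [uu_algebraMap]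
  have hass : Associated (minpoly Kn θ') ((toQ G).map (algebraMap _ Kn)) := by
    rw [hGf]
    have hub : IsUnit (C (uu (m := m) i K' Kn b)) := by
      rw [isUnit_C, isUnit_iff_ne_zero, _root_.map_ne_zero]; exact hb
    exact (associated_unit_mul_left _ _ hub).symm
  refine ⟨G, hass.irreducible (minpoly.irreducible hθ'int), ⟨?_⟩, ?_⟩
  · refine (AdjoinRoot.algEquivOfAssociated Kn _ _ hass.symm).trans ?_
    refine (IntermediateField.adjoinRootEquivAdjoin Kn hθ'int).trans ?_
    refine (IntermediateField.equivOfEq heq.symm).trans ?_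
    refine (IntermediateField.adjoinRootEquivAdjoin Kn hq'int).symm.trans ?_
    exact AdjoinRoot.algEquivOfEq Kn _ _ hFmin.symm
  · rw [degX, ← Nat.le_zero]
    refine Finset.sup_le fun k _ => ?_
    rw [hG, coeff_map]
    exact (degreeOf_rename_succAbove i _).le

end fields

end

section
lemma toQ_irreducible {n : ℕ} (R : (MvPolynomial (Fin n) ℤ)[X]) (hR : R.Monic) (h : AbsIrred R) :
    Irreducible (toQ R) := by
  have hRQ : (toQ R).Monic := hR.map _
  refine hRQ.irreducible_of_irreducible_map (MvPolynomial.map (algebraMap ℚ (AlgebraicClosure ℚ))) _ ?_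
  have : (toQ R).map (MvPolynomial.map (algebraMap ℚ (AlgebraicClosure ℚ)))
      = R.map (MvPolynomial.map (Int.castRingHom (AlgebraicClosure ℚ))) := by
    rw [toQ, Polynomial.map_map]
    congr 1
    refine RingHom.ext fun a => ?_
    rw [RingHom.comp_apply, MvPolynomial.map_map]
    congr 2
  rw [this]
  exact h

section fields
variable {m : ℕ}
variable (K' : Type) [Field K'] [Algebra (MvPolynomial (Fin m) ℚ) K'] [IsFractionRing (MvPolynomial (Fin m) ℚ) K']
variable (Kn : Type) [Field Kn] [Algebra (MvPolynomial (Fin (m + 1)) ℚ) Kn]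
  [IsFractionRing (MvPolynomial (Fin (m + 1)) ℚ) Kn]
variable (L : Type) [Field L] [Algebra K' L]

lemma D_abs [IsAlgClosed L] [Algebra.IsAlgebraic K' L] (R : (MvPolynomial (Fin (m + 1)) ℤ)[X]) (hR : R.Monic)
    (hirr : Irreducible (toQ R))
    (hgen : ∀ G : (MvPolynomial (Fin (m + 1)) ℤ)[X], Irreducible ((toQ G).map (algebraMap _ Kn)) →
      Nonempty (AdjoinRoot ((toQ G).map (algebraMap _ Kn)) ≃ₐ[Kn] AdjoinRoot ((toQ R).map (algebraMap _ Kn))) →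
      AllPosDeg G)
    (M : Type) [Field M] [Algebra Kn M] (e : AdjoinRoot ((toQ R).map (algebraMap _ Kn)) ≃ₐ[Kn] M)
    (M' : IntermediateField Kn M) (hM' : M' ≠ ⊥) (G : (MvPolynomial (Fin (m + 1)) ℤ)[X])
    (hG : Irreducible ((toQ G).map (algebraMap _ Kn)))
    (e' : AdjoinRoot ((toQ G).map (algebraMap _ Kn)) ≃ₐ[Kn] M') (hGp : ¬ AllPosDeg G) :
    ∃ i : Fin (m + 1), (∃ a b : L[X][X], a.Monic ∧ b.Monic ∧ a * b = (toQ R).map (tau i K' L) ∧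
      1 ≤ a.natDegree ∧ 1 ≤ b.natDegree) ∧ ∀ q : L[X], ((toQ R).map (tau i K' L)).eval q ≠ 0 := by
  have hRQ : (toQ R).Monic := hR.map _
  have hFirr : Irreducible ((toQ R).map (algebraMap _ Kn)) :=
    (hRQ.irreducible_iff_irreducible_map_fraction_map).1 hirr
  have hGd : 0 < G.natDegree := by
    rw [Nat.pos_iff_ne_zero]
    intro h0
    have h1 : ((toQ G).map (algebraMap _ Kn)).natDegree = 0 := by
      rw [← Nat.le_zero, ← h0]
      exact natDegree_map_le.trans natDegree_map_le
    have := hG.natDegree_pos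
    omega
  obtain ⟨i, hi⟩ : ∃ i, degX G i = 0 := by
    by_contra hcon
    push Not at hcon
    exact hGp ⟨hGd, fun i => Nat.pos_of_ne_zero (hcon i)⟩
  refine ⟨i, ?_, ?_⟩
  · obtain ⟨γ, hγ0, hγ⟩ := exists_gamma _ _ M e M' hM' e'
    have hni : ¬ Irreducible ((toQ R).map (tau i K' L)) := by
      intro hi'
      obtain ⟨r, hr⟩ := h3core i K' Kn L R G hR hi' hG.ne_zero hi _ rfl γ hγ0
      exact hγ r hr
    have hm : ((toQ R).map (tau i K' L)).Monic := hRQ.map _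
    have hne1 : (toQ R).map (tau i K' L) ≠ 1 := by
      intro h1
      have h2 : (toQ R).natDegree = 0 := by
        rw [← hRQ.natDegree_map (tau i K' L), h1, natDegree_one]
      have h3 := hFirr.natDegree_pos
      rw [hRQ.natDegree_map] at h3
      omega
    rw [hm.irreducible_iff_natDegree] at hni
    push Not at hni
    obtain ⟨a, b, ha, hb, hab, h1, h2⟩ := hni hne1
    exact ⟨a, b, ha, hb, hab, Nat.one_le_iff_ne_zero.2 h1, Nat.one_le_iff_ne_zero.2 h2⟩
  · intro q hq
    obtain ⟨G', hG'1, hG'2, hG'3⟩ := h2core i K' Kn L R hR _ rfl hFirr q hq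
    have := (hgen G' hG'1 hG'2).2 i
    omega

end fields

lemma tau_comp {m : ℕ} (i : Fin (m + 1)) (K' : Type) [Field K'] [Algebra (MvPolynomial (Fin m) ℚ) K']
    (L : Type) [Field L] [Algebra K' L] (R : (MvPolynomial (Fin (m + 1)) ℤ)[X]) (j : MvPolynomial (Fin m) ℤ →+* L)
    (hj : j = (algebraMap K' L).comp ((algebraMap (MvPolynomial (Fin m) ℚ) K').comp (MvPolynomial.map (Int.castRingHom ℚ)))) :
    (toQ R).map (tau i K' L) = (R.map (ei ℤ i : MvPolynomial (Fin (m + 1)) ℤ →+* (MvPolynomial (Fin m) ℤ)[X])).map (mapRingHom j) := by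
  rw [toQ, Polynomial.map_map, Polynomial.map_map, hj]
  congr 1
  refine RingHom.ext fun a => ?_
  simp only [tau, tauK, RingHom.comp_apply, coe_mapRingHom, RingHom.coe_coe]
  rw [ei_map, Polynomial.map_map, Polynomial.map_map, RingHom.comp_assoc]

theorem D_main {m : ℕ} (R : (MvPolynomial (Fin (m + 1)) ℤ)[X]) (hR : R.Monic)
    (hg : IsGenuinePoly R) (hns : ¬ IsStronglyGenuinePoly R) :
    ∃ (i : Fin (m + 1)) (L : Type) (_ : Field L) (_ : IsAlgClosed L) (j : MvPolynomial (Fin m) ℤ →+* L),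
      Function.Injective j ∧
      (∃ a b : L[X][X], a.Monic ∧ b.Monic ∧
        a * b = (R.map (ei ℤ i : MvPolynomial (Fin (m + 1)) ℤ →+* (MvPolynomial (Fin m) ℤ)[X])).map (mapRingHom j) ∧
      1 ≤ a.natDegree ∧ 1 ≤ b.natDegree) ∧ ∀ q : L[X], 
        ((R.map (ei ℤ i : MvPolynomial (Fin (m + 1)) ℤ →+* (MvPolynomial (Fin m) ℤ)[X])).map (mapRingHom j)).eval q ≠ 0 := by
  have h1 : ¬ StronglyGenuineExtOfQ (toQ R) := fun h => hns ⟨hg.1, h⟩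
  unfold StronglyGenuineExtOfQ IsStronglyGenuineExt IsGenuineExt at h1
  push Not at h1
  obtain ⟨M, iM, iA, ⟨e⟩, M', hM', G, hG, ⟨e'⟩, hGp⟩ := h1
  have hal : Algebra.IsAlgebraic (RF m) (AlgebraicClosure (RF m)) := AlgebraicClosure.isAlgebraic _
  obtain ⟨i, ⟨a, b, ha, hb, hab, h1, h2⟩, hq⟩ := D_abs (RF m) (RF (m + 1)) (AlgebraicClosure (RF m)) R hR (toQ_irreducible R hR hg.1)
    hg.2 M e M' hM' G hG e' hGp
  refine ⟨i, AlgebraicClosure (RF m), inferInstance, inferInstance, (algebraMap (RF m) (AlgebraicClosure (RF m))).comp ((algebraMap (MvPolynomial (Fin m) ℚ) (RF m)).comp (MvPolynomial.map (Int.castRingHom ℚ))), ?_, ⟨a, b, ha, hb, ?_, h1, h2⟩, ?_⟩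
  rotate_left
  · rw [hab]
    exact tau_comp i (RF m) (AlgebraicClosure (RF m)) R _ rfl
  · rwa [tau_comp i (RF m) (AlgebraicClosure (RF m)) R _ rfl] at hq
  · exact (algebraMap (RF m) (AlgebraicClosure (RF m))).injective.comp
      ((IsFractionRing.injective (MvPolynomial (Fin m) ℚ) (RF m)).comp
        (MvPolynomial.map_injective _ (RingHom.injective_int _)))

end

section
/-- coefficient family of a bivariate polynomial -/
noncomputable def cf {A : Type*} [CommRing A] (k1 k2 D : ℕ) (f : A[X][X]) : PIdx k1 k2 D → A :=
  fun v => (f.coeff v.1).coeff v.2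

lemma cf_map {A K : Type*} [CommRing A] [CommRing K] (k1 k2 D : ℕ) (f : A[X][X]) (φ : A →+* K) :
    cf k1 k2 D (f.map (mapRingHom φ)) = fun v => φ (cf k1 k2 D f v) := by
  funext v
  simp [cf]

lemma MP_cf {A : Type*} [CommRing A] (k1 k2 D : ℕ) (f : A[X][X]) (hf : f.Monic)
    (hk : f.natDegree = k1 + k2) (hD : ∀ j, (f.coeff j).natDegree ≤ D) :
    f = MP (k1 + k2) (2 * D + 1) (cf k1 k2 D f) :=
  MP_surj _ _ f hf hk fun j _ a ha => coeff_eq_zero_of_natDegree_lt (by have := hD j; omega)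

lemma eval₂Hom_comp {A K σ : Type*} [CommRing A] [CommRing K] (φ : A →+* K) (c : σ → A) :
    φ.comp (MvPolynomial.eval₂Hom (Int.castRingHom A) c) =
      MvPolynomial.eval₂Hom (Int.castRingHom K) (fun v => φ (c v)) := by
  apply MvPolynomial.ringHom_ext
  · intro r; simp
  · intro v; simp

lemma lift_factor {A K : Type*} [CommRing A] [Field K] [IsAlgClosed K] (k1 k2 D : ℕ) (f : A[X][X]) (hf : f.Monic)
    (hk : f.natDegree = k1 + k2) (hD : ∀ j, (f.coeff j).natDegree ≤ D) (φ : A →+* K)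
    (hker : ∀ p, univMap k1 k2 D p = 0 → φ (MvPolynomial.eval₂Hom (Int.castRingHom A) (cf k1 k2 D f) p) = 0) :
    ∃ a b : K[X][X], a.Monic ∧ b.Monic ∧ a * b = f.map (mapRingHom φ) ∧ a.natDegree = k1 ∧ b.natDegree = k2 := by
  obtain ⟨c', hc'⟩ := integral_lift (univMap k1 k2 D) (univMap_integral k1 k2 D)
    (φ.comp (MvPolynomial.eval₂Hom (Int.castRingHom A) (cf k1 k2 D f))) (fun p hp => hker p hp)
  set h : FIdx k1 k2 D → K := fun u => c' (MvPolynomial.X u) with hh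
  have h1 : prodCoeff k1 k2 D h = fun v => φ (cf k1 k2 D f v) := by
    funext v
    have h2 := RingHom.congr_fun hc' (MvPolynomial.X v)
    rw [RingHom.comp_apply, univMap_X, prodCoeff_map] at h2
    rw [hh, h2]
    simp
  refine ⟨_, _, MP_monic k1 (D + 1) (fun u => h (Sum.inl u)), MP_monic k2 (D + 1) (fun u => h (Sum.inr u)), ?_,
    MP_natDegree _ _ _, MP_natDegree _ _ _⟩
  rw [← prodCoeff_spec, h1, ← MP_map, ← MP_cf k1 k2 D f hf hk hD]

lemma ker_of_factor {A K : Type*} [CommRing A] [CommRing K] [IsDomain K] (k1 k2 D : ℕ) (f : A[X][X])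
    (hD : ∀ j, (f.coeff j).natDegree ≤ D) (φ : A →+* K)
    (a b : K[X][X]) (ha : a.Monic) (hb : b.Monic) (hab : a * b = f.map (mapRingHom φ))
    (h1 : a.natDegree = k1) (h2 : b.natDegree = k2)
    (p) (hp : univMap k1 k2 D p = 0) : φ (MvPolynomial.eval₂Hom (Int.castRingHom A) (cf k1 k2 D f) p) = 0 := by
  obtain ⟨h, -, -, e3⟩ := factor_MP k1 k2 D _ a b ha hb hab h1 h2 (by
    intro j; rw [coeff_map]; exact natDegree_map_le.trans (hD j))
  change prodCoeff k1 k2 D h = cf k1 k2 D (f.map (mapRingHom φ)) at e3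
  rw [← RingHom.comp_apply, eval₂Hom_comp, ← cf_map, ← e3, ← univMap_comp, RingHom.comp_apply, hp, map_zero]

lemma transfer_factor {A L K : Type*} [CommRing A] [Field L] [Field K] [IsAlgClosed K] (D : ℕ) (f : A[X][X])
    (hf : f.Monic) (hD : ∀ j, (f.coeff j).natDegree ≤ D) (j : A →+* L) (hj : Function.Injective j)
    (a b : L[X][X]) (ha : a.Monic) (hb : b.Monic) (hab : a * b = f.map (mapRingHom j)) (φ : A →+* K) :
    ∃ a' b' : K[X][X], a'.Monic ∧ b'.Monic ∧ a' * b' = f.map (mapRingHom φ) ∧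
      a'.natDegree = a.natDegree ∧ b'.natDegree = b.natDegree := by
  refine lift_factor a.natDegree b.natDegree D f hf ?_ hD φ fun p hp => ?_
  · rw [← hf.natDegree_map (mapRingHom j), ← hab, ha.natDegree_mul hb]
  · have := ker_of_factor _ _ D f hD j a b ha hb hab rfl rfl p hp
    rw [map_eq_zero_iff _ hj] at this
    rw [this, map_zero]

lemma root_poly_k (m k D : ℕ) : ∃ E : ℕ, ∀ (f : (MvPolynomial (Fin m) ℤ)[X][X]),
    f.Monic → f.natDegree = 1 + k → (∀ j, (f.coeff j).natDegree ≤ D) →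
    (∀ j a, ((f.coeff j).coeff a).totalDegree ≤ D) →
    ∀ (L : Type) (_ : Field L) (_ : IsAlgClosed L) (j : MvPolynomial (Fin m) ℤ →+* L),
    (∀ q : L[X], (f.map (mapRingHom j)).eval q ≠ 0) →
    ∃ g : MvPolynomial (Fin m) ℤ, g ≠ 0 ∧ g.totalDegree ≤ E ∧ ∀ φ : MvPolynomial (Fin m) ℤ →+* ℚ,
      ∀ r : ℚ[X], (f.map (mapRingHom φ)).eval r = 0 → φ g = 0 := by
  classical
  obtain ⟨s, hs⟩ := (isNoetherianRing_iff_ideal_fg (MvPolynomial (PIdx 1 k D) ℤ)).1 inferInstance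
    (RingHom.ker (univMap 1 k D))
  choose Bq hBq using fun (q : MvPolynomial (PIdx 1 k D) ℤ) => subst_totalDegree (τ := Fin m) D q
  refine ⟨∑ q ∈ s, Bq q, fun f hf hk hD hT L _ _ j hroot => ?_⟩
  have hex : ∃ q ∈ s, MvPolynomial.eval₂Hom (Int.castRingHom (MvPolynomial (Fin m) ℤ)) (cf 1 k D f) q ≠ 0 := by
    by_contra hcon
    push Not at hcon
    have hle : RingHom.ker (univMap 1 k D) ≤
        RingHom.ker (MvPolynomial.eval₂Hom (Int.castRingHom (MvPolynomial (Fin m) ℤ)) (cf 1 k D f)) := by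
      rw [← hs, Ideal.span_le]
      intro q hq
      exact hcon q hq
    obtain ⟨a, b, ha, hb, hab, h1, h2⟩ := lift_factor 1 k D f hf hk hD j (fun p hp => by
      have : MvPolynomial.eval₂Hom (Int.castRingHom (MvPolynomial (Fin m) ℤ)) (cf 1 k D f) p = 0 := hle hp
      rw [this, map_zero])
    apply hroot (-(a.coeff 0))
    rw [← hab, eval_mul]
    have : a = X + C (a.coeff 0) := by
      conv_lhs => rw [ha.as_sum, h1]
      simp
    have h3 : eval (-(a.coeff 0)) a = 0 := by
      rw [this]; simp
    rw [h3, zero_mul]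
  obtain ⟨q, hq, hne⟩ := hex
  refine ⟨_, hne, (hBq q _ fun v => hT _ _).trans (Finset.single_le_sum (f := Bq) (fun i _ => Nat.zero_le _) hq), ?_⟩
  intro φ r hr
  have hfm : (f.map (mapRingHom φ)).Monic := hf.map _
  obtain ⟨b, hb⟩ := dvd_iff_isRoot.2 hr
  have hbm : b.Monic := (monic_X_sub_C r).of_mul_monic_left (hb ▸ hfm)
  refine ker_of_factor 1 k D f hD φ (X - C r) b (monic_X_sub_C r) hbm hb.symm (natDegree_X_sub_C r) ?_ q ?_
  · have h4 := congrArg natDegree hb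
    rw [hf.natDegree_map, (monic_X_sub_C r).natDegree_mul hbm, natDegree_X_sub_C, hk] at h4
    omega
  · have : q ∈ RingHom.ker (univMap 1 k D) := by rw [← hs]; exact Ideal.subset_span hq
    exact this

lemma root_poly (D : ℕ) (m : ℕ) : ∃ E : ℕ, ∀ (f : (MvPolynomial (Fin m) ℤ)[X][X]),
    f.Monic → 1 ≤ f.natDegree → f.natDegree ≤ D → (∀ j, (f.coeff j).natDegree ≤ D) →
    (∀ j a, ((f.coeff j).coeff a).totalDegree ≤ D) →
    ∀ (L : Type) (_ : Field L) (_ : IsAlgClosed L) (j : MvPolynomial (Fin m) ℤ →+* L),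
    (∀ q : L[X], (f.map (mapRingHom j)).eval q ≠ 0) →
    ∃ g : MvPolynomial (Fin m) ℤ, g ≠ 0 ∧ g.totalDegree ≤ E ∧ ∀ φ : MvPolynomial (Fin m) ℤ →+* ℚ,
      ∀ r : ℚ[X], (f.map (mapRingHom φ)).eval r = 0 → φ g = 0 := by
  choose E hE using fun k => root_poly_k m k D
  refine ⟨∑ k ∈ Finset.range D, E k, fun f hf h1 h2 h3 h4 L _ _ j hj => ?_⟩
  obtain ⟨k, hk⟩ : ∃ k, f.natDegree = 1 + k := ⟨f.natDegree - 1, by omega⟩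
  obtain ⟨g, hg, hgE, hg2⟩ := hE k f hf hk h3 h4 L _ ‹_› j hj
  exact ⟨g, hg, hgE.trans (Finset.single_le_sum (f := E) (fun i _ => Nat.zero_le _) (Finset.mem_range.2 (by omega))), hg2⟩

end

section
/-- specialisation of the parameters at an integer point -/
noncomputable def spec {m : ℕ} (f : (MvPolynomial (Fin m) ℤ)[X][X]) (x : Fin m → ℤ) : ℤ[X][X] :=
  f.map (mapRingHom (MvPolynomial.eval x))

lemma spec_coeff_natDegree {m : ℕ} (D : ℕ) (f : (MvPolynomial (Fin m) ℤ)[X][X]) (hD : ∀ j, (f.coeff j).natDegree ≤ D)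
    (x : Fin m → ℤ) (j : ℕ) : ((spec f x).coeff j).natDegree ≤ D := by
  rw [spec, coeff_map]; exact natDegree_map_le.trans (hD j)

lemma bad2 (m D : ℕ) : ∃ C : ℝ, 0 < C ∧ ∀ N T : ℕ, 1 ≤ N → N + 2 ≤ T →
    ∀ f : (MvPolynomial (Fin m) ℤ)[X][X], f.Monic → f.natDegree ≤ D → (∀ j, (f.coeff j).natDegree ≤ D) →
    (∀ j a, ((f.coeff j).coeff a).totalDegree ≤ D) →
    (∀ j a, ∀ x : Fin m → ℤ, (∀ i, |x i| ≤ N) → |MvPolynomial.eval x ((f.coeff j).coeff a)| ≤ T) →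
    (∀ a b : (MvPolynomial (Fin m) ℤ)[X][X], a.Monic → b.Monic → a * b = f → a.natDegree = 0 ∨ b.natDegree = 0) →
    ∀ S : Finset (Fin m → ℤ),
    (∀ x ∈ S, (∀ i, |x i| ≤ N) ∧ ∃ k1 k2 : ℕ, 1 ≤ k1 ∧ 1 ≤ k2 ∧ k1 + k2 = f.natDegree ∧
      ∃ h : FIdx k1 k2 D → ℤ, prodCoeff k1 k2 D h = cf k1 k2 D (spec f x)) →
    (S.card : ℝ) * Real.sqrt N ≤ C * ((N : ℝ) ^ m * Real.log T ^ 4) := by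
  classical
  choose C hC0 hC using fun p : ℕ × ℕ => lemB m (TP_all m) p.1 p.2 D D
  set I := Finset.range (D + 1) ×ˢ Finset.range (D + 1) with hI
  refine ⟨∑ p ∈ I, C p + 1, add_pos_of_nonneg_of_pos (Finset.sum_nonneg fun p _ => (hC0 p).le) one_pos, ?_⟩
  intro N T hN hT f hf hfD hfX hfd hfT hirr S hS
  have hl := one_le_log T (by omega)
  set P : ℕ × ℕ → (Fin m → ℤ) → Prop := fun p x => 1 ≤ p.1 ∧ 1 ≤ p.2 ∧ p.1 + p.2 = f.natDegree ∧
      ∃ h : FIdx p.1 p.2 D → ℤ, prodCoeff p.1 p.2 D h = cf p.1 p.2 D (spec f x) with hP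
  have hsub : S ⊆ I.biUnion fun p => S.filter (P p) := by
    intro x hx
    obtain ⟨-, k1, k2, h1, h2, h3, h4⟩ := hS x hx
    rw [Finset.mem_biUnion]
    refine ⟨(k1, k2), ?_, Finset.mem_filter.2 ⟨hx, h1, h2, h3, h4⟩⟩
    rw [hI, Finset.mem_product, Finset.mem_range, Finset.mem_range]
    constructor <;> simp only <;> omega
  have hcard : (S.card : ℝ) ≤ ∑ p ∈ I, ((S.filter (P p)).card : ℝ) := by
    exact_mod_cast (Finset.card_le_card hsub).trans Finset.card_biUnion_le
  have hp : ∀ p ∈ I, ((S.filter (P p)).card : ℝ) * Real.sqrt N ≤ C p * ((N : ℝ) ^ m * Real.log T ^ 4) := by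
    intro p _
    refine hC p N T hN hT (cf p.1 p.2 D f) (fun v => hfd _ _) (fun v x hx => hfT _ _ x hx) _ ?_
    intro x hx
    rw [Finset.mem_filter] at hx
    obtain ⟨hxS, h1, h2, h3, h, hh⟩ := hx
    refine ⟨(hS x hxS).1, h, ?_, ?_⟩
    · rw [hh, spec, cf_map]
    · intro r hr
      exfalso
      have hsp := prodCoeff_spec p.1 p.2 D r
      rw [hr, ← MP_cf p.1 p.2 D f hf h3.symm hfX] at hsp
      rcases hirr _ _ (MP_monic _ _ _) (MP_monic _ _ _) hsp.symm with h0 | h0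
      · rw [MP_natDegree] at h0; omega
      · rw [MP_natDegree] at h0; omega
  calc (S.card : ℝ) * Real.sqrt N ≤ (∑ p ∈ I, ((S.filter (P p)).card : ℝ)) * Real.sqrt N := by gcongr
    _ = ∑ p ∈ I, ((S.filter (P p)).card : ℝ) * Real.sqrt N := Finset.sum_mul _ _ _
    _ ≤ ∑ p ∈ I, C p * ((N : ℝ) ^ m * Real.log T ^ 4) := Finset.sum_le_sum hp
    _ = (∑ p ∈ I, C p) * ((N : ℝ) ^ m * Real.log T ^ 4) := (Finset.sum_mul _ _ _).symm
    _ ≤ _ := by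
      have : (0 : ℝ) ≤ Real.log T := by linarith
      gcongr
      linarith

theorem assemble (m D E : ℕ) : ∃ C : ℝ, 0 < C ∧ ∀ N T : ℕ, 1 ≤ N → N + 2 ≤ T →
    ∀ f : (MvPolynomial (Fin m) ℤ)[X][X], f.Monic → f.natDegree ≤ D → (∀ j, (f.coeff j).natDegree ≤ D) →
    (∀ j a, ((f.coeff j).coeff a).totalDegree ≤ D) →
    (∀ j a, ∀ x : Fin m → ℤ, (∀ i, |x i| ≤ N) → |MvPolynomial.eval x ((f.coeff j).coeff a)| ≤ T) →
    (∀ j, ∀ x : Fin m → ℤ, ∀ x0 : ℤ, (∀ i, |x i| ≤ N) → |x0| ≤ N → |((spec f x).coeff j).eval x0| ≤ T) →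
    (∀ a b : (MvPolynomial (Fin m) ℤ)[X][X], a.Monic → b.Monic → a * b = f → a.natDegree = 0 ∨ b.natDegree = 0) →
    (∀ Q : Finset (Fin m → ℤ), (∀ x ∈ Q, (∀ i, |x i| ≤ N) ∧ ∃ r : ℤ[X], (spec f x).eval r = 0) →
      (Q.card : ℝ) * N ≤ E * (N : ℝ) ^ m) →
    (∀ x : Fin m → ℤ, ∃ a b : (AlgebraicClosure ℚ)[X][X], a.Monic ∧ b.Monic ∧
      a * b = (spec f x).map (mapRingHom (Int.castRingHom (AlgebraicClosure ℚ))) ∧ 1 ≤ a.natDegree ∧ 1 ≤ b.natDegree) →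
    ∀ S : Finset (Fin (m + 1) → ℤ),
    (∀ x ∈ S, (∀ i, |x i| ≤ N) ∧ ∃ y : ℤ, (spec f (Fin.tail x)).evalEval (x 0) y = 0) →
    (S.card : ℝ) ≤ C * ((N : ℝ) ^ m * Real.log T ^ 8) := by
  classical
  obtain ⟨C1, hC1, hcurve⟩ := curve_lemma D
  obtain ⟨C2, hC2, hbad2⟩ := bad2 m D
  refine ⟨3 * E + C2 * C1 + 3 ^ m * ((D + D) * D) + 1, by positivity, ?_⟩
  intro N T hN hT f hf hfD hfX hfd hfT hfT2 hirr hroot hfac S hS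
  have hl := one_le_log T (by omega)
  have hN' : (1 : ℝ) ≤ N := by exact_mod_cast hN
  have hspm : ∀ x, (spec f x).Monic := fun x => hf.map _
  have hspd : ∀ x, (spec f x).natDegree = f.natDegree := fun x => hf.natDegree_map _
  set box := Fintype.piFinset (fun _ : Fin m => Finset.Icc (-(N : ℤ)) N) with hbox
  set P1 : (Fin m → ℤ) → Prop := fun x => ∃ r : ℤ[X], (spec f x).eval r = 0 with hP1
  set P2 : (Fin m → ℤ) → Prop := fun x => ∃ k1 k2 : ℕ, 1 ≤ k1 ∧ 1 ≤ k2 ∧ k1 + k2 = f.natDegree ∧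
      ∃ h : FIdx k1 k2 D → ℤ, prodCoeff k1 k2 D h = cf k1 k2 D (spec f x) with hP2
  have hbS : ∀ x ∈ S, Fin.tail x ∈ box := fun x hx => (box_mem m N _).2 fun i => (hS x hx).1 i.succ
  set S1 := S.filter fun x => P1 (Fin.tail x) with hS1
  set S2 := S.filter fun x => ¬ P1 (Fin.tail x) ∧ P2 (Fin.tail x) with hS2
  set S3 := S.filter fun x => ¬ P1 (Fin.tail x) ∧ ¬ P2 (Fin.tail x) with hS3
  have hSsub : S ⊆ S1 ∪ (S2 ∪ S3) := by
    intro x hx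
    simp only [hS1, hS2, hS3, Finset.mem_union, Finset.mem_filter]
    by_cases q1 : P1 (Fin.tail x)
    · exact Or.inl ⟨hx, q1⟩
    · by_cases q2 : P2 (Fin.tail x)
      · exact Or.inr (Or.inl ⟨hx, q1, q2⟩)
      · exact Or.inr (Or.inr ⟨hx, q1, q2⟩)
  have hcard : (S.card : ℝ) ≤ S1.card + (S2.card + S3.card) := by
    have h1 := Finset.card_le_card hSsub
    have h2 := Finset.card_union_le S1 (S2 ∪ S3)
    have h3 := Finset.card_union_le S2 S3
    exact_mod_cast h1.trans (h2.trans (by omega))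
  have h1 : (S1.card : ℝ) ≤ 3 * E * (N : ℝ) ^ m := by
    have := fibre_count m S1 (box.filter P1) (fun x hx => by
      rw [hS1, Finset.mem_filter] at hx
      exact Finset.mem_filter.2 ⟨hbS x hx.1, hx.2⟩) (3 * N) (fun x' hx' S0 hS0 => by
        have : S0 ⊆ Finset.Icc (-(N : ℤ)) N := by
          intro a ha
          have h2 := (hS _ (Finset.mem_filter.1 (hS0 a ha)).1).1 0
          rw [Fin.cons_zero] at h2
          rw [Finset.mem_Icc]; exact abs_le.1 h2
        have h3 := Finset.card_le_card this
        rw [Int.card_Icc] at h3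
        have h4 : S0.card ≤ 3 * N := by omega
        exact_mod_cast h4)
    have h2 := hroot (box.filter P1) (fun x hx => by
      rw [Finset.mem_filter] at hx
      exact ⟨(box_mem m N x).1 hx.1, hx.2⟩)
    nlinarith
  have h2 : (S2.card : ℝ) ≤ C2 * C1 * ((N : ℝ) ^ m * Real.log T ^ 8) := by
    have := fibre_count m S2 (box.filter fun x => ¬ P1 x ∧ P2 x) (fun x hx => by
      rw [hS2, Finset.mem_filter] at hx
      exact Finset.mem_filter.2 ⟨hbS x hx.1, hx.2⟩) (C1 * (Real.sqrt N * Real.log T ^ 4)) (fun x' hx' S0 hS0 => by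
        rw [Finset.mem_filter] at hx'
        obtain ⟨hx'b, hx'1, hx'2⟩ := hx'
        have hx'N := (box_mem m N x').1 hx'b
        refine hcurve N T hN hT (spec f x') (hspm x') ((hspd x').le.trans hfD) (spec_coeff_natDegree D f hfX x')
          (fun j x0 hx0 => hfT2 j x' x0 hx'N hx0) S0 ?_
        intro a ha
        obtain ⟨h2, y, hy⟩ := hS _ (Finset.mem_filter.1 (hS0 a ha)).1
        have h20 := h2 0
        rw [Fin.cons_zero] at h20
        rw [Fin.tail_cons, Fin.cons_zero] at hy
        exact ⟨h20, y, hy, fun r hr => absurd ⟨r, hr⟩ hx'1⟩)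
    have h2 := hbad2 N T hN hT f hf hfD hfX hfd hfT hirr (box.filter fun x => ¬ P1 x ∧ P2 x) (fun x hx => by
      rw [Finset.mem_filter] at hx
      exact ⟨(box_mem m N x).1 hx.1, hx.2.2⟩)
    have h4 : (0 : ℝ) ≤ C1 * Real.log T ^ 4 := by positivity
    calc (S2.card : ℝ) ≤ _ := this
      _ = ((box.filter fun x => ¬ P1 x ∧ P2 x).card * Real.sqrt N) * (C1 * Real.log T ^ 4) := by ring
      _ ≤ (C2 * ((N : ℝ) ^ m * Real.log T ^ 4)) * (C1 * Real.log T ^ 4) := by gcongr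
      _ = _ := by ring
  have h3 : (S3.card : ℝ) ≤ 3 ^ m * ((D + D) * D) * (N : ℝ) ^ m := by
    have := fibre_count m S3 (box.filter fun x => ¬ P1 x ∧ ¬ P2 x) (fun x hx => by
      rw [hS3, Finset.mem_filter] at hx
      exact Finset.mem_filter.2 ⟨hbS x hx.1, hx.2⟩) (((D + D) * D : ℕ) : ℝ) (fun x' hx' S0 hS0 => by
        rw [Finset.mem_filter] at hx'
        obtain ⟨hx'b, hx'1, hx'2⟩ := hx'
        obtain ⟨a, b, ha, hb, hab, ha1, hb1⟩ := hfac x'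
        have hk2 : 1 ≤ f.natDegree := by
          have h5 := congrArg natDegree hab
          rw [ha.natDegree_mul hb, (hspm x').natDegree_map, hspd] at h5
          omega
        have hQm : ((spec f x').map (mapRingHom (Int.castRingHom ℚ))).Monic := (hspm x').map _
        have hQi : Irreducible ((spec f x').map (mapRingHom (Int.castRingHom ℚ))) := by
          by_contra hni
          rw [hQm.irreducible_iff_natDegree] at hni
          push Not at hni
          obtain ⟨u, v, hu, hv, huv, h1, h2⟩ := hni (by
            intro h1
            have := congrArg natDegree h1
            rw [(hspm x').natDegree_map, hspd, natDegree_one] at this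
            omega)
          obtain ⟨h, hh, -⟩ := int_factor u.natDegree v.natDegree D (spec f x') (spec_coeff_natDegree D f hfX x')
            u v hu hv huv rfl rfl
          refine hx'2 ⟨_, _, Nat.one_le_iff_ne_zero.2 h1, Nat.one_le_iff_ne_zero.2 h2, ?_, h, hh⟩
          rw [← hu.natDegree_mul hv, huv, (hspm x').natDegree_map, hspd]
        have := fibre_bound D (spec f x') (hspm x') ((hspd x').le.trans hfD) (spec_coeff_natDegree D f hfX x') hQi
          a b ha hb hab ha1 hb1 S0 (fun z hz => by
            obtain ⟨h2, y, hy⟩ := hS _ (Finset.mem_filter.1 (hS0 z hz)).1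
            rw [Fin.tail_cons, Fin.cons_zero] at hy
            exact ⟨y, hy⟩)
        exact_mod_cast this)
    have h4 : ((box.filter fun x => ¬ P1 x ∧ ¬ P2 x).card : ℝ) ≤ 3 ^ m * (N : ℝ) ^ m := by
      refine le_trans ?_ (box_card_le m N hN)
      rw [← box_card m N]
      exact_mod_cast Finset.card_filter_le _ _
    calc (S3.card : ℝ) ≤ _ := this
      _ ≤ (3 ^ m * (N : ℝ) ^ m) * (((D + D) * D : ℕ) : ℝ) := by gcongr
      _ = _ := by push_cast; ring
  have hN0 : (0 : ℝ) ≤ (N : ℝ) ^ m := by positivity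
  have hl8 : (1 : ℝ) ≤ Real.log T ^ 8 := one_le_pow₀ hl
  have h5 : (N : ℝ) ^ m ≤ (N : ℝ) ^ m * Real.log T ^ 8 := le_mul_of_one_le_right hN0 hl8
  have h6 : 3 * E * (N : ℝ) ^ m ≤ 3 * E * ((N : ℝ) ^ m * Real.log T ^ 8) := by gcongr
  have h7 : 3 ^ m * ((D + D) * D) * (N : ℝ) ^ m ≤ 3 ^ m * ((D + D) * D) * ((N : ℝ) ^ m * Real.log T ^ 8) := by gcongr
  nlinarith

end

section
lemma unscale {A : Type*} [CommRing A] [IsDomain A] (θ : A ≃+* A) (s s' : A) (hs : s * s' = 1) (F a b : A[X])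
    (ha : a.Monic) (hb : b.Monic) (hab : a * b = (F.map (θ : A →+* A)).scaleRoots s) :
    ∃ a' b' : A[X], a'.Monic ∧ b'.Monic ∧ a' * b' = F ∧ a'.natDegree = a.natDegree ∧ b'.natDegree = b.natDegree := by
  refine ⟨(a.scaleRoots s').map (θ.symm : A →+* A), (b.scaleRoots s').map (θ.symm : A →+* A),
    ((monic_scaleRoots_iff s').2 ha).map _, ((monic_scaleRoots_iff s').2 hb).map _, ?_, ?_, ?_⟩
  · rw [← Polynomial.map_mul, ← mul_scaleRoots_of_noZeroDivisors, hab, ← scaleRoots_mul, hs, scaleRoots_one,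
      Polynomial.map_map]
    have : (θ.symm : A →+* A).comp (θ : A →+* A) = RingHom.id A := by
      refine RingHom.ext fun x => ?_
      simp
    rw [this, Polynomial.map_id]
  · rw [((monic_scaleRoots_iff s').2 ha).natDegree_map, natDegree_scaleRoots]
  · rw [((monic_scaleRoots_iff s').2 hb).natDegree_map, natDegree_scaleRoots]

lemma rescale {A : Type*} [CommRing A] [IsDomain A] (θ : A ≃+* A) (s : A) (F a b : A[X])
    (ha : a.Monic) (hb : b.Monic) (hab : a * b = F) :
    ∃ a' b' : A[X], a'.Monic ∧ b'.Monic ∧ a' * b' = (F.map (θ : A →+* A)).scaleRoots s ∧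
      a'.natDegree = a.natDegree ∧ b'.natDegree = b.natDegree := by
  refine ⟨(a.map (θ : A →+* A)).scaleRoots s, (b.map (θ : A →+* A)).scaleRoots s,
    (monic_scaleRoots_iff s).2 (ha.map _), (monic_scaleRoots_iff s).2 (hb.map _), ?_, ?_, ?_⟩
  · rw [← mul_scaleRoots_of_noZeroDivisors, ← Polynomial.map_mul, hab]
  · rw [natDegree_scaleRoots, ha.natDegree_map]
  · rw [natDegree_scaleRoots, hb.natDegree_map]

/-- the substitution `X ↦ X / d` -/
noncomputable def sgm (n : ℕ) (d : ℚ) (hd : d ≠ 0) : MvPolynomial (Fin n) ℚ ≃ₐ[ℚ] MvPolynomial (Fin n) ℚ :=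
  AlgEquiv.ofAlgHom (MvPolynomial.aeval fun i => MvPolynomial.C d⁻¹ * MvPolynomial.X i)
    (MvPolynomial.aeval fun i => MvPolynomial.C d * MvPolynomial.X i)
    (by
      apply MvPolynomial.algHom_ext
      intro i
      simp only [AlgHom.comp_apply, MvPolynomial.aeval_X, map_mul, MvPolynomial.aeval_C, AlgHom.id_apply,
        MvPolynomial.algebraMap_eq]
      rw [← mul_assoc, ← map_mul, mul_inv_cancel₀ hd, map_one, one_mul])
    (by
      apply MvPolynomial.algHom_ext
      intro i
      simp only [AlgHom.comp_apply, MvPolynomial.aeval_X, map_mul, MvPolynomial.aeval_C, AlgHom.id_apply,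
        MvPolynomial.algebraMap_eq]
      rw [← mul_assoc, ← map_mul, inv_mul_cancel₀ hd, map_one, one_mul])

lemma sgm_X (n : ℕ) (d : ℚ) (hd : d ≠ 0) (i : Fin n) :
    sgm n d hd (MvPolynomial.X i) = MvPolynomial.C d⁻¹ * MvPolynomial.X i := by
  simp [sgm]

lemma sgm_C (n : ℕ) (d : ℚ) (hd : d ≠ 0) (r : ℚ) :
    sgm n d hd (MvPolynomial.C r) = MvPolynomial.C r := by
  simp [sgm, MvPolynomial.algebraMap_eq]

lemma sgm_monomial (n : ℕ) (d : ℚ) (hd : d ≠ 0) (s : Fin n →₀ ℕ) (a : ℚ) :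
    sgm n d hd (MvPolynomial.monomial s a) = MvPolynomial.monomial s (a * d⁻¹ ^ (s.sum fun _ e => e)) := by
  rw [MvPolynomial.monomial_eq, map_mul, sgm_C, Finsupp.prod, map_prod, MvPolynomial.monomial_eq, map_mul, mul_assoc]
  congr 1
  simp only [map_pow, sgm_X, mul_pow, Finset.prod_mul_distrib, Finsupp.sum, Finsupp.prod]
  rw [Finset.prod_pow_eq_pow_sum]

lemma sgm_int (n D : ℕ) (d : ℕ) (hd : (d : ℚ) ≠ 0) (p : MvPolynomial (Fin n) ℤ) (hp : p.totalDegree ≤ D) :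
    ∃ p' : MvPolynomial (Fin n) ℤ, p'.totalDegree ≤ D ∧
      MvPolynomial.map (Int.castRingHom ℚ) p' =
        sgm n d hd (MvPolynomial.map (Int.castRingHom ℚ) p) * MvPolynomial.C ((d : ℚ) ^ D) := by
  have hs : ∀ s ∈ p.support, (s.sum fun _ e => e) ≤ D := fun s hs => (MvPolynomial.le_totalDegree hs).trans hp
  refine ⟨∑ s ∈ p.support, MvPolynomial.monomial s (p.coeff s * (d : ℤ) ^ (D - (s.sum fun _ e => e))), ?_, ?_⟩
  · refine MvPolynomial.totalDegree_finsetSum_le fun s h => ?_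
    exact (MvPolynomial.totalDegree_monomial_le _ _).trans (hs s h)
  · conv_rhs => rw [p.as_sum, map_sum, map_sum, Finset.sum_mul]
    rw [map_sum]
    refine Finset.sum_congr rfl fun s h => ?_
    rw [MvPolynomial.map_monomial, MvPolynomial.map_monomial, sgm_monomial, mul_comm _ (MvPolynomial.C _),
      MvPolynomial.C_mul_monomial]
    congr 1
    have h2 := hs s h
    have h3 : (d : ℚ) ^ D = (d : ℚ) ^ (D - (s.sum fun _ e => e)) * (d : ℚ) ^ (s.sum fun _ e => e) := by
      rw [← pow_add]; congr 1; omega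
    rw [h3, map_mul, map_pow]
    simp only [eq_intCast, Int.cast_natCast, inv_pow]
    field_simp

lemma exists_Rt (n D d : ℕ) (hd : (d : ℚ) ≠ 0) (R : (MvPolynomial (Fin n) ℤ)[X]) (hR : R.Monic)
    (hD : ∀ j, (R.coeff j).totalDegree ≤ D) :
    ∃ Rt : (MvPolynomial (Fin n) ℤ)[X], Rt.Monic ∧ Rt.natDegree = R.natDegree ∧
      (∀ j, (Rt.coeff j).totalDegree ≤ D) ∧
      toQ Rt = ((toQ R).map ((sgm n d hd).toRingEquiv : MvPolynomial (Fin n) ℚ →+* MvPolynomial (Fin n) ℚ)).scaleRoots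
        (MvPolynomial.C ((d : ℚ) ^ D)) := by
  set σ := ((sgm n d hd).toRingEquiv : MvPolynomial (Fin n) ℚ →+* MvPolynomial (Fin n) ℚ) with hσ
  have hRQ : (toQ R).Monic := hR.map _
  set Q := ((toQ R).map σ).scaleRoots (MvPolynomial.C ((d : ℚ) ^ D)) with hQ
  have hQm : Q.Monic := (monic_scaleRoots_iff _).2 (hRQ.map _)
  have hQd : Q.natDegree = R.natDegree := by
    rw [hQ, natDegree_scaleRoots, hRQ.natDegree_map]; exact hR.natDegree_map _
  have hinj : Function.Injective (MvPolynomial.map (σ := Fin n) (Int.castRingHom ℚ)) :=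
    MvPolynomial.map_injective _ (RingHom.injective_int _)
  have hco : ∀ j, ∃ p : MvPolynomial (Fin n) ℤ, p.totalDegree ≤ D ∧ MvPolynomial.map (Int.castRingHom ℚ) p = Q.coeff j := by
    intro j
    rcases lt_trichotomy j R.natDegree with h | h | h
    · obtain ⟨p, hp1, hp2⟩ := sgm_int n D d hd (R.coeff j) (hD j)
      obtain ⟨e, he⟩ : ∃ e, R.natDegree - j = e + 1 := ⟨R.natDegree - j - 1, by omega⟩
      refine ⟨p * MvPolynomial.C (((d : ℤ) ^ D) ^ e), ?_, ?_⟩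
      · refine (MvPolynomial.totalDegree_mul _ _).trans ?_
        rw [MvPolynomial.totalDegree_C]; exact hp1
      · rw [hQ, coeff_scaleRoots, hRQ.natDegree_map]
        have : (toQ R).natDegree = R.natDegree := hR.natDegree_map _
        rw [this, he, map_mul, hp2, coeff_map, toQ, coeff_map, pow_succ', ← mul_assoc]
        congr 1
        simp
    · refine ⟨1, by simp, ?_⟩
      rw [h, ← hQd, hQm.coeff_natDegree, map_one]
    · refine ⟨0, by simp, ?_⟩
      rw [map_zero, coeff_eq_zero_of_natDegree_lt (by omega)]
  have hl : Q ∈ lifts (MvPolynomial.map (σ := Fin n) (Int.castRingHom ℚ)) := by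
    rw [lifts_iff_coeff_lifts]
    intro j
    obtain ⟨p, -, hp⟩ := hco j
    exact ⟨p, hp⟩
  obtain ⟨Rt, h1, h2, h3⟩ := lifts_and_natDegree_eq_and_monic hl hQm
  refine ⟨Rt, h3, h2.trans hQd, fun j => ?_, h1⟩
  obtain ⟨p, hp1, hp2⟩ := hco j
  have : Rt.coeff j = p := by
    apply hinj
    rw [hp2, ← h1, coeff_map]
  rw [this]; exact hp1

end

section
/-- the substitution `X ↦ X / d` in one variable -/
noncomputable def th1 (K : Type*) [Field K] (d : K) (hd : d ≠ 0) : K[X] ≃+* K[X] :=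
  (algEquivOfCompEqX (C d⁻¹ * X) (C d * X)
    (by simp only [mul_comp, C_comp, X_comp]; rw [← mul_assoc, ← C_mul, inv_mul_cancel₀ hd, C_1, one_mul])
    (by simp only [mul_comp, C_comp, X_comp]; rw [← mul_assoc, ← C_mul, mul_inv_cancel₀ hd, C_1, one_mul])).toRingEquiv

lemma th1_C (K : Type*) [Field K] (d : K) (hd : d ≠ 0) (r : K) : th1 K d hd (C r) = C r := by
  simp [th1]

lemma th1_X (K : Type*) [Field K] (d : K) (hd : d ≠ 0) : th1 K d hd X = C d⁻¹ * X := by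
  simp [th1]

/-- evaluation of the parameters at `x / d` -/
noncomputable def phK {m : ℕ} (K : Type*) [Field K] (d : K) (x : Fin m → ℤ) : MvPolynomial (Fin m) ℤ →+* K :=
  MvPolynomial.eval₂Hom (Int.castRingHom K) (fun j => (x j : K) / d)

lemma key_id {m : ℕ} (K : Type*) [Field K] [CharZero K] (i : Fin (m + 1)) (D d : ℕ) (hd : (d : ℚ) ≠ 0) (hdK : (d : K) ≠ 0)
    (R Rt : (MvPolynomial (Fin (m + 1)) ℤ)[X]) (hR : R.Monic)
    (h : toQ Rt = ((toQ R).map ((sgm (m + 1) d hd).toRingEquiv : MvPolynomial (Fin (m + 1)) ℚ →+* MvPolynomial (Fin (m + 1)) ℚ)).scaleRoots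
        (MvPolynomial.C ((d : ℚ) ^ D))) (x : Fin m → ℤ) :
    (spec (Rt.map (ei ℤ i : MvPolynomial (Fin (m + 1)) ℤ →+* (MvPolynomial (Fin m) ℤ)[X])) x).map (mapRingHom (Int.castRingHom K)) =
      (((R.map (ei ℤ i : MvPolynomial (Fin (m + 1)) ℤ →+* (MvPolynomial (Fin m) ℤ)[X])).map
        (mapRingHom (phK K (d : K) x))).map (th1 K (d : K) hdK : K[X] →+* K[X])).scaleRoots (C ((d : K) ^ D)) := by
  set ψ : MvPolynomial (Fin (m + 1)) ℚ →+* K[X] :=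
    MvPolynomial.eval₂Hom (C.comp (Rat.castHom K)) (i.insertNth X (fun j => C (x j : K)) : Fin (m + 1) → K[X]) with hψ
  have h1 : (spec (Rt.map (ei ℤ i : MvPolynomial (Fin (m + 1)) ℤ →+* (MvPolynomial (Fin m) ℤ)[X])) x).map
      (mapRingHom (Int.castRingHom K)) = (toQ Rt).map ψ := by
    rw [spec, toQ, Polynomial.map_map, Polynomial.map_map, Polynomial.map_map]
    congr 1
    apply ei_hom_ext i
    · intro r; simp [ei_C, hψ]
    · simp [ei_X_self, hψ]
    · intro j; simp [ei_X_succAbove, hψ]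
  rw [h1, h]
  have hm : (toQ R).Monic := hR.map _
  rw [map_scaleRoots _ _ _ (by rw [(hm.map _).leadingCoeff, map_one]; exact one_ne_zero)]
  congr 1
  · rw [toQ, Polynomial.map_map, Polynomial.map_map, Polynomial.map_map, Polynomial.map_map]
    congr 1
    apply ei_hom_ext i
    · intro r
      simp only [RingHom.comp_apply, MvPolynomial.map_C, RingHom.coe_coe, ei_C, coe_mapRingHom, Polynomial.map_C, th1_C, phK]
      simp [hψ]
    · simp only [RingHom.comp_apply, MvPolynomial.map_X, RingHom.coe_coe, ei_X_self, coe_mapRingHom, Polynomial.map_X, th1_X, AlgEquiv.toRingEquiv_eq_coe, AlgEquiv.coe_ringEquiv, sgm_X]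
      simp [hψ]
    · intro j
      simp only [RingHom.comp_apply, MvPolynomial.map_X, RingHom.coe_coe, ei_X_succAbove, coe_mapRingHom, Polynomial.map_C, th1_C, phK, AlgEquiv.toRingEquiv_eq_coe, AlgEquiv.coe_ringEquiv, sgm_X]
      simp only [hψ, map_mul, MvPolynomial.coe_eval₂Hom, MvPolynomial.eval₂_C, MvPolynomial.eval₂_X, Fin.insertNth_apply_succAbove, RingHom.comp_apply]
      rw [← C_mul, div_eq_inv_mul]
      simp
  · simp [hψ]

end

section
lemma H3 {m : ℕ} (i : Fin (m + 1)) (D d : ℕ) (hd : (d : ℚ) ≠ 0)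
    (R Rt : (MvPolynomial (Fin (m + 1)) ℤ)[X]) (hirr : Irreducible (toQ R))
    (h : toQ Rt = ((toQ R).map ((sgm (m + 1) d hd).toRingEquiv : MvPolynomial (Fin (m + 1)) ℚ →+* MvPolynomial (Fin (m + 1)) ℚ)).scaleRoots
        (MvPolynomial.C ((d : ℚ) ^ D)))
    (a b : (MvPolynomial (Fin m) ℤ)[X][X]) (ha : a.Monic) (hb : b.Monic)
    (hab : a * b = Rt.map (ei ℤ i : MvPolynomial (Fin (m + 1)) ℤ →+* (MvPolynomial (Fin m) ℤ)[X])) :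
    a.natDegree = 0 ∨ b.natDegree = 0 := by
  set s : (MvPolynomial (Fin m) ℤ)[X] →+* MvPolynomial (Fin (m + 1)) ℤ := ((ei ℤ i).symm : (MvPolynomial (Fin m) ℤ)[X] →+* MvPolynomial (Fin (m + 1)) ℤ) with hs
  have h1 : a.map s * b.map s = Rt := by
    rw [← Polynomial.map_mul, hab, Polynomial.map_map]
    have : s.comp (ei ℤ i : MvPolynomial (Fin (m + 1)) ℤ →+* (MvPolynomial (Fin m) ℤ)[X]) = RingHom.id _ := by
      refine RingHom.ext fun x => ?_
      simp [hs]
    rw [this, Polynomial.map_id]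
  have h2 : toQ (a.map s) * toQ (b.map s) = toQ Rt := by
    rw [← h1]; unfold toQ; rw [Polynomial.map_mul]
  have hu : MvPolynomial.C ((d : ℚ) ^ D) * MvPolynomial.C (((d : ℚ) ^ D)⁻¹) = (1 : MvPolynomial (Fin (m + 1)) ℚ) := by
    rw [← map_mul, mul_inv_cancel₀ (pow_ne_zero _ hd), map_one]
  have hma : (toQ (a.map s)).Monic := (ha.map s).map _
  have hmb : (toQ (b.map s)).Monic := (hb.map s).map _
  obtain ⟨a', b', ha', hb', hab', hda, hdb⟩ := unscale (sgm (m + 1) d hd).toRingEquiv _ _ hu (toQ R) _ _ hma hmb (h2.trans h)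
  have e1 : (toQ (a.map s)).natDegree = a.natDegree := ((ha.map s).natDegree_map _).trans (ha.natDegree_map s)
  have e2 : (toQ (b.map s)).natDegree = b.natDegree := ((hb.map s).natDegree_map _).trans (hb.natDegree_map s)
  rw [e1] at hda
  rw [e2] at hdb
  rcases hirr.isUnit_or_isUnit hab'.symm with hh | hh
  · left; rw [← hda, ha'.eq_one_of_isUnit hh, natDegree_one]
  · right; rw [← hdb, hb'.eq_one_of_isUnit hh, natDegree_one]

lemma H1 {m : ℕ} (i : Fin (m + 1)) (D d : ℕ) (hd : (d : ℚ) ≠ 0)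
    (R Rt : (MvPolynomial (Fin (m + 1)) ℤ)[X]) (hR : R.Monic)
    (h : toQ Rt = ((toQ R).map ((sgm (m + 1) d hd).toRingEquiv : MvPolynomial (Fin (m + 1)) ℚ →+* MvPolynomial (Fin (m + 1)) ℚ)).scaleRoots
        (MvPolynomial.C ((d : ℚ) ^ D))) (hRt : Rt.Monic) (x : Fin m → ℤ) (r : ℤ[X])
    (hr : (spec (Rt.map (ei ℤ i : MvPolynomial (Fin (m + 1)) ℤ →+* (MvPolynomial (Fin m) ℤ)[X])) x).eval r = 0) :
    ∃ q : ℚ[X], ((R.map (ei ℤ i : MvPolynomial (Fin (m + 1)) ℤ →+* (MvPolynomial (Fin m) ℤ)[X])).map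
        (mapRingHom (phK ℚ (d : ℚ) x))).eval q = 0 := by
  have hk := key_id ℚ i D d hd hd R Rt hR h x
  set F := spec (Rt.map (ei ℤ i : MvPolynomial (Fin (m + 1)) ℤ →+* (MvPolynomial (Fin m) ℤ)[X])) x with hF
  have hFm : F.Monic := (hRt.map _).map _
  obtain ⟨c, hc⟩ := dvd_iff_isRoot.2 hr
  have hcm : c.Monic := (monic_X_sub_C r).of_mul_monic_left (by rw [← hc]; exact hFm)
  have hu : C ((d : ℚ) ^ D) * C (((d : ℚ) ^ D)⁻¹) = (1 : ℚ[X]) := by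
    rw [← C_mul, mul_inv_cancel₀ (pow_ne_zero _ hd), C_1]
  have h2 := hk
  rw [hc, Polynomial.map_mul] at h2
  obtain ⟨a', b', ha', hb', hab', hda, hdb⟩ := unscale (th1 ℚ (d : ℚ) hd) _ _ hu _ _ _
    ((monic_X_sub_C r).map (mapRingHom (Int.castRingHom ℚ))) (hcm.map _) h2
  rw [(monic_X_sub_C r).natDegree_map, natDegree_X_sub_C] at hda
  refine ⟨-a'.coeff 0, ?_⟩
  rw [← hab', eval_mul]
  have : a' = X + C (a'.coeff 0) := ha'.eq_X_add_C hda
  rw [this]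
  simp

lemma H2 {m : ℕ} (i : Fin (m + 1)) (D d : ℕ) (hd : (d : ℚ) ≠ 0)
    (R Rt : (MvPolynomial (Fin (m + 1)) ℤ)[X]) (hR : R.Monic) (hRD : ∀ j, (R.coeff j).totalDegree ≤ D)
    (h : toQ Rt = ((toQ R).map ((sgm (m + 1) d hd).toRingEquiv : MvPolynomial (Fin (m + 1)) ℚ →+* MvPolynomial (Fin (m + 1)) ℚ)).scaleRoots
        (MvPolynomial.C ((d : ℚ) ^ D)))
    (L : Type) [Field L] [IsAlgClosed L] (j : MvPolynomial (Fin m) ℤ →+* L) (hj : Function.Injective j)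
    (a b : L[X][X]) (ha : a.Monic) (hb : b.Monic)
    (hab : a * b = (R.map (ei ℤ i : MvPolynomial (Fin (m + 1)) ℤ →+* (MvPolynomial (Fin m) ℤ)[X])).map (mapRingHom j))
    (ha1 : 1 ≤ a.natDegree) (hb1 : 1 ≤ b.natDegree) (x : Fin m → ℤ) :
    ∃ a b : (AlgebraicClosure ℚ)[X][X], a.Monic ∧ b.Monic ∧
      a * b = (spec (Rt.map (ei ℤ i : MvPolynomial (Fin (m + 1)) ℤ →+* (MvPolynomial (Fin m) ℤ)[X])) x).map
        (mapRingHom (Int.castRingHom (AlgebraicClosure ℚ))) ∧ 1 ≤ a.natDegree ∧ 1 ≤ b.natDegree := by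
  have hdK : (d : AlgebraicClosure ℚ) ≠ 0 := by
    have : d ≠ 0 := by rintro rfl; simp at hd
    exact_mod_cast this
  have hk := key_id (AlgebraicClosure ℚ) i D d hd hdK R Rt hR h x
  obtain ⟨a', b', ha', hb', hab', hda, hdb⟩ := transfer_factor D
    (R.map (ei ℤ i : MvPolynomial (Fin (m + 1)) ℤ →+* (MvPolynomial (Fin m) ℤ)[X])) (hR.map _)
    (fun k => by rw [coeff_map]; exact (ei_natDegree i _).trans (hRD k)) j hj a b ha hb hab
    (phK (AlgebraicClosure ℚ) (d : AlgebraicClosure ℚ) x)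
  obtain ⟨a2, b2, ha2, hb2, hab2, hda2, hdb2⟩ := rescale (th1 (AlgebraicClosure ℚ) (d : AlgebraicClosure ℚ) hdK)
    (C ((d : AlgebraicClosure ℚ) ^ D)) _ a' b' ha' hb' hab'
  exact ⟨a2, b2, ha2, hb2, hab2.trans hk.symm, by omega, by omega⟩

lemma H5 {m : ℕ} (i : Fin (m + 1)) (D d : ℕ) (hd : (d : ℚ) ≠ 0)
    (R Rt : (MvPolynomial (Fin (m + 1)) ℤ)[X])
    (h : toQ Rt = ((toQ R).map ((sgm (m + 1) d hd).toRingEquiv : MvPolynomial (Fin (m + 1)) ℚ →+* MvPolynomial (Fin (m + 1)) ℚ)).scaleRoots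
        (MvPolynomial.C ((d : ℚ) ^ D))) (z : Fin (m + 1) → ℤ) (y : ℤ)
    (hy : Polynomial.eval (y : ℚ) ((toQ R).map (MvPolynomial.eval fun i => (z i : ℚ) / (d : ℚ))) = 0) :
    (spec (Rt.map (ei ℤ i : MvPolynomial (Fin (m + 1)) ℤ →+* (MvPolynomial (Fin m) ℤ)[X]))
      (fun j => z (i.succAbove j))).evalEval (z i) ((d : ℤ) ^ D * y) = 0 := by
  have e1 : (spec (Rt.map (ei ℤ i : MvPolynomial (Fin (m + 1)) ℤ →+* (MvPolynomial (Fin m) ℤ)[X]))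
      (fun j => z (i.succAbove j))).map (evalRingHom (z i)) = Rt.map (MvPolynomial.eval z) := by
    rw [spec, Polynomial.map_map, Polynomial.map_map]
    congr 1
    apply ei_hom_ext i
    · intro r; simp [ei_C]
    · simp [ei_X_self]
    · intro j; simp [ei_X_succAbove]
  have e2 : (Rt.map (MvPolynomial.eval z)).map (Int.castRingHom ℚ) = (toQ Rt).map (MvPolynomial.eval fun i => (z i : ℚ)) := by
    rw [toQ, Polynomial.map_map, Polynomial.map_map]
    congr 1
    apply MvPolynomial.ringHom_ext
    · intro r; simp
    · intro r; simp
  have e3 : ((toQ R).map ((sgm (m + 1) d hd).toRingEquiv : MvPolynomial (Fin (m + 1)) ℚ →+* MvPolynomial (Fin (m + 1)) ℚ)).map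
      (MvPolynomial.eval fun i => (z i : ℚ)) = (toQ R).map (MvPolynomial.eval fun i => (z i : ℚ) / (d : ℚ)) := by
    rw [Polynomial.map_map]
    congr 1
    apply MvPolynomial.ringHom_ext
    · intro r; simp [sgm_C]
    · intro r; simp [sgm_X, div_eq_inv_mul]
  rw [← map_evalRingHom_eval, e1]
  have e4 := Polynomial.eval_intCast_map (Int.castRingHom ℚ) (Rt.map (MvPolynomial.eval z)) ((d : ℤ) ^ D * y)
  rw [e2, h] at e4
  have e5 : Polynomial.eval (((d : ℤ) ^ D * y : ℤ) : ℚ) ((((toQ R).map ((sgm (m + 1) d hd).toRingEquiv : MvPolynomial (Fin (m + 1)) ℚ →+* MvPolynomial (Fin (m + 1)) ℚ)).scaleRoots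
        (MvPolynomial.C ((d : ℚ) ^ D))).map (MvPolynomial.eval fun i => (z i : ℚ))) = 0 := by
    rw [eval_map]
    have := scaleRoots_eval₂_eq_zero (MvPolynomial.eval fun i => (z i : ℚ)) (r := (y : ℚ))
      (s := MvPolynomial.C ((d : ℚ) ^ D)) (p := (toQ R).map ((sgm (m + 1) d hd).toRingEquiv : MvPolynomial (Fin (m + 1)) ℚ →+* MvPolynomial (Fin (m + 1)) ℚ))
      (by rw [← eval_map, e3, hy])
    rw [MvPolynomial.eval_C] at this
    push_cast
    exact this
  rw [e5, Int.cast_id] at e4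
  have : Function.Injective (Int.castRingHom ℚ) := RingHom.injective_int _
  apply this
  rw [map_zero, ← e4]

lemma mv_bound {n : ℕ} (D b : ℕ) (hb : 1 ≤ b) (p : MvPolynomial (Fin n) ℤ) (hp : p.totalDegree ≤ D) (w : Fin n → ℚ)
    (hw : ∀ i, |w i| ≤ b) :
    |MvPolynomial.eval w (MvPolynomial.map (Int.castRingHom ℚ) p)| ≤ (((D + 1) ^ n * mvNorm p * b ^ D : ℕ) : ℚ) := by
  have hb' : (1 : ℚ) ≤ b := by exact_mod_cast hb
  have hcard : p.support.card ≤ (D + 1) ^ n := by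
    have : p.support.card ≤ (Fintype.piFinset fun _ : Fin n => Finset.range (D + 1)).card := by
      apply Finset.card_le_card_of_injOn (fun (s : Fin n →₀ ℕ) => (s : Fin n → ℕ))
      · intro s hs
        rw [Finset.mem_coe, Fintype.mem_piFinset]
        intro i
        rw [Finset.mem_range]
        have h1 : s i ≤ p.degreeOf i := MvPolynomial.monomial_le_degreeOf i hs
        have h2 := MvPolynomial.degreeOf_le_totalDegree p i
        exact Nat.lt_succ_of_le (h1.trans (h2.trans hp))
      · intro s _ t _ h
        exact DFunLike.coe_injective h
    refine this.trans ?_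
    rw [Fintype.card_piFinset]
    simp
  rw [MvPolynomial.eval_map, MvPolynomial.eval₂_eq]
  refine (Finset.abs_sum_le_sum_abs _ _).trans ?_
  have hterm : ∀ s ∈ p.support, |(Int.castRingHom ℚ) (p.coeff s) * ∏ i ∈ s.support, w i ^ s i| ≤ (mvNorm p : ℚ) * (b : ℚ) ^ D := by
    intro s hs
    rw [abs_mul]
    have h1 : |(Int.castRingHom ℚ) (p.coeff s)| ≤ (mvNorm p : ℚ) := by
      have : (p.coeff s).natAbs ≤ mvNorm p := Finset.le_sup (f := fun m => (p.coeff m).natAbs) hs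
      rw [eq_intCast, ← Int.cast_abs, Int.abs_eq_natAbs]
      exact_mod_cast this
    have h2 : |∏ i ∈ s.support, w i ^ s i| ≤ (b : ℚ) ^ D := by
      rw [Finset.abs_prod]
      calc ∏ i ∈ s.support, |w i ^ s i| ≤ ∏ i ∈ s.support, (b : ℚ) ^ s i := by
            apply Finset.prod_le_prod
            · intro i _; exact abs_nonneg _
            · intro i _; rw [abs_pow]; exact pow_le_pow_left₀ (abs_nonneg _) (hw i) _
        _ = (b : ℚ) ^ (∑ i ∈ s.support, s i) := Finset.prod_pow_eq_pow_sum _ _ _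
        _ ≤ (b : ℚ) ^ D := pow_le_pow_right₀ hb' ((MvPolynomial.le_totalDegree hs).trans hp)
    exact mul_le_mul h1 h2 (abs_nonneg _) (Nat.cast_nonneg _)
  refine (Finset.sum_le_card_nsmul _ _ _ hterm).trans ?_
  rw [nsmul_eq_mul]
  push_cast
  rw [mul_assoc]
  apply mul_le_mul_of_nonneg_right _ (by positivity)
  exact_mod_cast hcard

lemma H6 {n : ℕ} (D d b : ℕ) (hb : 1 ≤ b) (hd1 : 1 ≤ d) (hd : (d : ℚ) ≠ 0)
    (R Rt : (MvPolynomial (Fin n) ℤ)[X]) (hR : R.Monic) (hk : R.natDegree ≤ D) (hRD : ∀ j, (R.coeff j).totalDegree ≤ D)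
    (h : toQ Rt = ((toQ R).map ((sgm n d hd).toRingEquiv : MvPolynomial (Fin n) ℚ →+* MvPolynomial (Fin n) ℚ)).scaleRoots
        (MvPolynomial.C ((d : ℚ) ^ D))) (z : Fin n → ℤ) (hz : ∀ i, |z i| ≤ ((d * b : ℕ) : ℤ)) (j : ℕ) :
    |MvPolynomial.eval z (Rt.coeff j)| ≤ (((D + 1) ^ n * polyNorm R * b ^ D * d ^ (D * D) : ℕ) : ℤ) := by
  have hm : (toQ R).Monic := hR.map _
  have e0 : (toQ R).natDegree = R.natDegree := hR.natDegree_map _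
  have e1 : ((MvPolynomial.eval z (Rt.coeff j) : ℤ) : ℚ) = MvPolynomial.eval (fun i => (z i : ℚ)) ((toQ Rt).coeff j) := by
    rw [toQ, coeff_map, MvPolynomial.eval_map, ← eq_intCast (Int.castRingHom ℚ), MvPolynomial.eval, MvPolynomial.coe_eval₂Hom,
      MvPolynomial.hom_eval₂]
    rfl
  have e3 : (MvPolynomial.eval fun i => (z i : ℚ)).comp ((sgm n d hd).toRingEquiv : MvPolynomial (Fin n) ℚ →+* MvPolynomial (Fin n) ℚ)
       = (MvPolynomial.eval fun i => (z i : ℚ) / (d : ℚ)) := by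
    apply MvPolynomial.ringHom_ext
    · intro r; simp [sgm_C]
    · intro r; simp [sgm_X, div_eq_inv_mul]
  have e2 : ((MvPolynomial.eval z (Rt.coeff j) : ℤ) : ℚ) =
      MvPolynomial.eval (fun i => (z i : ℚ) / (d : ℚ)) (MvPolynomial.map (Int.castRingHom ℚ) (R.coeff j)) * ((d : ℚ) ^ D) ^ (R.natDegree - j) := by
    rw [e1, h, coeff_scaleRoots, hm.natDegree_map, e0, map_mul, coeff_map, ← e3, toQ, coeff_map, map_pow, MvPolynomial.eval_C]
    rfl
  have hdpos : (0 : ℚ) < d := by exact_mod_cast hd1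
  have h1 := mv_bound D b hb (R.coeff j) (hRD j) (fun i => (z i : ℚ) / (d : ℚ)) (by
    intro i
    rw [abs_div, abs_of_pos hdpos, div_le_iff₀ hdpos]
    have := hz i
    have h2 : ((|z i| : ℤ) : ℚ) ≤ (((d * b : ℕ) : ℤ) : ℚ) := by exact_mod_cast this
    push_cast at h2
    linarith [mul_comm (d : ℚ) b])
  have h2 : mvNorm (R.coeff j) ≤ polyNorm R := by
    by_cases hj : j ∈ R.support
    · exact Finset.le_sup (f := fun k => mvNorm (R.coeff k)) hj
    · rw [notMem_support_iff.1 hj]; simp [mvNorm]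
  have h3 : ((d : ℚ) ^ D) ^ (R.natDegree - j) ≤ (d : ℚ) ^ (D * D) := by
    rw [← pow_mul]
    apply pow_le_pow_right₀ (by exact_mod_cast hd1)
    exact Nat.mul_le_mul_left _ (by omega)
  have h4 : ((|MvPolynomial.eval z (Rt.coeff j)| : ℤ) : ℚ) ≤ ((((D + 1) ^ n * polyNorm R * b ^ D * d ^ (D * D) : ℕ) : ℤ) : ℚ) := by
    rw [Int.cast_abs, e2, abs_mul, abs_of_nonneg (show (0 : ℚ) ≤ ((d : ℚ) ^ D) ^ (R.natDegree - j) by positivity)]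
    have h5 : (((D + 1) ^ n * mvNorm (R.coeff j) * b ^ D : ℕ) : ℚ) ≤ (((D + 1) ^ n * polyNorm R * b ^ D : ℕ) : ℚ) := by
      exact_mod_cast Nat.mul_le_mul_right _ (Nat.mul_le_mul_left _ h2)
    calc _ ≤ (((D + 1) ^ n * polyNorm R * b ^ D : ℕ) : ℚ) * (d : ℚ) ^ (D * D) :=
          mul_le_mul (h1.trans h5) h3 (by positivity) (by positivity)
      _ = _ := by push_cast; ring
  exact_mod_cast h4

end

section
theorem core_bound (m D : ℕ) : ∃ C : ℝ, 0 < C ∧ ∃ K : ℕ, 1 ≤ K ∧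
    ∀ R : (MvPolynomial (Fin (m + 1)) ℤ)[X], R.Monic → IsGenuinePoly R → ¬ IsStronglyGenuinePoly R →
    R.natDegree ≤ D → (∀ j, (R.coeff j).totalDegree ≤ D) →
    ∀ d b N T : ℕ, 1 ≤ d → 1 ≤ b → 1 ≤ N → D ≤ N → N ≤ d * b → N + 2 ≤ T →
    K * ((D + 1) ^ (m + 1) * polyNorm R * b ^ D * d ^ (D * D)) ≤ T →
    ∀ S : Finset (Fin (m + 1) → ℤ),
    (∀ z ∈ S, (∀ i, |z i| ≤ N) ∧ ∃ y : ℤ, Polynomial.eval (y : ℚ)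
      ((toQ R).map (MvPolynomial.eval fun i => (z i : ℚ) / (d : ℚ))) = 0) →
    (S.card : ℝ) ≤ C * ((N : ℝ) ^ m * Real.log T ^ 8) := by
  classical
  obtain ⟨E, hE⟩ := root_poly D m
  obtain ⟨K, hK1, hK⟩ := lagrange_bound D
  obtain ⟨C, hC, hA⟩ := assemble m D (E * 3 ^ m)
  refine ⟨C, hC, K, hK1, ?_⟩
  intro R hR hg hns hk hRD d b N T hd1 hb hN1 hDN hNdb hNT hMT S hS
  have hd : (d : ℚ) ≠ 0 := by
    have : d ≠ 0 := by omega
    exact_mod_cast this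
  obtain ⟨i, L, instL, instA, j, hj, ⟨a, b', ha, hb', hab, ha1, hb1⟩, hnr⟩ := D_main R hR hg hns
  obtain ⟨Rt, hRt, hRtk, hRtD, hRtQ⟩ := exists_Rt (m + 1) D d hd R hR hRD
  set eI : MvPolynomial (Fin (m + 1)) ℤ →+* (MvPolynomial (Fin m) ℤ)[X] :=
    (ei ℤ i : MvPolynomial (Fin (m + 1)) ℤ →+* (MvPolynomial (Fin m) ℤ)[X]) with heI
  set M := (D + 1) ^ (m + 1) * polyNorm R * b ^ D * d ^ (D * D) with hM
  have hMT1 : M ≤ T := (Nat.le_mul_of_pos_left M hK1).trans hMT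
  have hk1 : 1 ≤ R.natDegree := by
    have h1 : ((R.map eI).map (mapRingHom j)).natDegree = R.natDegree := by
      rw [(hR.map eI).natDegree_map, hR.natDegree_map]
    rw [← hab, ha.natDegree_mul hb'] at h1
    omega
  obtain ⟨g, hg0, hgE, hgr⟩ := hE (R.map eI) (hR.map _) (by rw [hR.natDegree_map]; exact hk1)
    (by rw [hR.natDegree_map]; exact hk)
    (fun k => by rw [coeff_map]; exact (ei_natDegree i _).trans (hRD k))
    (fun k a => by rw [coeff_map]; exact (ei_coeff_totalDegree i _ a).trans (hRD k)) L instL instA j hnr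
  have hsz : ∀ k, ∀ x : Fin m → ℤ, ∀ x0 : ℤ, (∀ i, |x i| ≤ N) → |x0| ≤ N →
      |((spec (Rt.map eI) x).coeff k).eval x0| ≤ (M : ℤ) := by
    intro k x x0 hx hx0
    rw [spec, coeff_map, coeff_map]
    have e := ei_eval i x0 x (Rt.coeff k)
    have e' : ((mapRingHom (MvPolynomial.eval x)) (eI (Rt.coeff k))).eval x0 =
      MvPolynomial.eval (i.insertNth x0 x : Fin (m + 1) → ℤ) (Rt.coeff k) := e.symm
    rw [e']
    refine H6 D d b hb hd1 hd R Rt hR hk hRD hRtQ _ ?_ k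
    intro l
    have hN' : (N : ℤ) ≤ ((d * b : ℕ) : ℤ) := by exact_mod_cast hNdb
    rcases Fin.eq_self_or_eq_succAbove i l with rfl | ⟨l', rfl⟩
    · rw [Fin.insertNth_apply_same]; exact hx0.trans hN'
    · rw [Fin.insertNth_apply_succAbove]; exact (hx l').trans hN'
  have hMTZ : (M : ℤ) ≤ T := by exact_mod_cast hMT1
  have hKMT : ((K * M : ℕ) : ℤ) ≤ T := by exact_mod_cast hMT
  set re : (Fin (m + 1) → ℤ) → (Fin (m + 1) → ℤ) := fun z => Fin.cons (z i) (fun j => z (i.succAbove j)) with hre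
  have hinj : Function.Injective re := by
    intro z w h
    have h0 := congrFun h 0
    have hs := fun j : Fin m => congrFun h j.succ
    simp only [hre, Fin.cons_zero, Fin.cons_succ] at h0 hs
    funext l
    rcases Fin.eq_self_or_eq_succAbove i l with rfl | ⟨l', rfl⟩
    · exact h0
    · exact hs l'
  have hfin := hA N T hN1 hNT (Rt.map eI) (hRt.map _) (by rw [hRt.natDegree_map, hRtk]; exact hk)
    (fun k => by rw [coeff_map]; exact (ei_natDegree i _).trans (hRtD k))
    (fun k a => by rw [coeff_map]; exact (ei_coeff_totalDegree i _ a).trans (hRtD k))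
    (fun k a x hx => by
      have h1 := hK ((spec (Rt.map eI) x).coeff k)
        (spec_coeff_natDegree D _ (fun k => by rw [coeff_map]; exact (ei_natDegree i _).trans (hRtD k)) x k) M
        (fun l hl => hsz k x l hx (by rw [abs_of_nonneg (Int.natCast_nonneg l)]; exact_mod_cast hl.trans hDN)) a
      have h2 : ((spec (Rt.map eI) x).coeff k).coeff a = MvPolynomial.eval x (((Rt.map eI).coeff k).coeff a) := by
        rw [spec, coeff_map, coe_mapRingHom, coeff_map]
      rw [← h2]
      exact h1.trans hKMT)
    (fun k x x0 hx hx0 => (hsz k x x0 hx hx0).trans hMTZ)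
    (fun a b ha hb hab => H3 i D d hd R Rt (toQ_irreducible R hR hg.1) hRtQ a b ha hb hab)
    (fun Q hQ => by
      have h1 := sz_real (fun z : ℤ => (z : ℚ) / (d : ℚ)) (by
          intro u v huv
          simp only at huv
          rw [div_left_inj' hd] at huv
          exact_mod_cast huv) m E N hN1 (MvPolynomial.map (Int.castRingHom ℚ) g)
          (by
            intro h0
            apply hg0
            apply MvPolynomial.map_injective (Int.castRingHom ℚ) (RingHom.injective_int _)
            rw [h0, map_zero])
          ((Finset.sup_mono (MvPolynomial.support_map_subset _ _)).trans hgE) Q (by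
            intro x hx
            obtain ⟨hx1, r, hr⟩ := hQ x hx
            refine ⟨hx1, ?_⟩
            obtain ⟨q, hq⟩ := H1 i D d hd R Rt hR hRtQ hRt x r hr
            have h2 := hgr (phK ℚ (d : ℚ) x) q hq
            rw [MvPolynomial.eval_map]
            exact h2)
      push_cast
      exact h1)
    (fun x => H2 i D d hd R Rt hR hRD hRtQ L j hj a b' ha hb' hab ha1 hb1 x)
    (S.image re) (by
      intro x hx
      obtain ⟨z, hz, rfl⟩ := Finset.mem_image.1 hx
      obtain ⟨hz1, y, hy⟩ := hS z hz
      refine ⟨?_, (d : ℤ) ^ D * y, ?_⟩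
      · intro l
        refine Fin.cases ?_ (fun l => ?_) l
        · simp only [hre, Fin.cons_zero]; exact hz1 i
        · simp only [hre, Fin.cons_succ]; exact hz1 _
      · have := H5 i D d hd R Rt hRtQ z y hy
        simp only [hre, Fin.tail_cons, Fin.cons_zero]
        exact this)
  rw [Finset.card_image_of_injective _ hinj] at hfin
  exact hfin

end

section
lemma one_le_log_real (t : ℝ) (h : 3 ≤ t) : 1 ≤ Real.log t := by
  have h1 := one_le_log 3 le_rfl
  push_cast at h1
  exact h1.trans (Real.log_le_log (by norm_num) h)

lemma one_le_polyNorm {n : ℕ} (R : (MvPolynomial (Fin n) ℤ)[X]) (hR : R.Monic) : 1 ≤ polyNorm R := by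
  have h1 : R.natDegree ∈ R.support := by
    rw [mem_support_iff, hR.coeff_natDegree]; exact one_ne_zero
  have h2 : mvNorm (R.coeff R.natDegree) ≤ polyNorm R := Finset.le_sup (f := fun k => mvNorm (R.coeff k)) h1
  refine le_trans ?_ h2
  rw [hR.coeff_natDegree]
  have h3 : (0 : Fin n →₀ ℕ) ∈ (1 : MvPolynomial (Fin n) ℤ).support := by
    rw [MvPolynomial.mem_support_iff]; simp
  refine le_trans ?_ (Finset.le_sup (f := fun s => ((1 : MvPolynomial (Fin n) ℤ).coeff s).natAbs) h3)
  simp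

lemma totalDeg_bounds {n : ℕ} (R : (MvPolynomial (Fin n) ℤ)[X]) (hR : R.Monic) :
    R.natDegree ≤ totalDeg R ∧ ∀ j, (R.coeff j).totalDegree ≤ totalDeg R := by
  have key : ∀ j ∈ R.support, j + (R.coeff j).totalDegree ≤ totalDeg R := fun j hj =>
    Finset.le_sup (f := fun k => k + (R.coeff k).totalDegree) hj
  constructor
  · have h1 : R.natDegree ∈ R.support := by
      rw [mem_support_iff, hR.coeff_natDegree]; exact one_ne_zero
    have := key _ h1
    omega
  · intro j
    by_cases hj : j ∈ R.support
    · have := key j hj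
      omega
    · rw [notMem_support_iff.1 hj]; simp

lemma logT_bound (K1 q P d b : ℕ) (B : ℝ) (hK : 1 ≤ K1) (hP : 1 ≤ P) (hd : 1 ≤ d) (hB : 1 ≤ B) (hb : (b : ℝ) ≤ B + 1) :
    Real.log ((K1 * (P + 2) * (d * (b + 2)) ^ q : ℕ) : ℝ) ≤
      (Real.log K1 + 1 + 2 * q) * (Real.log ((P : ℝ) + 2) * Real.log ((d : ℝ) * (B + 2))) := by
  have hP' : (1 : ℝ) ≤ P := by exact_mod_cast hP
  have hd' : (1 : ℝ) ≤ d := by exact_mod_cast hd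
  have hK' : (1 : ℝ) ≤ K1 := by exact_mod_cast hK
  have hdB : 3 ≤ (d : ℝ) * (B + 2) := by nlinarith
  have l1 := one_le_log_real ((P : ℝ) + 2) (by linarith)
  have l2 := one_le_log_real ((d : ℝ) * (B + 2)) hdB
  have hpos : 0 < (d : ℝ) * (b + 2) := by positivity
  have h1 : Real.log ((d : ℝ) * (b + 2)) ≤ 2 * Real.log ((d : ℝ) * (B + 2)) := by
    have : Real.log ((d : ℝ) * (b + 2)) ≤ Real.log (((d : ℝ) * (B + 2)) ^ 2) := by
      apply Real.log_le_log hpos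
      nlinarith
    rwa [Real.log_pow] at this
  push_cast
  rw [Real.log_mul (by positivity) (by positivity), Real.log_mul (by positivity) (by positivity), Real.log_pow]
  have lK : 0 ≤ Real.log K1 := Real.log_nonneg hK'
  set x := Real.log ((P : ℝ) + 2)
  set y := Real.log ((d : ℝ) * (B + 2))
  have hq : (0 : ℝ) ≤ q := Nat.cast_nonneg _
  have h2 : (q : ℝ) * Real.log ((d : ℝ) * (b + 2)) ≤ q * (2 * y) := mul_le_mul_of_nonneg_left h1 hq
  have hxy : x ≤ x * y := by nlinarith
  have hyx : y ≤ x * y := by nlinarith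
  have h1xy : 1 ≤ x * y := by nlinarith
  nlinarith [mul_le_mul_of_nonneg_left hyx hq, mul_le_mul_of_nonneg_left h1xy lK]

set_option maxHeartbeats 2000000 in
theorem main12 (n : ℕ) (hn : 2 ≤ n) :
    ∃ e : ℕ, 1 ≤ e ∧ ∀ D : ℕ, ∃ C : ℝ, 0 < C ∧
      ∀ R : Polynomial (MvPolynomial (Fin n) ℤ),
        R.Monic → IsGenuinePoly R → ¬ IsStronglyGenuinePoly R → totalDeg R = D →
        ∀ d : ℕ, 1 ≤ d → ∀ B : ℝ, 1 ≤ B →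
          (Set.ncard {z : Fin n → ℤ | (∀ i, |(z i : ℝ)| ≤ d * B) ∧
              ∃ y : ℤ, Polynomial.eval (y : ℚ)
                ((toQ R).map (MvPolynomial.eval fun i => (z i : ℚ) / (d : ℚ))) = 0} : ℝ) ≤
            C * Real.log ((polyNorm R : ℝ) + 2) ^ e * ((d : ℝ) * B) ^ (n - 1) *
              Real.log ((d : ℝ) * (B + 2)) ^ (2 * e) := by
  classical
  obtain ⟨m, rfl⟩ : ∃ m, n = m + 1 := ⟨n - 1, by omega⟩
  refine ⟨8, by norm_num, fun D => ?_⟩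
  obtain ⟨C, hC, K, hK1, hcore⟩ := core_bound m D
  set K1 := K * (D + 1) ^ (m + 1) with hK1def
  have hK1' : 1 ≤ K1 := Nat.one_le_iff_ne_zero.2 (by positivity)
  set q := D + D * D + 1 with hq
  set c : ℝ := Real.log K1 + 1 + 2 * q with hc
  have hc0 : 0 < c := by
    have : 0 ≤ Real.log K1 := Real.log_nonneg (by exact_mod_cast hK1')
    positivity
  refine ⟨C * c ^ 8 + 3 ^ (m + 1) * D, by positivity, ?_⟩
  intro R hR hg hns hD d hd B hB
  obtain ⟨hk, hRD⟩ := totalDeg_bounds R hR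
  rw [hD] at hk hRD
  have hP := one_le_polyNorm R hR
  have hd' : (1 : ℝ) ≤ d := by exact_mod_cast hd
  set N := ⌊(d : ℝ) * B⌋₊ with hN
  set b := ⌈B⌉₊ with hb
  have hdB1 : 1 ≤ (d : ℝ) * B := by nlinarith
  have hN1 : 1 ≤ N := Nat.le_floor (by simpa using hdB1)
  have hNle : (N : ℝ) ≤ d * B := Nat.floor_le (by linarith)
  have hb1 : 1 ≤ b := Nat.one_le_ceil_iff.2 (by linarith)
  have hBb : B ≤ b := Nat.le_ceil B
  have hbB : (b : ℝ) ≤ B + 1 := (Nat.ceil_lt_add_one (by linarith)).le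
  have hNdb : N ≤ d * b := by
    have : (N : ℝ) ≤ d * b := hNle.trans (mul_le_mul_of_nonneg_left hBb (by linarith))
    exact_mod_cast this
  set S : Finset (Fin (m + 1) → ℤ) := (Fintype.piFinset (fun _ : Fin (m + 1) => Finset.Icc (-(N : ℤ)) N)).filter
    (fun z => ∃ y : ℤ, Polynomial.eval (y : ℚ)
      ((toQ R).map (MvPolynomial.eval fun i => (z i : ℚ) / (d : ℚ))) = 0) with hS
  have hSmem : ∀ z ∈ S, (∀ i, |z i| ≤ N) ∧ ∃ y : ℤ, Polynomial.eval (y : ℚ)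
      ((toQ R).map (MvPolynomial.eval fun i => (z i : ℚ) / (d : ℚ))) = 0 := by
    intro z hz
    rw [hS, Finset.mem_filter, box_mem] at hz
    exact hz
  have hset : {z : Fin (m + 1) → ℤ | (∀ i, |(z i : ℝ)| ≤ d * B) ∧
              ∃ y : ℤ, Polynomial.eval (y : ℚ)
                ((toQ R).map (MvPolynomial.eval fun i => (z i : ℚ) / (d : ℚ))) = 0} ⊆ (S : Set (Fin (m + 1) → ℤ)) := by
    rintro z ⟨hz1, hz2⟩
    rw [Finset.mem_coe, hS, Finset.mem_filter, box_mem]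
    refine ⟨fun i => ?_, hz2⟩
    have h1 := hz1 i
    have h2 : ((z i).natAbs : ℝ) ≤ d * B := by
      rw [Nat.cast_natAbs, Int.cast_abs]; exact h1
    have h3 : (z i).natAbs ≤ N := Nat.le_floor h2
    rw [Int.abs_eq_natAbs]
    exact_mod_cast h3
  have hncard := Set.ncard_le_ncard hset S.finite_toSet
  rw [Set.ncard_coe_finset] at hncard
  have hle : ((Set.ncard {z : Fin (m + 1) → ℤ | (∀ i, |(z i : ℝ)| ≤ d * B) ∧
              ∃ y : ℤ, Polynomial.eval (y : ℚ)
                ((toQ R).map (MvPolynomial.eval fun i => (z i : ℚ) / (d : ℚ))) = 0} : ℕ) : ℝ) ≤ S.card := by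
    exact_mod_cast hncard
  refine hle.trans ?_
  have hP' : (1 : ℝ) ≤ polyNorm R := by exact_mod_cast hP
  have l1 := one_le_log_real ((polyNorm R : ℝ) + 2) (by linarith)
  have l2 := one_le_log_real ((d : ℝ) * (B + 2)) (by nlinarith)
  have hlog : ∀ T : ℕ, T = K1 * (polyNorm R + 2) * (d * (b + 2)) ^ q → Real.log T ≤
      c * (Real.log ((polyNorm R : ℝ) + 2) * Real.log ((d : ℝ) * (B + 2))) := by
    rintro T rfl
    exact logT_bound K1 q (polyNorm R) d b B hK1' hP hd hB hbB
  set x := Real.log ((polyNorm R : ℝ) + 2)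
  set y := Real.log ((d : ℝ) * (B + 2))
  have hNm : (N : ℝ) ^ m ≤ ((d : ℝ) * B) ^ m := pow_le_pow_left₀ (Nat.cast_nonneg _) hNle _
  have hx8 : 1 ≤ x ^ 8 := one_le_pow₀ l1
  have hy8 : 1 ≤ y ^ 8 := one_le_pow₀ l2
  have hy16 : y ^ 8 ≤ y ^ 16 := pow_le_pow_right₀ l2 (by norm_num)
  have hmain : (S.card : ℝ) ≤ (C * c ^ 8 + 3 ^ (m + 1) * D) * ((N : ℝ) ^ m * (x * y) ^ 8) := by
    rcases lt_or_ge N D with hlt | hge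
    · have h1 : (S.card : ℝ) ≤ 3 ^ (m + 1) * (N : ℝ) ^ (m + 1) := by
        refine le_trans ?_ (box_card_le (m + 1) N hN1)
        rw [← box_card (m + 1) N]
        exact_mod_cast Finset.card_filter_le _ _
      have h2 : (N : ℝ) ≤ D := by exact_mod_cast hlt.le
      have h3 : (1 : ℝ) ≤ (x * y) ^ 8 := one_le_pow₀ (by nlinarith)
      calc (S.card : ℝ) ≤ 3 ^ (m + 1) * (N : ℝ) ^ (m + 1) := h1
        _ = 3 ^ (m + 1) * N * ((N : ℝ) ^ m * 1) := by ring
        _ ≤ (C * c ^ 8 + 3 ^ (m + 1) * D) * ((N : ℝ) ^ m * (x * y) ^ 8) := by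
          apply mul_le_mul
          · have : (3 : ℝ) ^ (m + 1) * N ≤ 3 ^ (m + 1) * D := mul_le_mul_of_nonneg_left h2 (by positivity)
            have h4 : 0 ≤ C * c ^ 8 := by positivity
            linarith
          · exact mul_le_mul_of_nonneg_left h3 (by positivity)
          · positivity
          · positivity
    · set T := K1 * (polyNorm R + 2) * (d * (b + 2)) ^ q with hT
      have hbig : 1 ≤ d * (b + 2) := Nat.one_le_iff_ne_zero.2 (by positivity)
      have hNT : N + 2 ≤ T := by
        have h1 : N + 2 ≤ d * (b + 2) := by nlinarith
        have h2 : d * (b + 2) ≤ (d * (b + 2)) ^ q := Nat.le_self_pow (by omega) _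
        have h3 : (d * (b + 2)) ^ q ≤ T := Nat.le_mul_of_pos_left _ (by positivity)
        omega
      have hMT : K * ((D + 1) ^ (m + 1) * polyNorm R * b ^ D * d ^ (D * D)) ≤ T := by
        have h1 : b ^ D ≤ (d * (b + 2)) ^ D := Nat.pow_le_pow_left (by nlinarith) _
        have h2 : d ^ (D * D) ≤ (d * (b + 2)) ^ (D * D) := Nat.pow_le_pow_left (by nlinarith) _
        calc _ = K1 * polyNorm R * (b ^ D * d ^ (D * D)) := by rw [hK1def]; ring
          _ ≤ K1 * (polyNorm R + 2) * ((d * (b + 2)) ^ D * (d * (b + 2)) ^ (D * D)) :=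
            Nat.mul_le_mul (Nat.mul_le_mul_left _ (by omega)) (Nat.mul_le_mul h1 h2)
          _ ≤ T := by
            rw [hT, ← pow_add]
            exact Nat.mul_le_mul_left _ (Nat.pow_le_pow_right hbig (by omega))
      have h1 := hcore R hR hg hns hk hRD d b N T hd hb1 hN1 hge hNdb hNT hMT S hSmem
      have h2 := hlog T hT
      have h3 : 0 ≤ Real.log T := le_trans zero_le_one (one_le_log T (by omega))
      have h4 : Real.log T ^ 8 ≤ c ^ 8 * (x * y) ^ 8 := by
        rw [← mul_pow]; exact pow_le_pow_left₀ h3 h2 _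
      calc (S.card : ℝ) ≤ C * ((N : ℝ) ^ m * Real.log T ^ 8) := h1
        _ ≤ C * ((N : ℝ) ^ m * (c ^ 8 * (x * y) ^ 8)) := by gcongr
        _ = C * c ^ 8 * ((N : ℝ) ^ m * (x * y) ^ 8) := by ring
        _ ≤ _ := by
          apply mul_le_mul_of_nonneg_right
          · have : (0 : ℝ) ≤ 3 ^ (m + 1) * D := by positivity
            linarith
          · have : 0 ≤ x * y := by nlinarith
            positivity
  refine hmain.trans ?_
  have hx0 : 0 ≤ x := by linarith
  have hy0 : 0 ≤ y := by linarith
  calc _ ≤ (C * c ^ 8 + 3 ^ (m + 1) * D) * (((d : ℝ) * B) ^ m * (x ^ 8 * y ^ 16)) := by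
        rw [mul_pow]
        gcongr
    _ = _ := by
      rw [Nat.add_sub_cancel]; ring

end

theorem statement12 (n : ℕ) (hn : 2 ≤ n) :
    ∃ e : ℕ, 1 ≤ e ∧ ∀ D : ℕ, ∃ C : ℝ, 0 < C ∧
      ∀ R : Polynomial (MvPolynomial (Fin n) ℤ),
        R.Monic → IsGenuinePoly R → ¬ IsStronglyGenuinePoly R → totalDeg R = D →
        ∀ d : ℕ, 1 ≤ d → ∀ B : ℝ, 1 ≤ B →
          (Set.ncard {z : Fin n → ℤ | (∀ i, |(z i : ℝ)| ≤ d * B) ∧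
              ∃ y : ℤ, Polynomial.eval (y : ℚ)
                ((toQ R).map (MvPolynomial.eval fun i => (z i : ℚ) / (d : ℚ))) = 0} : ℝ) ≤
            C * Real.log ((polyNorm R : ℝ) + 2) ^ e * ((d : ℝ) * B) ^ (n - 1) *
              Real.log ((d : ℝ) * (B + 2)) ^ (2 * e) := by
  exact main12 n hn
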